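/- For every g ≥ 4 and every surjective group homomorphism p from Sp(2g, Z) onto a finite group F, the image p₊(H₂(Sp(2g, Z))) of the map induced by p on second integral homology is a subgroup of H₂(F) of order at most 2; equivalently, 2·p₊(x) = 0 in H₂(F) for every x ∈ H₂(Sp(2g, Z)). -/

import Mathlib

noncomputable section

namespace GpH2

open Finsupp

variable (G : Type) [Group G]

/-- Second boundary map of the bar complex: `(g,h) ↦ [h] - [gh] + [g]`. -/
def d2 : ((G × G) →₀ ℤ) →ₗ[ℤ] (G →₀ ℤ) :=
  Finsupp.linearCombination ℤ fun p : G × G =>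
    Finsupp.single p.2 1 - Finsupp.single (p.1 * p.2) 1 + Finsupp.single p.1 1

/-- Third boundary map of the bar complex:
`(g,h,k) ↦ [(h,k)] - [(gh,k)] + [(g,hk)] - [(g,h)]`. -/
def d3 : ((G × G × G) →₀ ℤ) →ₗ[ℤ] ((G × G) →₀ ℤ) :=
  Finsupp.linearCombination ℤ fun t : G × G × G =>
    Finsupp.single (t.2.1, t.2.2) 1 - Finsupp.single (t.1 * t.2.1, t.2.2) 1
      + Finsupp.single (t.1, t.2.1 * t.2.2) 1 - Finsupp.single (t.1, t.2.1) 1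

/-- 2-cycles. -/
def Z2 : Submodule ℤ ((G × G) →₀ ℤ) := LinearMap.ker (d2 G)

/-- 2-boundaries. -/
def B2 : Submodule ℤ ((G × G) →₀ ℤ) := LinearMap.range (d3 G)

/-- The second homology group of `G` with trivial integral coefficients,
defined via the bar resolution as 2-cycles modulo 2-boundaries. -/
abbrev H2 := ↥(Z2 G) ⧸ (B2 G).comap (Z2 G).subtype

variable {G} {H : Type} [Group H]

/-- The map induced on bar 2-chains by a group homomorphism. -/
def C2 (f : G →* H) : ((G × G) →₀ ℤ) →ₗ[ℤ] ((H × H) →₀ ℤ) :=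
  Finsupp.lmapDomain ℤ ℤ (Prod.map f f)

def C1 (f : G →* H) : (G →₀ ℤ) →ₗ[ℤ] (H →₀ ℤ) :=
  Finsupp.lmapDomain ℤ ℤ f

def C3 (f : G →* H) : ((G × G × G) →₀ ℤ) →ₗ[ℤ] ((H × H × H) →₀ ℤ) :=
  Finsupp.lmapDomain ℤ ℤ (Prod.map f (Prod.map f f))

@[simp] theorem C2_single (f : G →* H) (p : G × G) (n : ℤ) :
    C2 f (Finsupp.single p n) = Finsupp.single (f p.1, f p.2) n := by
  simp [C2, Finsupp.mapDomain_single, Prod.map]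

@[simp] theorem C1_single (f : G →* H) (g : G) (n : ℤ) :
    C1 f (Finsupp.single g n) = Finsupp.single (f g) n := by
  simp [C1, Finsupp.mapDomain_single]

@[simp] theorem C3_single (f : G →* H) (t : G × G × G) (n : ℤ) :
    C3 f (Finsupp.single t n) = Finsupp.single (f t.1, f t.2.1, f t.2.2) n := by
  simp [C3, Finsupp.mapDomain_single, Prod.map]

theorem d2_comm (f : G →* H) : (d2 H).comp (C2 f) = (C1 f).comp (d2 G) := by
  refine Finsupp.lhom_ext fun p n => ?_
  simp only [LinearMap.comp_apply, C2_single, d2, Finsupp.linearCombination_single,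
    map_smul, map_sub, map_add, C1_single, map_mul]

theorem d3_comm (f : G →* H) : (d3 H).comp (C3 f) = (C2 f).comp (d3 G) := by
  refine Finsupp.lhom_ext fun t n => ?_
  simp only [LinearMap.comp_apply, C3_single, d3, Finsupp.linearCombination_single,
    map_smul, map_sub, map_add, C2_single, map_mul]

theorem C2_mem_Z2 (f : G →* H) : ∀ x ∈ Z2 G, C2 f x ∈ Z2 H := by
  intro x hx
  have := congrArg (fun φ => φ x) (d2_comm f)
  simp only [LinearMap.comp_apply] at this
  simp only [Z2, LinearMap.mem_ker] at hx ⊢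
  rw [this, hx, map_zero]

/-- The map induced by a group homomorphism on second homology. -/
def H2Map (f : G →* H) : H2 G →ₗ[ℤ] H2 H :=
  Submodule.mapQ _ _ ((C2 f).restrict (C2_mem_Z2 f)) (by
    rintro ⟨x, hxZ⟩ hx
    simp only [Submodule.mem_comap, Submodule.subtype_apply] at hx ⊢
    simp only [LinearMap.restrict_apply]
    obtain ⟨w, hw⟩ := hx
    have := congrArg (fun φ => φ w) (d3_comm f)
    simp only [LinearMap.comp_apply] at this
    exact ⟨C3 f w, by rw [this, hw]⟩)

end GpH2

open Matrix

/-- The symplectic group `Sp(2g, R)`: matrices `M` (of size `2g`) with `Mᵀ * J * M = J`,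
where `J` is the standard symplectic form (see `SymplecticGroup.mem_iff'`). -/
abbrev Sp (g : ℕ) (R : Type) [CommRing R] : Submonoid (Matrix (Fin g ⊕ Fin g) (Fin g ⊕ Fin g) R) :=
  Matrix.symplecticGroup (Fin g) R

namespace SpAux

variable {g : ℕ} {R S : Type} [CommRing R] [CommRing S]

theorem J_map (f : R →+* S) : (Matrix.J (Fin g) R).map f = Matrix.J (Fin g) S := by
  ext i j
  rcases i with i | i <;> rcases j with j | j <;>
    simp [Matrix.J, Matrix.fromBlocks, Matrix.one_apply, apply_ite f]

theorem map_mem (f : R →+* S) {A : Matrix (Fin g ⊕ Fin g) (Fin g ⊕ Fin g) R}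
    (hA : A ∈ Sp g R) : A.map f ∈ Sp g S := by
  rw [SymplecticGroup.mem_iff] at hA ⊢
  rw [← J_map f, ← Matrix.transpose_map, ← Matrix.map_mul, ← Matrix.map_mul, hA]

/-- The homomorphism `Sp(2g, R) → Sp(2g, S)` induced by a ring homomorphism `R → S`
(entrywise application). -/
def SpMap (f : R →+* S) (g : ℕ) : Sp g R →* Sp g S where
  toFun A := ⟨Matrix.map A.1 f, map_mem f A.2⟩
  map_one' := Subtype.ext <| by
    show ((1 : Matrix _ _ R)).map f = (1 : Matrix _ _ S)
    exact Matrix.map_one f (map_zero f) (map_one f)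
  map_mul' A B := Subtype.ext <| by
    show Matrix.map (A.1 * B.1) f = Matrix.map A.1 f * Matrix.map B.1 f
    exact Matrix.map_mul

end SpAux

end

noncomputable section
set_option linter.unusedSimpArgs false

namespace SymplecticSteinberg
open Matrix

/-- Indices of the standard symplectic basis. -/
abbrev Idx (g : ℕ) := Fin g ⊕ Fin g

variable {g : ℕ} {R : Type} [CommRing R]

/-- The index of the dual basis vector. -/
def bar (i : Idx g) : Idx g := Sum.swap i

/-- The hyperbolic plane containing a basis vector. -/
def pl (i : Idx g) : Fin g := Sum.elim id id i

/-- The sign of the pairing of a basis vector with its dual. -/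
def sg (i : Idx g) : R := Sum.elim (fun _ => -1) (fun _ => 1) i

@[simp, grind =] theorem bar_bar (i : Idx g) : bar (bar i) = i := by simp [bar]
@[simp, grind =] theorem pl_bar (i : Idx g) : pl (bar i) = pl i := by cases i <;> rfl
@[simp] theorem bar_inl (i : Fin g) : bar (Sum.inl i) = Sum.inr i := rfl
@[simp] theorem bar_inr (i : Fin g) : bar (Sum.inr i) = Sum.inl i := rfl
@[simp] theorem pl_inl (i : Fin g) : pl (Sum.inl i) = i := rfl
@[simp] theorem pl_inr (i : Fin g) : pl (Sum.inr i) = i := rfl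
@[simp] theorem sg_inl (i : Fin g) : (sg (Sum.inl i) : R) = -1 := rfl
@[simp] theorem sg_inr (i : Fin g) : (sg (Sum.inr i) : R) = 1 := rfl
@[simp, grind =] theorem sg_bar (i : Idx g) : (sg (bar i) : R) = -sg i := by cases i <;> simp
@[simp, grind =] theorem sg_mul_self (i : Idx g) : (sg i : R) * sg i = 1 := by cases i <;> simp

@[simp] theorem sg_sq (i : Idx g) : (sg i : R) ^ 2 = 1 := by cases i <;> simp

theorem sg_eq (i : Idx g) : (sg i : R) = 1 ∨ (sg i : R) = -1 := by cases i <;> simp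

@[simp, grind .] theorem bar_ne (i : Idx g) : bar i ≠ i := by cases i <;> simp
@[simp, grind .] theorem ne_bar (i : Idx g) : i ≠ bar i := by cases i <;> simp

@[simp] theorem bar_inj {i j : Idx g} : bar i = bar j ↔ i = j :=
  ⟨fun h => by simpa using congrArg bar h, fun h => by rw [h]⟩

@[grind →] theorem eq_or_eq_bar_of_pl_eq {i j : Idx g} (h : pl i = pl j) : i = j ∨ i = bar j := by
  cases i <;> cases j <;> simp_all

@[grind →] theorem eq_of_bar_eq_bar {i j : Idx g} (h : bar i = bar j) : i = j := bar_inj.1 h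

theorem bar_eq_iff {i j : Idx g} : bar i = j ↔ i = bar j := by
  constructor <;> rintro rfl <;> simp

/-- The short relations among the root elements of the symplectic group. -/
structure ShortDatum {R : Type} [CommRing R] {S : Type} [Group S]
    (z : Idx g → Idx g → R → S) : Prop where
  add_short : ∀ i j s t, pl i ≠ pl j → z i j (s + t) = z i j s * z i j t
  symm : ∀ i j t, j ≠ bar i → z i j t = z j i t
  comm_short : ∀ i j k l s t, pl i ≠ pl j → pl k ≠ pl l → k ≠ bar i → k ≠ bar j →
    l ≠ bar i → l ≠ bar j → Commute (z i j s) (z k l t)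
  conj_short : ∀ i j l s t, pl i ≠ pl j → pl i ≠ pl l → pl j ≠ pl l →
    MulAut.conj (z i j s) (z (bar j) l t) = z i l (sg j * s * t) * z (bar j) l t

/-- Elements `z i j t` satisfying the relations of the elementary root elements
of the symplectic group. -/
structure SpDatum {R : Type} [CommRing R] {S : Type} [Group S]
    (z : Idx g → Idx g → R → S) : Prop extends ShortDatum z where
  add_long : ∀ i s t, z i i (s + t) = z i i s * z i i t
  comm_long_short : ∀ i k l s t, pl k ≠ pl l → k ≠ bar i → l ≠ bar i →
    Commute (z i i s) (z k l t)
  comm_long : ∀ i k s t, k ≠ bar i → Commute (z i i s) (z k k t)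
  conj_opp : ∀ i j s t, pl i ≠ pl j →
    MulAut.conj (z i j s) (z (bar j) i t) = z i i (2 * sg j * s * t) * z (bar j) i t
  conj_long : ∀ j l s t, pl j ≠ pl l →
    MulAut.conj (z j j s) (z (bar j) l t) =
      z j l (sg j * s * t) * z l l (-(s * t ^ 2)) * z (bar j) l t

/-- The matrix of an elementary root element. -/
def rootMat (i j : Idx g) (t : R) : Matrix (Idx g) (Idx g) R :=
  if i = j then 1 + single i (bar i) (sg i * t)
  else 1 + single i (bar j) (sg j * t) + single j (bar i) (sg i * t)

theorem rootMat_same (i : Idx g) (t : R) :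
    rootMat i i t = 1 + single i (bar i) (sg i * t) := by simp [rootMat]

theorem rootMat_ne {i j : Idx g} (h : i ≠ j) (t : R) :
    rootMat i j t = 1 + single i (bar j) (sg j * t) + single j (bar i) (sg i * t) := by
  simp [rootMat, h]

theorem single_mul_single_ite (i j k l : Idx g) (a b : R) :
    single i j a * single k l b = if j = k then single i l (a * b) else 0 := by
  split_ifs with h
  · subst h; simp
  · exact single_mul_single_of_ne _ _ _ _ h _

theorem J_apply (i j : Idx g) : J (Fin g) R i j = if j = bar i then sg i else 0 := by
  cases i <;> cases j <;> (simp [J, Matrix.one_apply, eq_comm]; try split_ifs <;> simp)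

theorem single_mul_J (k l : Idx g) (a : R) :
    single k l a * J (Fin g) R = single k (bar l) (sg l * a) := by
  ext p q
  by_cases hk : p = k
  · subst hk
    rw [single_mul_apply_same, J_apply, single_apply]
    by_cases hl : q = bar l <;> simp [hl, eq_comm, mul_comm]
  · rw [single_mul_apply_of_ne _ _ _ _ _ hk, single_apply_of_row_ne (Ne.symm hk)]

theorem J_mul_single (k l : Idx g) (a : R) :
    J (Fin g) R * single k l a = single (bar k) l (-(sg k * a)) := by
  ext p q
  by_cases hl : q = l
  · subst hl
    rw [mul_single_apply_same, J_apply, single_apply]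
    by_cases hk : k = bar p
    · subst hk; simp
    · have : bar k ≠ p := fun h => hk (by rw [← h, bar_bar])
      simp [hk, this]
  · rw [mul_single_apply_of_ne _ _ _ _ _ hl, single_apply_of_col_ne _ _ (Ne.symm hl)]

theorem rootMat_mem (i j : Idx g) (hij : j ≠ bar i) (t : R) : rootMat i j t ∈ Sp g R := by
  rw [SymplecticGroup.mem_iff]
  have h1 : i ≠ bar j := fun h => hij (by rw [h, bar_bar])
  have h2 : bar j ≠ i := Ne.symm h1
  have h3 : bar i ≠ j := Ne.symm hij
  by_cases h : i = j
  · subst h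
    simp only [rootMat_same, transpose_add, transpose_one, transpose_single, add_mul, mul_add,
      one_mul, mul_one, single_mul_J, J_mul_single, single_mul_single_ite]
    simp [← single_neg, add_assoc]
  · simp only [rootMat_ne h, transpose_add, transpose_one, transpose_single, add_mul, mul_add,
      one_mul, mul_one, single_mul_J, J_mul_single, single_mul_single_ite]
    simp [← single_neg, h, h1, h2, h3, hij, Ne.symm h, ← mul_assoc]

theorem rootMat_add (i j : Idx g) (hij : j ≠ bar i) (s t : R) :
    rootMat i j (s + t) = rootMat i j s * rootMat i j t := by
  have h1 : i ≠ bar j := fun h => hij (by rw [h, bar_bar])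
  have h2 : bar j ≠ i := Ne.symm h1
  have h3 : bar i ≠ j := Ne.symm hij
  by_cases h : i = j
  · subst h
    simp only [rootMat_same, add_mul, mul_add,
      one_mul, mul_one, single_mul_single_ite, single_add]
    simp [add_assoc]
  · simp only [rootMat_ne h, add_mul, mul_add,
      one_mul, mul_one, single_mul_single_ite, single_add]
    simp [h, h2, h3, Ne.symm h]
    abel

theorem rootMat_symm (i j : Idx g) (t : R) : rootMat i j t = rootMat j i t := by
  by_cases h : i = j
  · rw [h]
  · rw [rootMat_ne h, rootMat_ne (Ne.symm h)]; abel

theorem rootMat_conj_short (i j l : Idx g) (s t : R) (h1 : pl i ≠ pl j) (h2 : pl i ≠ pl l)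
    (h3 : pl j ≠ pl l) :
    rootMat i j s * rootMat (bar j) l t =
      rootMat i l (sg j * s * t) * rootMat (bar j) l t * rootMat i j s := by
  have e1 : i ≠ j := by grind
  have e2 : i ≠ l := by grind
  have e3 : bar j ≠ l := by grind
  have e4 : bar i ≠ l := by grind
  have e5 : bar i ≠ j := by grind
  have e6 : bar l ≠ j := by grind
  have e7 : bar l ≠ i := by grind
  have e8 : l ≠ j := by grind
  simp only [rootMat_ne e1, rootMat_ne e2, rootMat_ne e3, add_mul, mul_add, one_mul, mul_one,
    single_mul_single_ite, bar_bar, sg_bar]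
  simp [e1, e2, e3, e4, e5, e6, e7, e8, e1.symm, e2.symm, e3.symm, e4.symm, e5.symm, e6.symm,
    e7.symm, e8.symm, bar_eq_iff, ← single_neg]
  ring_nf
  abel

theorem rootMat_comm (i j k l : Idx g) (s t : R) (h1 : k ≠ bar i) (h2 : k ≠ bar j)
    (h3 : l ≠ bar i) (h4 : l ≠ bar j) :
    rootMat i j s * rootMat k l t = rootMat k l t * rootMat i j s := by
  have e1 : bar l ≠ i := by grind
  have e2 : bar l ≠ j := by grind
  have e3 : bar k ≠ i := by grind
  have e4 : bar k ≠ j := by grind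
  unfold rootMat
  split_ifs <;>
  · simp only [add_mul, mul_add, one_mul, mul_one, single_mul_single_ite, bar_bar, sg_bar]
    simp [h1, h2, h3, h4, e1, e2, e3, e4, h1.symm, h2.symm, h3.symm, h4.symm]
    abel

theorem rootMat_conj_opp (i j : Idx g) (s t : R) (h1 : pl i ≠ pl j) :
    rootMat i j s * rootMat (bar j) i t =
      rootMat i i (2 * sg j * s * t) * rootMat (bar j) i t * rootMat i j s := by
  rw [show 2 * sg j * s * t = sg j * s * t + sg j * s * t by ring]
  have e1 : i ≠ j := by grind
  have e3 : bar j ≠ i := by grind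
  have e5 : bar i ≠ j := by grind
  simp only [rootMat_ne e1, rootMat_ne e3, rootMat_same, add_mul, mul_add, one_mul, mul_one,
    single_mul_single_ite, bar_bar, sg_bar, single_add]
  simp [e1, e3, e5, e1.symm, e3.symm, e5.symm, bar_eq_iff, ← single_neg]
  ring_nf
  abel

theorem rootMat_conj_long (j l : Idx g) (s t : R) (h1 : pl j ≠ pl l) :
    rootMat j j s * rootMat (bar j) l t =
      rootMat j l (sg j * s * t) * rootMat l l (-(s * t ^ 2)) * rootMat (bar j) l t *
        rootMat j j s := by
  have e1 : j ≠ l := by grind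
  have e3 : bar j ≠ l := by grind
  simp only [rootMat_ne e1, rootMat_ne e3, rootMat_same, add_mul, mul_add, one_mul, mul_one,
    single_mul_single_ite, bar_bar, sg_bar]
  simp [e1, e3, e1.symm, e3.symm, bar_eq_iff, ← single_neg]
  ring_nf
  simp only [sg_sq, one_mul]
  abel

/-- The elementary root elements of the symplectic group (trivial for opposite indices). -/
def rootSp (i j : Idx g) (t : R) : Sp g R :=
  if h : j ≠ bar i then ⟨rootMat i j t, rootMat_mem i j h t⟩ else 1

theorem rootSp_coe {i j : Idx g} (h : j ≠ bar i) (t : R) :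
    (rootSp i j t : Matrix (Idx g) (Idx g) R) = rootMat i j t := by
  simp [rootSp, h]

theorem conj_eq_iff {S : Type} [Group S] {a b c : S} : MulAut.conj a b = c ↔ a * b = c * a := by
  rw [MulAut.conj_apply, mul_inv_eq_iff_eq_mul]

theorem spDatum_rootSp : SpDatum (rootSp : Idx g → Idx g → R → Sp g R) where
  add_short i j s t h := by
    have h : j ≠ bar i := by grind
    exact Subtype.ext (by simp only [rootSp_coe h, Submonoid.coe_mul, rootMat_add i j h])
  symm i j t h := by
    have h' : i ≠ bar j := by grind
    exact Subtype.ext (by simp only [rootSp_coe h, rootSp_coe h', rootMat_symm i j])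
  comm_short i j k l s t h1 h2 h3 h4 h5 h6 := by
    have h : j ≠ bar i := by grind
    have h' : l ≠ bar k := by grind
    exact Subtype.ext (by
      simp only [rootSp_coe h, rootSp_coe h', Submonoid.coe_mul, rootMat_comm i j k l s t h3 h4 h5 h6])
  conj_short i j l s t h1 h2 h3 := by
    have e1 : j ≠ bar i := by grind
    have e2 : l ≠ bar (bar j) := by grind
    have e3 : l ≠ bar i := by grind
    rw [conj_eq_iff]
    exact Subtype.ext (by
      simp only [rootSp_coe e1, rootSp_coe e2, rootSp_coe e3, Submonoid.coe_mul,
        rootMat_conj_short i j l s t h1 h2 h3])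
  add_long i s t := by
    exact Subtype.ext (by
      simp only [rootSp_coe (ne_bar i), Submonoid.coe_mul, rootMat_add i i (ne_bar i)])
  comm_long_short i k l s t h1 h2 h3 := by
    have h' : l ≠ bar k := by grind
    exact Subtype.ext (by
      simp only [rootSp_coe (ne_bar i), rootSp_coe h', Submonoid.coe_mul,
        rootMat_comm i i k l s t h2 h2 h3 h3])
  comm_long i k s t h := by
    exact Subtype.ext (by
      simp only [rootSp_coe (ne_bar _), Submonoid.coe_mul,
        rootMat_comm i i k k s t h h h h])
  conj_opp i j s t h := by
    have e1 : j ≠ bar i := by grind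
    have e2 : i ≠ bar (bar j) := by grind
    rw [conj_eq_iff]
    exact Subtype.ext (by
      simp only [rootSp_coe e1, rootSp_coe e2, rootSp_coe (ne_bar _), Submonoid.coe_mul,
        rootMat_conj_opp i j s t h])
  conj_long j l s t h := by
    have e1 : l ≠ bar j := by grind
    have e2 : l ≠ bar (bar j) := by grind
    rw [conj_eq_iff]
    exact Subtype.ext (by
      simp only [rootSp_coe e1, rootSp_coe e2, rootSp_coe (ne_bar _), Submonoid.coe_mul,
        rootMat_conj_long j l s t h])

end SymplecticSteinberg

namespace SymplecticSteinberg
open Matrix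
variable {g : ℕ}

theorem rootMat_mul_apply {R : Type} [CommRing R] (i j : Idx g) (t : R)
    (M : Matrix (Idx g) (Idx g) R) (q p : Idx g) :
    (rootMat i j t * M) q p = M q p + (if q = i then sg j * t * M (bar j) p else 0) +
      (if q = j ∧ i ≠ j then sg i * t * M (bar i) p else 0) := by
  have h (k l : Idx g) (a : R) : (single k l a * M) q p = if q = k then a * M l p else 0 := by
    split_ifs with h
    · subst h; simp
    · simp [h]
  by_cases hij : i = j
  · subst hij; simp [rootMat_same, add_mul, h]
  · simp [rootMat_ne hij, add_mul, h, hij]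

theorem rootSp_mul_apply {R : Type} [CommRing R] {i j : Idx g} (hij : j ≠ bar i) (t : R)
    (N : Sp g R) (q p : Idx g) :
    (rootSp i j t * N).1 q p = N.1 q p + (if q = i then sg j * t * N.1 (bar j) p else 0) +
      (if q = j ∧ i ≠ j then sg i * t * N.1 (bar i) p else 0) := by
  rw [Submonoid.coe_mul, rootSp_coe hij, rootMat_mul_apply]

theorem row_of_col {R : Type} [CommRing R] (A : Sp g R) (l : Idx g)
    (h : ∀ q, A.1 q l = if q = l then 1 else 0) (p : Idx g) :
    A.1 (bar l) p = if p = bar l then 1 else 0 := by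
  have h1 : (A.1ᵀ * J (Fin g) R * A.1) l p = J (Fin g) R l p := by
    rw [SymplecticGroup.mem_iff'.1 A.2]
  simp only [Matrix.mul_assoc, Matrix.mul_apply, transpose_apply, h, J_apply, ite_mul, one_mul,
    zero_mul, Finset.sum_ite_eq', Finset.sum_ite_eq, Finset.mem_univ, if_true] at h1
  have h2 := congrArg (fun x => sg l * x) h1
  simpa [← mul_assoc] using h2

theorem exists_column_entry_ne_zero (A : Sp g ℤ) (p : Idx g) :
    ∃ q, A.1 q p ≠ 0 := by
  by_contra! h
  have h1 : (A⁻¹ * A).1 p p = 1 := by simp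
  rw [Submonoid.coe_mul, Matrix.mul_apply] at h1
  simp [h] at h1

theorem isUnit_of_column_single (A : Sp g ℤ) (p l : Idx g) (h : ∀ q, q ≠ l → A.1 q p = 0) :
    A.1 l p = 1 ∨ A.1 l p = -1 := by
  have h1 : (A⁻¹ * A).1 p p = 1 := by simp
  rw [Submonoid.coe_mul, Matrix.mul_apply, Finset.sum_eq_single l] at h1
  · exact Int.isUnit_iff.1 (IsUnit.of_mul_eq_one_right _ h1)
  · intro b _ hb; simp [h b hb]
  · simp

/-- A family of matrices stable under left multiplication by the root elements whose indices
lie in planes at least `k`. -/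
def StepClosed (k : ℕ) (P : Sp g ℤ → Prop) : Prop :=
  ∀ i j t N, k ≤ pl i → k ≤ pl j → j ≠ bar i → P N → P (rootSp i j t * N)

theorem StepClosed.exists_monomial_column {k : ℕ} {P : Sp g ℤ → Prop} (hP : StepClosed k P)
    (hne : ∃ N, P N) (p : Idx g) (hz : ∀ N q, P N → (pl q : ℕ) < k → N.1 q p = 0) :
    ∃ N l, P N ∧ k ≤ pl l ∧ ∀ q, q ≠ l → N.1 q p = 0 := by
  obtain ⟨N, hN, hmin⟩ : ∃ N, P N ∧ ∀ N', P N' →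
      ∑ q, (N.1 q p).natAbs ≤ ∑ q, (N'.1 q p).natAbs := by
    obtain ⟨N, hN, h⟩ := exists_minimalFor_of_wellFoundedLT P
      (fun N => ∑ q, (N.1 q p).natAbs) hne
    refine ⟨N, hN, fun N' h' => ?_⟩
    rcases le_total (∑ q, (N.1 q p).natAbs) (∑ q, (N'.1 q p).natAbs) with h1 | h1
    · exact h1
    · exact h h' h1
  have key : ∀ i (c : ℤ) N', P N' → (∀ q, q ≠ i → N'.1 q p = N.1 q p) →
      N'.1 i p = N.1 i p + c → (N.1 i p).natAbs ≤ (N.1 i p + c).natAbs := by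
    intro i c N' h1 h2 h3
    by_contra! h4
    refine absurd (hmin N' h1) (not_le.2 (Finset.sum_lt_sum (fun q _ => ?_)
      ⟨i, Finset.mem_univ _, by rw [h3]; exact h4⟩))
    by_cases hq : q = i
    · subst hq; rw [h3]; exact h4.le
    · rw [h2 q hq]
  have hsupp : ∀ q, N.1 q p ≠ 0 → k ≤ pl q := fun q h => by
    by_contra! h'; exact h (hz N q hN h')
  have one : ∀ i, N.1 i p ≠ 0 → N.1 (bar i) p ≠ 0 →
      (N.1 i p).natAbs < (N.1 (bar i) p).natAbs := by
    intro i h1 h2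
    by_contra! h3
    have hk := hsupp i h1
    have a (t : ℤ) := key i (sg i * t * N.1 (bar i) p) _ (hP i i t N hk hk (ne_bar i) hN)
      (by intro q hq; rw [rootSp_mul_apply (ne_bar i)]; simp [hq])
      (by rw [rootSp_mul_apply (ne_bar i)]; simp)
    have a1 := a 1
    have a2 := a (-1)
    rcases sg_eq (R := ℤ) i with h | h <;> rw [h] at a1 a2 <;> omega
  have two : ∀ i, N.1 i p ≠ 0 → N.1 (bar i) p = 0 := by
    intro i h1
    by_contra h2
    have := one i h1 h2
    have := one (bar i) h2 (by simpa using h1)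
    rw [bar_bar] at this
    omega
  have three : ∀ i j, i ≠ j → N.1 i p ≠ 0 → N.1 j p ≠ 0 →
      (N.1 i p).natAbs < (N.1 j p).natAbs := by
    intro i j hij h1 h2
    by_contra! h3
    have hi := hsupp i h1
    have hj := hsupp j h2
    have hb : i ≠ bar j := by
      rintro rfl
      exact h1 (two j h2)
    have hij' : bar j ≠ bar i := by simpa using hij.symm
    have a (t : ℤ) := key i (sg (bar j) * t * N.1 j p) _
      (hP i (bar j) t N hi (by simpa using hj) hij' hN)
      (by intro q hq; rw [rootSp_mul_apply hij']; simp [hq, two i h1])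
      (by rw [rootSp_mul_apply hij']; simp [hb])
    have a1 := a 1
    have a2 := a (-1)
    rcases sg_eq (R := ℤ) (bar j) with h | h <;> rw [h] at a1 a2 <;> omega
  obtain ⟨l, hl⟩ := exists_column_entry_ne_zero N p
  refine ⟨N, l, hN, hsupp l hl, fun q hq => ?_⟩
  by_contra h
  have := three q l hq h hl
  have := three l q (Ne.symm hq) hl h
  omega

theorem StepClosed.move_column {k : ℕ} {P : Sp g ℤ → Prop} (hP : StepClosed k P)
    (p l m : Idx g) (hl : k ≤ pl l) (hm : k ≤ pl m) (hlm : l ≠ m) (N : Sp g ℤ) (hN : P N)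
    (h : ∀ q, q ≠ l → N.1 q p = 0) :
    ∃ N', P N' ∧ ∀ q, N'.1 q p = if q = m then 1 else 0 := by
  have e1 : bar l ≠ bar m := by simpa using hlm
  have e2 : bar m ≠ bar l := by simpa using hlm.symm
  set ε := N.1 l p with hε
  have hu : ε * ε = 1 := by
    rcases isUnit_of_column_single N p l h with h | h <;> rw [hε, h] <;> norm_num
  have hval : ∀ q, N.1 q p = if q = l then ε else 0 := by
    intro q; split_ifs with hq
    · rw [hq]
    · exact h q hq
  let N1 := rootSp m (bar l) (-(sg l : ℤ) * ε) * N
  have hN1 : P N1 := hP _ _ _ _ hm (by simpa using hl) e1 hN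
  have h1 : ∀ q, N1.1 q p = (if q = l then ε else 0) + if q = m then 1 else 0 := by
    intro q
    have hbm : (q = bar l ∧ m ≠ bar l) → bar m ≠ l := by
      rintro ⟨-, h⟩ h'; exact h (by rw [← h', bar_bar])
    rw [rootSp_mul_apply e1]
    simp only [hval, bar_bar, if_true, sg_bar]
    have : -sg l * (-sg l * ε) * ε = (sg l * sg l) * (ε * ε) := by ring
    rw [this, hu, sg_mul_self]
    by_cases hc : q = bar l ∧ m ≠ bar l
    · simp [hbm hc, hc]
    · rw [if_neg hc]; simp
  refine ⟨rootSp l (bar m) ((sg m : ℤ) * ε) * N1,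
    hP _ _ _ _ hl (by simpa using hm) e2 hN1, fun q => ?_⟩
  rw [rootSp_mul_apply e2]
  simp only [h1, bar_bar, if_true, sg_bar, if_neg hlm.symm]
  have : -sg m * (sg m * ε) * (0 + 1) = - ((sg m * sg m) * ε) := by ring
  rw [this, sg_mul_self]
  have hb : (q = bar m ∧ l ≠ bar m) → bar l ≠ m := by
    rintro ⟨-, h⟩ h'; exact h (by rw [← h', bar_bar])
  by_cases hc : q = bar m ∧ l ≠ bar m
  · rw [if_pos hc]
    have h3 : bar l ≠ l := bar_ne l
    simp [hb hc, h3]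
    split_ifs <;> simp
  · rw [if_neg hc]
    split_ifs <;> simp

theorem StepClosed.exists_std_column {k : ℕ} {P : Sp g ℤ → Prop} (hP : StepClosed k P)
    (hne : ∃ N, P N) (p : Idx g) (hp : k ≤ pl p)
    (hz : ∀ N q, P N → (pl q : ℕ) < k → N.1 q p = 0) :
    ∃ N, P N ∧ ∀ q, N.1 q p = if q = p then 1 else 0 := by
  obtain ⟨N, l, hN, hl, h⟩ := hP.exists_monomial_column hne p hz
  by_cases hlp : l = p
  · subst hlp
    obtain ⟨N1, hN1, h1⟩ := hP.move_column l l (bar l) hl (by simpa using hl) (ne_bar l) N hN h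
    exact hP.move_column l (bar l) l (by simpa using hl) hl (bar_ne l) N1 hN1
      (fun q hq => by rw [h1, if_neg hq])
  · exact hP.move_column p l p hl hp hlp N hN h

theorem StepClosed.exists_std_pair {k : ℕ} {P : Sp g ℤ → Prop} (hP : StepClosed k P)
    (hne : ∃ N, P N) (p : Idx g) (hp : k ≤ pl p)
    (hz : ∀ N q r, pl r = pl p → P N → (pl q : ℕ) < k → N.1 q r = 0) :
    ∃ N, P N ∧ (∀ q, N.1 q p = if q = p then 1 else 0) ∧
      ∀ q, N.1 q (bar p) = if q = bar p then 1 else 0 := by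
  obtain ⟨N, hN, h⟩ := hP.exists_std_column hne p hp (fun N q => hz N q p rfl)
  have step : ∀ T : Finset (Idx g), (∀ l ∈ T, pl l ≠ pl p ∧ k ≤ pl l) → ∃ N, P N ∧
      (∀ q, N.1 q p = if q = p then 1 else 0) ∧ ∀ q ∈ T, N.1 q (bar p) = 0 := by
    intro T
    induction T using Finset.induction_on with
    | empty => intro _; exact ⟨N, hN, h, by simp⟩
    | insert l T hl ih =>
      intro hT
      obtain ⟨N, hN, h, hT'⟩ := ih (fun x hx => hT x (Finset.mem_insert_of_mem hx))
      obtain ⟨hl1, hl2⟩ := hT l (Finset.mem_insert_self _ _)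
      have e : l ≠ bar p := by grind
      have e' : bar l ≠ p := by grind
      have e'' : p ≠ l := by grind
      refine ⟨rootSp p l (-(sg p : ℤ) * N.1 l (bar p)) * N, hP _ _ _ _ hp hl2 e hN,
        fun q => ?_, fun q hq => ?_⟩
      · rw [rootSp_mul_apply e]; simp [h, e']
      · rw [rootSp_mul_apply e, row_of_col N p h]
        have hqp : q ≠ p := by
          intro hqp
          exact (hT q hq).1 (by rw [hqp])
        rcases Finset.mem_insert.1 hq with rfl | hq
        · simp [hqp, e'', ← mul_assoc]
        · have : q ≠ l := fun h => hl (h ▸ hq)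
          simp [hqp, this, hT' q hq]
  obtain ⟨N, hN, h, hT⟩ := step (Finset.univ.filter fun l => pl l ≠ pl p ∧ k ≤ pl l) (by simp)
  refine ⟨rootSp p p (-(sg p : ℤ) * N.1 p (bar p)) * N, hP _ _ _ _ hp hp (ne_bar p) hN,
    fun q => ?_, fun q => ?_⟩
  · rw [rootSp_mul_apply (ne_bar p)]; simp [h]
  · rw [rootSp_mul_apply (ne_bar p), row_of_col N p h]
    by_cases hq : q = p
    · subst hq; simp [← mul_assoc]
    · by_cases hq' : q = bar p
      · subst hq'; simp [row_of_col N p h]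
      · have : pl q ≠ pl p := by grind
        by_cases hk : k ≤ pl q
        · simp [hq, hq', hT q (by simp [hk, this])]
        · simp [hq, hq', hz N q (bar p) (by simp) hN (by omega)]

theorem closure_rootSp_one_of_std : ∀ (d k : ℕ), k + d = g → ∀ M : Sp g ℤ,
    (∀ l q, (pl l : ℕ) < k → M.1 q l = if q = l then 1 else 0) →
    M ∈ Subgroup.closure {x : Sp g ℤ | ∃ i j t, j ≠ bar i ∧ x = rootSp i j t} := by
  intro d
  induction d with
  | zero =>
    intro k hk M h
    have : M = 1 := by
      apply Subtype.ext
      ext q l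
      rw [h l q (by omega)]
      simp [Matrix.one_apply]
    rw [this]; exact one_mem _
  | succ d ih =>
    intro k hk M h
    set E := Subgroup.closure {x : Sp g ℤ | ∃ i j t, j ≠ bar i ∧ x = rootSp i j t} with hE
    let P : Sp g ℤ → Prop := fun N => N * M⁻¹ ∈ E ∧
      ∀ l q, (pl l : ℕ) < k → N.1 q l = if q = l then 1 else 0
    have hP : StepClosed k P := by
      rintro i j t N hi hj hij ⟨h1, h2⟩
      refine ⟨?_, fun l q hl => ?_⟩
      · rw [mul_assoc]
        exact mul_mem (Subgroup.subset_closure ⟨i, j, t, hij, rfl⟩) h1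
      · have a1 : bar j ≠ l := by rintro rfl; simp at hl; omega
        have a2 : bar i ≠ l := by rintro rfl; simp at hl; omega
        rw [rootSp_mul_apply hij, h2 l q hl, h2 l _ hl, h2 l _ hl]
        simp [a1, a2]
    let p : Idx g := Sum.inl ⟨k, by omega⟩
    obtain ⟨N, ⟨hN1, hN2⟩, h3, h4⟩ := hP.exists_std_pair ⟨M, by simp [P], h⟩ p (by simp [p])
      (by
        rintro N q r hr ⟨-, h2⟩ hq
        have := row_of_col N (bar q) (fun q' => h2 (bar q) q' (by simpa using hq)) r
        rw [bar_bar] at this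
        rw [this, if_neg]
        rintro rfl
        rw [hr] at hq
        simp [p] at hq)
    have hNE : N ∈ E := by
      refine ih (k + 1) (by omega) N (fun l q hl => ?_)
      by_cases hl' : (pl l : ℕ) < k
      · exact hN2 l q hl'
      · have : pl l = pl p := Fin.ext (by simp [p]; omega)
        rcases eq_or_eq_bar_of_pl_eq this with rfl | rfl
        · exact h3 q
        · exact h4 q
    have := mul_mem (inv_mem hN1) hNE
    simpa using this

theorem SpDatum.add {R : Type} [CommRing R] {S : Type} [Group S] {z : Idx g → Idx g → R → S}
    (hz : SpDatum z) (i j : Idx g) (hij : j ≠ bar i) (s t : R) :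
    z i j (s + t) = z i j s * z i j t := by
  by_cases h : pl i = pl j
  · have : i = j := by grind
    subst this; exact hz.add_long i s t
  · exact hz.add_short i j s t h

/-- A root subgroup as a homomorphism. -/
def SpDatum.hom {R : Type} [CommRing R] {S : Type} [Group S] {z : Idx g → Idx g → R → S}
    (hz : SpDatum z) (i j : Idx g) (hij : j ≠ bar i) : Multiplicative R →* S :=
  MonoidHom.mk' (fun t => z i j t.toAdd) (fun s t => hz.add i j hij s.toAdd t.toAdd)

theorem SpDatum.zpow {S : Type} [Group S] {z : Idx g → Idx g → ℤ → S}
    (hz : SpDatum z) (i j : Idx g) (hij : j ≠ bar i) (n : ℤ) : z i j n = z i j 1 ^ n := by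
  have := map_zpow (hz.hom i j hij) (Multiplicative.ofAdd 1) n
  simpa [SpDatum.hom, ← ofAdd_zsmul] using this

theorem closure_rootSp_one :
    Subgroup.closure {x : Sp g ℤ | ∃ i j, j ≠ bar i ∧ x = rootSp i j 1} = ⊤ := by
  have hle : Subgroup.closure {x : Sp g ℤ | ∃ i j t, j ≠ bar i ∧ x = rootSp i j t} ≤
      Subgroup.closure {x : Sp g ℤ | ∃ i j, j ≠ bar i ∧ x = rootSp i j 1} := by
    rw [Subgroup.closure_le]
    rintro x ⟨i, j, t, hij, rfl⟩
    rw [SetLike.mem_coe, spDatum_rootSp.zpow i j hij]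
    have hmem : (rootSp i j 1 : Sp g ℤ) ∈
        Subgroup.closure {x : Sp g ℤ | ∃ i j, j ≠ bar i ∧ x = rootSp i j 1} :=
      Subgroup.subset_closure ⟨i, j, hij, rfl⟩
    exact Subgroup.zpow_mem _ hmem t
  exact top_le_iff.1 fun M _ => hle (closure_rootSp_one_of_std g 0 (by simp) M (by simp))

end SymplecticSteinberg

namespace SymplecticSteinberg
variable {g : ℕ} {R : Type} [CommRing R] {S : Type} [Group S] {z : Idx g → Idx g → R → S}

theorem conj_of_commute {a b : S} (h : Commute a b) : MulAut.conj a b = b :=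
  conj_eq_iff.2 h.eq

namespace ShortDatum
variable (hz : ShortDatum z)
include hz

theorem zero {i j : Idx g} (h : pl i ≠ pl j) : z i j 0 = 1 := by
  have := hz.add_short i j 0 0 h
  rw [add_zero] at this
  exact left_eq_mul.1 this

theorem neg {i j : Idx g} (h : pl i ≠ pl j) (t : R) : z i j (-t) = (z i j t)⁻¹ := by
  rw [eq_inv_iff_mul_eq_one, ← hz.add_short i j _ _ h, neg_add_cancel, hz.zero h]

theorem conj_eq (i j l : Idx g) (s t : R) (h1 : pl i ≠ pl j) (h2 : pl i ≠ pl l)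
    (h3 : pl j ≠ pl l) :
    z i l (sg j * s * t) = MulAut.conj (z i j s) (z (bar j) l t) * (z (bar j) l t)⁻¹ := by
  rw [hz.conj_short i j l s t h1 h2 h3, mul_inv_cancel_right]

end ShortDatum

/-- The Weyl element attached to a pair of opposite root elements of short type. -/
def wShort (z : Idx g → Idx g → R → S) (i j : Idx g) (u : Rˣ) : S :=
  z i j u * z (bar i) (bar j) (sg i * sg j * ↑u⁻¹) * z i j u

/-- The Weyl element attached to a pair of opposite root elements of long type. -/
def wLong (z : Idx g → Idx g → R → S) (j : Idx g) (u : Rˣ) : S :=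
  z j j u * z (bar j) (bar j) ↑u⁻¹ * z j j u

theorem ShortDatum.wShort_symm (hz : ShortDatum z) {i j : Idx g} (h : j ≠ bar i) (u : Rˣ) :
    wShort z i j u = wShort z j i u := by
  have h' : bar j ≠ bar (bar i) := by simpa [bar_eq_iff] using h
  rw [wShort, wShort, hz.symm i j _ h, hz.symm (bar i) (bar j) _ h', mul_comm (sg i) (sg j)]

theorem ShortDatum.wShort_conj_bar (hz : ShortDatum z) (i j l : Idx g) (u : Rˣ) (t : R)
    (h1 : pl i ≠ pl j) (h2 : pl i ≠ pl l) (h3 : pl j ≠ pl l) :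
    MulAut.conj (wShort z i j u) (z (bar j) l t) = z i l (sg j * u * t) := by
  have e1 : MulAut.conj (z (bar i) (bar j) (sg i * sg j * ↑u⁻¹)) (z (bar j) l t) = z (bar j) l t :=
    conj_of_commute (hz.comm_short _ _ _ _ _ _ (by simpa) (by simpa) (by grind) (by grind)
      (by grind) (by grind))
  have e2 : MulAut.conj (z i j u) (z i l (sg j * u * t)) = z i l (sg j * u * t) :=
    conj_of_commute (hz.comm_short _ _ _ _ _ _ (by simpa) (by simpa) (by grind) (by grind)
      (by grind) (by grind))
  have e3 : MulAut.conj (z (bar i) (bar j) (sg i * sg j * ↑u⁻¹)) (z i l (sg j * u * t)) =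
      z (bar j) l (-t) * z i l (sg j * u * t) := by
    rw [hz.symm (bar i) (bar j) _ (by grind)]
    have := hz.conj_short (bar j) (bar i) l (sg i * sg j * ↑u⁻¹) (sg j * u * t)
      (by simpa using h1.symm) (by simpa) (by simpa)
    rw [bar_bar] at this
    rw [this]
    congr 2
    rw [sg_bar]
    linear_combination (-t * sg i ^ 2 * sg j ^ 2) * u.inv_mul - sg i ^ 2 * t * sg_sq (R := R) j
      - t * sg_sq (R := R) i
  rw [wShort, map_mul, map_mul, MulAut.mul_apply, MulAut.mul_apply,
    hz.conj_short i j l _ _ h1 h2 h3, map_mul, map_mul, e1, e3, map_mul, e2,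
    hz.conj_short i j l _ _ h1 h2 h3, hz.conj_short i j l _ _ h1 h2 h3, hz.neg (by simpa),
    mul_neg, hz.neg (by simpa)]
  have c : Commute (z i l (sg j * u * t)) (z (bar j) l t) :=
    hz.comm_short _ _ _ _ _ _ (by simpa) (by simpa) (by grind) (by grind) (by grind) (by grind)
  generalize z i l (sg j * u * t) = X at *
  generalize z (bar j) l t = Y at *
  simp only [mul_assoc, c.eq]
  simp [← mul_assoc]
  rw [mul_assoc, c.eq]
  group

theorem ShortDatum.wShort_conj (hz : ShortDatum z) (i j l : Idx g) (u : Rˣ) (t : R)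
    (h1 : pl i ≠ pl j) (h2 : pl i ≠ pl l) (h3 : pl j ≠ pl l) :
    MulAut.conj (wShort z i j u) (z i l t) = z (bar j) l (-(sg j * ↑u⁻¹ * t)) := by
  have e1 : MulAut.conj (z i j u) (z i l t) = z i l t :=
    conj_of_commute (hz.comm_short _ _ _ _ _ _ (by simpa) (by simpa) (by grind) (by grind)
      (by grind) (by grind))
  have e3 : MulAut.conj (z (bar i) (bar j) (sg i * sg j * ↑u⁻¹)) (z i l t) =
      z (bar j) l (-(sg j * ↑u⁻¹ * t)) * z i l t := by
    rw [hz.symm (bar i) (bar j) _ (by grind)]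
    have := hz.conj_short (bar j) (bar i) l (sg i * sg j * ↑u⁻¹) t
      (by simpa using h1.symm) (by simpa) (by simpa)
    rw [bar_bar] at this
    rw [this]
    congr 2
    rw [sg_bar]
    linear_combination (-sg j * ↑u⁻¹ * t) * sg_sq (R := R) i
  have e4 : sg j * (u : R) * -(sg j * ↑u⁻¹ * t) = -t := by
    linear_combination (-t * sg j ^ 2) * u.mul_inv - t * sg_sq (R := R) j
  have c : Commute (z i l t) (z (bar j) l (-(sg j * ↑u⁻¹ * t))) :=
    hz.comm_short _ _ _ _ _ _ (by simpa) (by simpa) (by grind) (by grind) (by grind) (by grind)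
  rw [wShort, map_mul, map_mul, MulAut.mul_apply, MulAut.mul_apply, e1, e3, map_mul, e1,
    hz.conj_short i j l _ _ h1 h2 h3, e4, hz.neg (by simpa), mul_assoc, ← c.eq,
    inv_mul_cancel_left]

namespace SpDatum
variable (hz : SpDatum z)
include hz

theorem zero {i j : Idx g} (h : j ≠ bar i) : z i j 0 = 1 := by
  have := hz.add i j h 0 0
  rw [add_zero] at this
  exact left_eq_mul.1 this

theorem neg {i j : Idx g} (h : j ≠ bar i) (t : R) : z i j (-t) = (z i j t)⁻¹ := by
  rw [eq_inv_iff_mul_eq_one, ← hz.add i j h, neg_add_cancel, hz.zero h]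

theorem comm (i j k l : Idx g) (s t : R) (hij : j ≠ bar i) (hkl : l ≠ bar k) (h1 : k ≠ bar i)
    (h2 : k ≠ bar j) (h3 : l ≠ bar i) (h4 : l ≠ bar j) : Commute (z i j s) (z k l t) := by
  by_cases e1 : pl i = pl j
  · have : i = j := by grind
    subst this
    by_cases e2 : pl k = pl l
    · have : k = l := by grind
      subst this
      exact hz.comm_long _ _ _ _ h1
    · exact hz.comm_long_short _ _ _ _ _ e2 h1 h3
  · by_cases e2 : pl k = pl l
    · have : k = l := by grind
      subst this
      exact (hz.comm_long_short _ _ _ _ _ e1 (by grind) (by grind)).symm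
    · exact hz.comm_short _ _ _ _ _ _ e1 e2 h1 h2 h3 h4

theorem wLong_conj_bar (j l : Idx g) (u : Rˣ) (t : R) (h : pl j ≠ pl l) :
    MulAut.conj (wLong z j u) (z (bar j) l t) = z j l (sg j * u * t) := by
  have e1 : MulAut.conj (z (bar j) (bar j) ↑u⁻¹) (z (bar j) l t) = z (bar j) l t :=
    conj_of_commute (hz.comm _ _ _ _ _ _ (by grind) (by grind) (by grind) (by grind) (by grind)
      (by grind))
  have e2 : MulAut.conj (z j j u) (z j l (sg j * u * t)) = z j l (sg j * u * t) :=
    conj_of_commute (hz.comm _ _ _ _ _ _ (by grind) (by grind) (by grind) (by grind) (by grind)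
      (by grind))
  have e3 : MulAut.conj (z (bar j) (bar j) ↑u⁻¹) (z j l (sg j * u * t)) =
      z (bar j) l (-t) * z l l (-(u * t ^ 2)) * z j l (sg j * u * t) := by
    have := hz.conj_long (bar j) l (↑u⁻¹) (sg j * u * t) (by simpa)
    rw [bar_bar] at this
    rw [this]
    congr 3
    · rw [sg_bar]
      linear_combination (-t * sg j ^ 2) * u.inv_mul - t * sg_sq (R := R) j
    · linear_combination (-t ^ 2 * sg j ^ 2 * u) * u.inv_mul - t ^ 2 * u * sg_sq (R := R) j
  have e4 : MulAut.conj (z (bar j) (bar j) ↑u⁻¹) (z l l (-(u * t ^ 2))) = z l l (-(u * t ^ 2)) :=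
    conj_of_commute (hz.comm _ _ _ _ _ _ (by grind) (by grind) (by grind) (by grind) (by grind)
      (by grind))
  have c1 : Commute (z l l (-(u * t ^ 2))) (z (bar j) l t) :=
    hz.comm _ _ _ _ _ _ (by grind) (by grind) (by grind) (by grind) (by grind) (by grind)
  have c2 : Commute (z l l (-(u * t ^ 2))) (z j l (sg j * u * t)) :=
    hz.comm _ _ _ _ _ _ (by grind) (by grind) (by grind) (by grind) (by grind) (by grind)
  have h5 : z j l (sg j * u * t) * z (bar j) l t =
      (z l l (-(u * t ^ 2)) * z l l (-(u * t ^ 2)))⁻¹ * (z (bar j) l t * z j l (sg j * u * t)) := by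
    have := hz.conj_opp l j (sg j * u * t) t (Ne.symm h)
    rw [hz.symm l j _ (by grind), conj_eq_iff] at this
    rw [this, ← hz.add l l (by grind), ← hz.neg (by grind), mul_assoc]
    congr 2
    linear_combination (2 * u * t ^ 2) * sg_sq (R := R) j
  have key : MulAut.conj (z (bar j) (bar j) ↑u⁻¹ * z j j u) (z (bar j) l t) =
      z j l (sg j * u * t) := by
    rw [map_mul, MulAut.mul_apply, hz.conj_long j l _ _ h, map_mul, map_mul, e1, e3, e4,
      hz.neg (by grind)]
    generalize z (bar j) l t = Y at *
    generalize z j l (sg j * u * t) = X at *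
    generalize z l l (-(u * t ^ 2)) = Z at *
    calc Y⁻¹ * Z * X * Z * Y = Y⁻¹ * Z * (Z * X) * Y := by rw [c2.eq]; group
      _ = Y⁻¹ * (Z * Z) * (X * Y) := by group
      _ = X := by rw [h5]; group
  rw [wLong, mul_assoc, map_mul, MulAut.mul_apply, key, e2]

theorem wLong_conj (j l : Idx g) (u : Rˣ) (t : R) (h : pl j ≠ pl l) :
    MulAut.conj (wLong z j u) (z j l t) = z (bar j) l (-(sg j * ↑u⁻¹ * t)) := by
  set q := -(sg j * ↑u⁻¹ * t) with hq
  have e2 (t : R) : MulAut.conj (z j j u) (z j l t) = z j l t :=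
    conj_of_commute (hz.comm _ _ _ _ _ _ (by grind) (by grind) (by grind) (by grind) (by grind)
      (by grind))
  have e3 : MulAut.conj (z (bar j) (bar j) ↑u⁻¹) (z j l t) =
      z (bar j) l q * z l l (-(↑u⁻¹ * t ^ 2)) * z j l t := by
    have := hz.conj_long (bar j) l (↑u⁻¹) t (by simpa)
    rw [bar_bar] at this
    rw [this]
    congr 3
    rw [sg_bar, hq]; ring
  have e4 : MulAut.conj (z j j u) (z l l (-(↑u⁻¹ * t ^ 2))) = z l l (-(↑u⁻¹ * t ^ 2)) :=
    conj_of_commute (hz.comm _ _ _ _ _ _ (by grind) (by grind) (by grind) (by grind) (by grind)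
      (by grind))
  have e5 : MulAut.conj (z j j u) (z (bar j) l q) =
      (z j l t)⁻¹ * z l l (-(↑u⁻¹ * t ^ 2)) * z (bar j) l q := by
    rw [hz.conj_long j l _ _ h, ← hz.neg (by grind)]
    congr 3
    · rw [hq]; linear_combination (-t * sg j ^ 2) * u.mul_inv - t * sg_sq (R := R) j
    · rw [hq]
      linear_combination (-t ^ 2 * sg j ^ 2 * ↑u⁻¹) * u.inv_mul - t ^ 2 * ↑u⁻¹ * sg_sq (R := R) j
  have c1 : Commute (z l l (-(↑u⁻¹ * t ^ 2))) (z (bar j) l q) :=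
    hz.comm _ _ _ _ _ _ (by grind) (by grind) (by grind) (by grind) (by grind) (by grind)
  have c2 : Commute (z l l (-(↑u⁻¹ * t ^ 2))) (z j l t) :=
    hz.comm _ _ _ _ _ _ (by grind) (by grind) (by grind) (by grind) (by grind) (by grind)
  have h5 : z j l t * z (bar j) l q =
      (z l l (-(↑u⁻¹ * t ^ 2)) * z l l (-(↑u⁻¹ * t ^ 2))) * (z (bar j) l q * z j l t) := by
    have := hz.conj_opp l j t q (Ne.symm h)
    rw [hz.symm l j _ (by grind), conj_eq_iff] at this
    rw [this, ← hz.add l l (by grind), mul_assoc]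
    congr 2
    rw [hq]
    linear_combination (-2 * ↑u⁻¹ * t ^ 2) * sg_sq (R := R) j
  rw [wLong, map_mul, map_mul, MulAut.mul_apply, MulAut.mul_apply, e2, e3, map_mul, map_mul, e2,
    e4, e5]
  generalize z (bar j) l q = Y at *
  generalize z j l t = X at *
  generalize z l l (-(↑u⁻¹ * t ^ 2)) = Z at *
  calc X⁻¹ * Z * Y * Z * X = X⁻¹ * Z * (Z * Y) * X := by rw [c1.eq]; group
    _ = X⁻¹ * ((Z * Z) * (Y * X)) := by group
    _ = Y := by rw [← h5]; group

end SpDatum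

/-- The element `n` acts on the root elements monomially. -/
structure Mono (z : Idx g → Idx g → R → S) (n : S) (σ : Equiv.Perm (Idx g)) (c : Idx g → Rˣ) :
    Prop where
  bar : ∀ k, σ (bar k) = bar (σ k)
  scale : ∀ k, (c k : R) * c (SymplecticSteinberg.bar k) * sg (σ k) = sg k
  conj : ∀ k l t, l ≠ SymplecticSteinberg.bar k →
    MulAut.conj n (z k l t) = z (σ k) (σ l) (c k * c l * t)

theorem pl_ne_of_perm {σ : Equiv.Perm (Idx g)} (h : ∀ k, σ (bar k) = bar (σ k)) {k l : Idx g}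
    (hkl : pl k ≠ pl l) : pl (σ k) ≠ pl (σ l) := by
  intro e
  rcases eq_or_eq_bar_of_pl_eq e with e | e
  · exact hkl (by rw [σ.injective e])
  · rw [← h] at e; exact hkl (by rw [σ.injective e, pl_bar])

theorem Mono.mul {m n : S} {σ τ : Equiv.Perm (Idx g)} {c d : Idx g → Rˣ} (hm : Mono z m σ c)
    (hn : Mono z n τ d) : Mono z (m * n) (σ * τ) (fun k => c (τ k) * d k) where
  bar k := by simp [hn.bar, hm.bar]
  scale k := by
    have h1 := hn.scale k
    have h2 := hm.scale (τ k)
    simp only [hn.bar, Equiv.Perm.mul_apply, Units.val_mul]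
    linear_combination h1 + (d k : R) * d (SymplecticSteinberg.bar k) * h2
  conj k l t h := by
    rw [map_mul, MulAut.mul_apply, hn.conj k l t h, hm.conj]
    · simp only [Equiv.Perm.mul_apply, Units.val_mul]
      congr 1; ring
    · rw [← hn.bar]; simpa using h

theorem SpDatum.mono_of_outside (hz : SpDatum z) (n : S) (σ : Equiv.Perm (Idx g)) (c : Idx g → Rˣ)
    (B : Finset (Fin g)) (m : Idx g) (hm : pl m ∉ B)
    (hbar : ∀ k, σ (bar k) = bar (σ k)) (hscale : ∀ k, (c k : R) * c (bar k) * sg (σ k) = sg k)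
    (hout : ∀ k l t, pl l ∉ B → l ≠ bar k →
      MulAut.conj n (z k l t) = z (σ k) (σ l) (c k * c l * t)) : Mono z n σ c := by
  refine ⟨hbar, hscale, fun k l t hkl => ?_⟩
  by_cases hl : pl l ∈ B
  swap
  · exact hout k l t hl hkl
  by_cases hk : pl k ∈ B
  swap
  · have h1 : k ≠ bar l := by grind
    have h2 : σ l ≠ bar (σ k) := by rw [← hbar]; simpa using hkl
    rw [hz.symm k l _ hkl, hout l k t hk h1, hz.symm _ _ _ h2, mul_comm (c k : R)]
  have hmk : pl k ≠ pl m := fun h => hm (h ▸ hk)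
  have hml : pl m ≠ pl l := fun h => hm (h ▸ hl)
  have hmk' := pl_ne_of_perm hbar hmk
  have hml' := pl_ne_of_perm hbar hml
  by_cases h : pl k = pl l
  · have : k = l := by grind
    subst this
    have h1 := hz.conj_long m k (-t) 1 hml
    have h2 : z k k t = (z m k (sg m * -t * 1))⁻¹ * MulAut.conj (z m m (-t)) (z (bar m) k 1) *
        (z (bar m) k 1)⁻¹ := by
      rw [h1]
      simp only [one_pow, mul_one, neg_neg]
      group
    have h3 := hz.conj_long (σ m) (σ k) (c m * c m * -t) (c (bar m) * c k * 1) hml'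
    have hs := hscale m
    have hs2 : ((c m : R) * c (bar m)) ^ 2 = 1 := by
      have : ((c m : R) * c (bar m)) = sg m * sg (σ m) := by
        linear_combination sg (σ m) * hs - (c m : R) * c (bar m) * sg_sq (R := R) (σ m)
      rw [this]; simp [mul_pow]
    rw [h2, map_mul, map_mul, map_inv, map_inv, MulAut.conj_apply (z m m (-t)), map_mul, map_mul,
      map_inv, hz.symm m k _ (by grind), hout k m _ hm (by grind), hout m m _ hm (by grind),
      hz.symm (bar m) k _ (by grind), hout k (bar m) _ (by simpa) (by grind),
      ← MulAut.conj_apply, hz.symm (σ k) (σ (bar m)) _ (by rw [hbar, ]; grind), hbar,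
      mul_comm (c k : R) (c (bar m)), h3,
      hz.symm (σ k) (σ m) _ (by grind)]
    have e1 : (c k : R) * c m * (sg m * -t * 1) =
        sg (σ m) * (c m * c m * -t) * (c (bar m) * c k * 1) := by
      linear_combination (t * c k * c m : R) * hs
    have e2 : -((c m : R) * c m * -t * (c (bar m) * c k * 1) ^ 2) = c k * c k * t := by
      linear_combination (t * c k ^ 2 : R) * hs2
    rw [e1, e2]
    group
  · have hkl' := pl_ne_of_perm hbar h
    have h1 := hz.conj_eq k m l 1 (sg m * t) hmk h hml
    have h2 : sg m * 1 * (sg m * t) = t := by linear_combination t * sg_sq (R := R) m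
    rw [h2] at h1
    have h3 := hz.conj_eq (σ k) (σ m) (σ l) (c k * c m * 1) (c l * c (bar m) * (sg m * t))
      hmk' hkl' hml'
    rw [h1, map_mul, map_inv, MulAut.conj_apply (z k m 1), map_mul, map_mul, map_inv,
      hout k m _ hm (by grind), hz.symm (bar m) l _ (by grind),
      hout l (bar m) _ (by simpa) (by grind), ← MulAut.conj_apply,
      hz.symm (σ l) (σ (bar m)) _ (by rw [hbar]; grind), hbar, ← h3]
    congr 1
    linear_combination (t * sg m * c k * c l : R) * hscale m + t * c k * c l * sg_sq (R := R) m

/-- The sign as a unit. -/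
def sgU (i : Idx g) : Rˣ := ⟨sg i, sg i, sg_mul_self i, sg_mul_self i⟩

@[simp] theorem sgU_val (i : Idx g) : ((sgU i : Rˣ) : R) = sg i := rfl
@[simp] theorem sgU_mul_self (i : Idx g) : (sgU i : Rˣ) * sgU i = 1 := Units.ext (by simp)

/-- The scaling factors of the long Weyl element. -/
def cLong (j : Idx g) (u : Rˣ) (k : Idx g) : Rˣ :=
  if k = bar j then u * sgU j else if k = j then -(u⁻¹ * sgU j) else 1

/-- The scaling factors of the short Weyl element. -/
def cShort (i j : Idx g) (u : Rˣ) (k : Idx g) : Rˣ :=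
  if k = bar j then u * sgU j else if k = bar i then u * sgU i else
  if k = i then -(u⁻¹ * sgU j) else if k = j then -(u⁻¹ * sgU i) else 1

theorem SpDatum.mono_wLong (hz : SpDatum z) (hg : 2 ≤ g) (j : Idx g) (u : Rˣ) :
    Mono z (wLong z j u) (Equiv.swap j (bar j)) (cLong j u) := by
  obtain ⟨m, hm⟩ : ∃ m : Fin g, m ≠ pl j := by
    have : Nontrivial (Fin g) := Fin.nontrivial_iff_two_le.2 hg
    exact exists_ne _
  refine hz.mono_of_outside _ _ _ {pl j} (Sum.inl m) (by simpa) (fun k => ?_) (fun k => ?_)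
    (fun k l t hl hkl => ?_)
  · by_cases h1 : k = j
    · subst h1; simp
    by_cases h2 : k = bar j
    · subst h2; simp
    rw [Equiv.swap_apply_of_ne_of_ne h1 h2, Equiv.swap_apply_of_ne_of_ne (by grind) (by simpa)]
  · by_cases h1 : k = j
    · subst h1; simp [cLong]; linear_combination (sg k ^ 3 * u.inv_mul + sg k * sg_sq (R := R) k)
    by_cases h2 : k = bar j
    · subst h2; simp [cLong]
      linear_combination (sg j ^ 3 * u.mul_inv + sg j * sg_sq (R := R) j)
    rw [Equiv.swap_apply_of_ne_of_ne h1 h2]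
    have : bar k ≠ j := by grind
    simp [cLong, h1, h2, this]
  · rw [Finset.mem_singleton] at hl
    have l1 : l ≠ j := by grind
    have l2 : l ≠ bar j := by grind
    rw [Equiv.swap_apply_of_ne_of_ne l1 l2]
    by_cases h1 : k = j
    · subst h1
      rw [hz.wLong_conj _ _ _ _ (Ne.symm hl)]
      simp [cLong, l1, l2, mul_comm]
    by_cases h2 : k = bar j
    · subst h2
      rw [hz.wLong_conj_bar _ _ _ _ (Ne.symm hl)]
      simp [cLong, l1, l2, mul_comm]
    rw [Equiv.swap_apply_of_ne_of_ne h1 h2, conj_of_commute]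
    · simp [cLong, h1, h2, l1, l2]
    · have (v : R) : Commute (z j j v) (z k l t) := hz.comm _ _ _ _ _ _ (by grind) hkl h2 h2 l2 l2
      have h' (v : R) : Commute (z (bar j) (bar j) v) (z k l t) :=
        hz.comm _ _ _ _ _ _ (by grind) hkl (by grind) (by grind) (by grind) (by grind)
      exact ((this _).mul_left (h' _)).mul_left (this _)

theorem SpDatum.mono_wShort (hz : SpDatum z) (hg : 3 ≤ g) (i j : Idx g) (hij : pl i ≠ pl j)
    (u : Rˣ) :
    Mono z (wShort z i j u) (Equiv.swap i (bar j) * Equiv.swap j (bar i)) (cShort i j u) := by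
  obtain ⟨m, hm⟩ : ∃ m : Fin g, m ∉ ({pl i, pl j} : Finset (Fin g)) := by
    by_contra! h
    have h1 := Finset.card_le_two (a := pl i) (b := pl j)
    rw [Finset.eq_univ_iff_forall.2 h, Finset.card_univ, Fintype.card_fin] at h1
    omega
  have a1 : i ≠ bar i := by grind
  have a2 : i ≠ bar j := by grind
  have a3 : j ≠ bar i := by grind
  have a4 : j ≠ bar j := by grind
  have a5 : i ≠ j := by grind
  have s1 : (Equiv.swap i (bar j) * Equiv.swap j (bar i)) i = bar j := by
    simp [Equiv.swap_apply_of_ne_of_ne, *]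
  have s2 : (Equiv.swap i (bar j) * Equiv.swap j (bar i)) j = bar i := by
    simp [Equiv.swap_apply_of_ne_of_ne, a1.symm, Ne.symm a5, a5]
  have s3 : (Equiv.swap i (bar j) * Equiv.swap j (bar i)) (bar i) = j := by
    simp [Equiv.swap_apply_of_ne_of_ne, a5.symm, a4]
  have s4 : (Equiv.swap i (bar j) * Equiv.swap j (bar i)) (bar j) = i := by
    simp [Equiv.swap_apply_of_ne_of_ne, a4.symm, a5.symm]
  have s5 (k : Idx g) (h1 : k ≠ i) (h2 : k ≠ j) (h3 : k ≠ bar i) (h4 : k ≠ bar j) :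
      (Equiv.swap i (bar j) * Equiv.swap j (bar i)) k = k := by
    simp [Equiv.swap_apply_of_ne_of_ne, *]
  refine hz.mono_of_outside _ _ _ {pl i, pl j} (Sum.inl m) (by simpa using hm) (fun k => ?_)
    (fun k => ?_) (fun k l t hl hkl => ?_)
  · by_cases h1 : k = i
    · subst h1; rw [s3, s1, bar_bar]
    by_cases h2 : k = j
    · subst h2; rw [s4, s2, bar_bar]
    by_cases h3 : k = bar i
    · subst h3; rw [s3, bar_bar, s1]
    by_cases h4 : k = bar j
    · subst h4; rw [s4, bar_bar, s2]
    rw [s5 k h1 h2 h3 h4, s5]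
    all_goals grind
  · by_cases h1 : k = i
    · subst h1; rw [s1]; simp [cShort, a1, a2, a3, a4, a5, a5.symm]
      linear_combination (sg k * sg j ^ 2 * u.inv_mul + sg k * sg_sq (R := R) j)
    by_cases h2 : k = j
    · subst h2; rw [s2]; simp [cShort, a1, a2, a3, a4, a5, a5.symm]
      linear_combination (sg k * sg i ^ 2 * u.inv_mul + sg k * sg_sq (R := R) i)
    by_cases h3 : k = bar i
    · subst h3; rw [s3]; simp [cShort, a1, a2, a3, a4, a5, a5.symm]
      linear_combination (sg i * sg j ^ 2 * u.mul_inv + sg i * sg_sq (R := R) j)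
    by_cases h4 : k = bar j
    · subst h4; rw [s4]; simp [cShort, a1, a2, a3, a4, a5, a5.symm]
      linear_combination (sg j * sg i ^ 2 * u.mul_inv + sg j * sg_sq (R := R) i)
    rw [s5 k h1 h2 h3 h4]
    have b1 : bar k ≠ i := by grind
    have b2 : bar k ≠ j := by grind
    simp [cShort, h1, h2, h3, h4, b1, b2]
  · simp only [Finset.mem_insert, Finset.mem_singleton, not_or] at hl
    obtain ⟨hl1, hl2⟩ := hl
    have l1 : l ≠ i := by grind
    have l2 : l ≠ j := by grind
    have l3 : l ≠ bar i := by grind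
    have l4 : l ≠ bar j := by grind
    rw [s5 l l1 l2 l3 l4]
    have cl : cShort i j u l = 1 := by simp [cShort, *]
    rw [cl]
    by_cases h1 : k = i
    · subst h1
      rw [hz.wShort_conj _ _ _ _ _ hij (Ne.symm hl1) (Ne.symm hl2), s1]
      simp [cShort, *, mul_comm]
    by_cases h2 : k = j
    · subst h2
      rw [hz.wShort_symm (by grind), hz.wShort_conj _ _ _ _ _ hij.symm (Ne.symm hl2)
        (Ne.symm hl1), s2]
      simp [cShort, *, Ne.symm a5, mul_comm]
    by_cases h3 : k = bar i
    · subst h3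
      rw [hz.wShort_symm (by grind), hz.wShort_conj_bar _ _ _ _ _ hij.symm (Ne.symm hl2)
        (Ne.symm hl1), s3]
      simp [cShort, *, mul_comm]
    by_cases h4 : k = bar j
    · subst h4
      rw [hz.wShort_conj_bar _ _ _ _ _ hij (Ne.symm hl1) (Ne.symm hl2), s4]
      simp [cShort, *, mul_comm]
    rw [s5 k h1 h2 h3 h4, conj_of_commute]
    · simp [cShort, *]
    · have (v : R) : Commute (z i j v) (z k l t) := hz.comm _ _ _ _ _ _ (by grind) hkl h3 h4 l3 l4
      have h' (v : R) : Commute (z (bar i) (bar j) v) (z k l t) :=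
        hz.comm _ _ _ _ _ _ (by grind) hkl (by grind) (by grind) (by grind) (by grind)
      exact ((this _).mul_left (h' _)).mul_left (this _)

end SymplecticSteinberg

namespace SymplecticSteinberg
open Subgroup commutatorElement

section CentralLift
variable {G Γ F : Type} [Group G] [Group Γ] [Group F] {π : Γ →* F} {p : G →* F}

/-- Any lifts of the images of `a` and `b` commute. -/
def Perp (π : Γ →* F) (p : G →* F) (a b : G) : Prop :=
  ∀ x y, π x = p a → π y = p b → Commute x y

theorem Perp.symm {a b : G} (h : Perp π p a b) : Perp π p b a :=
  fun x y hx hy => (h y x hy hx).symm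

theorem Perp.mul (hπ : Function.Surjective π) {a b c : G} (hb : Perp π p a b)
    (hc : Perp π p a c) : Perp π p a (b * c) := by
  intro x y hx hy
  obtain ⟨v, hv⟩ := hπ (p b)
  have := (hb x v hx hv).mul_right (hc x (v⁻¹ * y) hx (by simp [hv, hy]))
  simpa using this

theorem Perp.inv {a b : G} (hb : Perp π p a b) : Perp π p a b⁻¹ := by
  intro x y hx hy
  simpa using (hb x y⁻¹ hx (by simp [hy])).inv_right

variable (hc : π.ker ≤ center Γ)
include hc

theorem conj_eq_of_map_eq {x y : Γ} (h : π x = π y) : MulAut.conj x = MulAut.conj y := by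
  have h1 : x * y⁻¹ ∈ center Γ := hc (by simp [MonoidHom.mem_ker, h])
  ext v
  have h2 : MulAut.conj (x * y⁻¹) (MulAut.conj y v) = MulAut.conj y v :=
    conj_of_commute ((mem_center_iff.1 h1 _).symm)
  rw [← h2, ← MulAut.mul_apply, ← map_mul, inv_mul_cancel_right]

theorem commutator_eq_of_map_eq {x y x' y' : Γ} (h : π x = π x') (h' : π y = π y') :
    ⁅x, y⁆ = ⁅x', y'⁆ := by
  have e1 (v w : Γ) : ⁅v, w⁆ = MulAut.conj v w * w⁻¹ := by simp [commutatorElement_def]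
  have e2 (v w : Γ) : ⁅v, w⁆ = v * MulAut.conj w v⁻¹ := by simp [commutatorElement_def, mul_assoc]
  rw [e1 x, conj_eq_of_map_eq hc h, ← e1, e2, conj_eq_of_map_eq hc h', ← e2]

theorem perp_of_commute {a b : G} {x y : Γ} (hx : π x = p a) (hy : π y = p b)
    (h : Commute x y) : Perp π p a b := by
  intro x' y' hx' hy'
  rw [← commutatorElement_eq_one_iff_commute, commutator_eq_of_map_eq hc (hx'.trans hx.symm)
    (hy'.trans hy.symm), commutatorElement_eq_one_iff_commute]
  exact h

theorem perp_self (hπ : Function.Surjective π) (a : G) : Perp π p a a := by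
  obtain ⟨x, hx⟩ := hπ (p a)
  exact perp_of_commute hc hx hx (Commute.refl x)

theorem perp_commutator (hπ : Function.Surjective π) {a b c : G} (hb : Commute a b)
    (hcc : Commute a c) : Perp π p a ⁅b, c⁆ := by
  obtain ⟨x, hx⟩ := hπ (p a)
  obtain ⟨y, hy⟩ := hπ (p b)
  obtain ⟨v, hv⟩ := hπ (p c)
  refine perp_of_commute hc hx (y := ⁅y, v⁆) (by simp [map_commutatorElement, hy, hv]) ?_
  refine conj_eq_iff.1 ?_
  rw [map_commutatorElement]
  apply commutator_eq_of_map_eq hc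
  · simp only [MulAut.conj_apply, map_mul, map_inv, hx, hy]
    rw [← map_mul, hb.eq]; simp
  · simp only [MulAut.conj_apply, map_mul, map_inv, hx, hv]
    rw [← map_mul, hcc.eq]; simp

end CentralLift

theorem conj_zpow_left {Γ : Type} [Group Γ] {a b c : Γ} (h : MulAut.conj a b = c * b)
    (ha : Commute a c) (s : ℤ) : MulAut.conj (a ^ s) b = c ^ s * b := by
  have hfix (n : ℤ) : MulAut.conj (a ^ n) c = c := conj_of_commute (ha.zpow_left n)
  have hneg : MulAut.conj (a ^ (-1 : ℤ)) b = c⁻¹ * b := by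
    have := congrArg (MulAut.conj (a ^ (-1 : ℤ))) h
    rw [← MulAut.mul_apply, ← map_mul, map_mul _ c, hfix] at this
    rw [eq_inv_mul_iff_mul_eq, ← this]
    simp
  induction s using Int.induction_on with
  | zero => simp
  | succ k ih =>
    rw [zpow_add, zpow_one, map_mul, MulAut.mul_apply, h, map_mul, hfix, ih, ← mul_assoc,
      ← zpow_one_add, add_comm]
  | pred k ih =>
    rw [sub_eq_add_neg, zpow_add, map_mul, MulAut.mul_apply, hneg, map_mul, map_inv, hfix, ih,
      ← mul_assoc, zpow_add, (Commute.refl c).zpow_zpow _ _ |>.eq]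
    simp

theorem conj_zpow_zpow {Γ : Type} [Group Γ] {a b c : Γ} (h : MulAut.conj a b = c * b)
    (ha : Commute a c) (hb : Commute c b) (s t : ℤ) :
    MulAut.conj (a ^ s) (b ^ t) = c ^ (s * t) * b ^ t := by
  rw [map_zpow, conj_zpow_left h ha, (hb.zpow_left s).mul_zpow, zpow_mul]

section SpLift
variable {Γ F : Type} [Group Γ] [Group F] {π : Γ →* F} {p : Sp g ℤ →* F}

theorem exists_pl_notMem (hg : 4 ≤ g) (s : Finset (Fin g)) (hs : s.card ≤ 3) :
    ∃ m : Idx g, pl m ∉ s := by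
  by_contra! h
  have h1 : s = Finset.univ := Finset.eq_univ_iff_forall.2 fun x => h (Sum.inl x)
  rw [h1, Finset.card_univ, Fintype.card_fin] at hs
  omega

theorem exists_pl_ne (hg : 4 ≤ g) (a b c : Idx g) :
    ∃ m : Idx g, pl m ≠ pl a ∧ pl m ≠ pl b ∧ pl m ≠ pl c := by
  obtain ⟨m, hm⟩ := exists_pl_notMem hg {pl a, pl b, pl c} Finset.card_le_three
  exact ⟨m, by simpa using hm⟩

/-- The integral root elements of the symplectic group with parameter `1`. -/
def rt (i j : Idx g) : Sp g ℤ := rootSp i j 1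

theorem rt_symm (i j : Idx g) (h : j ≠ bar i) : rt i j = rt j i :=
  spDatum_rootSp.symm i j 1 h

theorem rootSp_eq_zpow (i j : Idx g) (h : j ≠ bar i) (n : ℤ) :
    rootSp i j n = rt i j ^ n :=
  spDatum_rootSp.zpow i j h _

theorem commutator_rt_short (i m j : Idx g) (h1 : pl i ≠ pl m) (h2 : pl i ≠ pl j)
    (h3 : pl m ≠ pl j) :
    ⁅rt i m, rt (bar m) j⁆ = rt i j ^ (sg m : ℤ) := by
  have := spDatum_rootSp.conj_short (R := ℤ) i m j 1 1 h1 h2 h3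
  rw [mul_one, mul_one, rootSp_eq_zpow i j (by grind)] at this
  rw [commutatorElement_def, ← MulAut.conj_apply, rt, rt, this, mul_inv_cancel_right]

theorem commutator_rt_long (m k : Idx g) (h : pl m ≠ pl k) :
    ⁅rt m m, rt (bar m) k⁆ = rt m k ^ (sg m : ℤ) * (rt k k)⁻¹ := by
  have := spDatum_rootSp.conj_long (R := ℤ) m k 1 1 h
  rw [mul_one, mul_one, one_pow, mul_one, rootSp_eq_zpow m k (by grind),
    spDatum_rootSp.neg (by grind)] at this
  rw [commutatorElement_def, ← MulAut.conj_apply, rt, rt, this, mul_inv_cancel_right]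
  rfl

theorem rt_commute (i j k l : Idx g) (hij : j ≠ bar i) (hkl : l ≠ bar k) (h1 : k ≠ bar i)
    (h2 : k ≠ bar j) (h3 : l ≠ bar i) (h4 : l ≠ bar j) : Commute (rt i j) (rt k l) :=
  spDatum_rootSp.comm i j k l 1 1 hij hkl h1 h2 h3 h4

theorem Perp.zpow_sg {a b : Sp g ℤ} {m : Idx g} :
    Perp π p a (b ^ (sg m : ℤ)) ↔ Perp π p a b := by
  rcases sg_eq (R := ℤ) m with h | h
  · simp [h]
  · simp only [h, zpow_neg, zpow_one]
    exact ⟨fun h => by simpa using h.inv, fun h => h.inv⟩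

variable (hg : 4 ≤ g) (hπ : Function.Surjective π) (hc : π.ker ≤ center Γ)
include hc hπ

theorem perp_of_outside (i j k l m : Idx g) (hij : pl i ≠ pl j) (hkl : l ≠ bar k) (h1 : k ≠ bar i)
    (h2 : k ≠ bar j) (h3 : l ≠ bar i) (h4 : l ≠ bar j) (m1 : pl m ≠ pl i) (m2 : pl m ≠ pl j)
    (m3 : pl m ≠ pl k) (m4 : pl m ≠ pl l) : Perp π p (rt k l) (rt i j) := by
  rw [← Perp.zpow_sg (m := m), ← commutator_rt_short i m j (by grind) hij m2]
  exact perp_commutator hc hπ (rt_commute _ _ _ _ (by grind) (by grind) (by grind) (by grind)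
    (by grind) (by grind)) (rt_commute _ _ _ _ (by grind) (by grind) (by grind) (by grind)
    (by grind) (by grind))

theorem perp_disjoint (i j k l : Idx g) (h1 : pl i ≠ pl j) (h2 : pl k ≠ pl l) (h3 : pl i ≠ pl k)
    (h4 : pl i ≠ pl l) (h5 : pl j ≠ pl k) (h6 : pl j ≠ pl l) :
    Perp π p (rt k l) (rt i j) := by
  have e1 : Perp π p (rt k l) (rt i j ^ (sg i : ℤ) * (rt j j)⁻¹) := by
    rw [← commutator_rt_long i j h1]
    exact perp_commutator hc hπ (rt_commute _ _ _ _ (by grind) (by grind) (by grind) (by grind)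
      (by grind) (by grind)) (rt_commute _ _ _ _ (by grind) (by grind) (by grind) (by grind)
      (by grind) (by grind))
  have e2 : Perp π p (rt k l) (rt j j) := (perp_of_outside hπ hc k l j j i h2 (by grind) (by grind)
    (by grind) (by grind) (by grind) h3 h4 h1 h1).symm
  have e3 := e1.mul hπ e2
  rw [inv_mul_cancel_right] at e3
  exact Perp.zpow_sg.1 e3

include hg

theorem perp_long (i k : Idx g) (hik : pl i ≠ pl k) : Perp π p (rt i i) (rt k k) := by
  obtain ⟨m, m1, m2, -⟩ := exists_pl_ne hg i k k
  obtain ⟨n, n1, n2, n3⟩ := exists_pl_ne hg i k m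
  have h1 : Perp π p (rt i i) (rt m k ^ (sg m : ℤ) * (rt k k)⁻¹) := by
    rw [← commutator_rt_long m k m2]
    exact perp_commutator hc hπ (rt_commute _ _ _ _ (by grind) (by grind) (by grind) (by grind)
      (by grind) (by grind)) (rt_commute _ _ _ _ (by grind) (by grind) (by grind) (by grind)
      (by grind) (by grind))
  have h2 : Perp π p (rt i i) (rt m k ^ (sg m : ℤ)) := Perp.zpow_sg.2
    (perp_of_outside hπ hc m k i i n m2 (by grind) (by grind) (by grind) (by grind) (by grind)
      n3 n2 n1 n1)
  have h3 := h2.inv.mul hπ h1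
  rw [inv_mul_cancel_left] at h3
  simpa using h3.inv

theorem perp_rt (i j k l : Idx g) (hij : j ≠ bar i) (hkl : l ≠ bar k) (h1 : k ≠ bar i)
    (h2 : k ≠ bar j) (h3 : l ≠ bar i) (h4 : l ≠ bar j) : Perp π p (rt i j) (rt k l) := by
  by_cases e1 : ∃ m : Idx g, pl m ≠ pl i ∧ pl m ≠ pl j ∧ pl m ≠ pl k ∧ pl m ≠ pl l
  · obtain ⟨m, m1, m2, m3, m4⟩ := e1
    by_cases e2 : pl i = pl j
    · have : i = j := by grind
      subst this
      by_cases e3 : pl k = pl l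
      · have : k = l := by grind
        subst this
        by_cases e4 : pl i = pl k
        · have : i = k := by grind
          subst this
          exact perp_self hc hπ _
        · exact perp_long hg hπ hc _ _ e4
      · exact perp_of_outside hπ hc k l i i m e3 (by grind) (by grind) (by grind) (by grind)
          (by grind) m3 m4 m1 m1
    · exact (perp_of_outside hπ hc i j k l m e2 hkl h1 h2 h3 h4 m1 m2 m3 m4).symm
  · have e2 : pl i ≠ pl j := fun h => e1 (by
      obtain ⟨m, m1, m2, m3⟩ := exists_pl_ne hg i k l; exact ⟨m, m1, h ▸ m1, m2, m3⟩)
    have e3 : pl k ≠ pl l := fun h => e1 (by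
      obtain ⟨m, m1, m2, m3⟩ := exists_pl_ne hg i j l; exact ⟨m, m1, m2, h ▸ m3, m3⟩)
    have e4 : pl i ≠ pl k := fun h => e1 (by
      obtain ⟨m, m1, m2, m3⟩ := exists_pl_ne hg i j l; exact ⟨m, m1, m2, h ▸ m1, m3⟩)
    have e5 : pl i ≠ pl l := fun h => e1 (by
      obtain ⟨m, m1, m2, m3⟩ := exists_pl_ne hg i j k; exact ⟨m, m1, m2, m3, h ▸ m1⟩)
    have e6 : pl j ≠ pl k := fun h => e1 (by
      obtain ⟨m, m1, m2, m3⟩ := exists_pl_ne hg i j l; exact ⟨m, m1, m2, h ▸ m2, m3⟩)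
    have e7 : pl j ≠ pl l := fun h => e1 (by
      obtain ⟨m, m1, m2, m3⟩ := exists_pl_ne hg i j k; exact ⟨m, m1, m2, m3, h ▸ m2⟩)
    exact (perp_disjoint hπ hc i j k l e2 e3 e4 e5 e6 e7).symm

end SpLift

end SymplecticSteinberg

namespace SymplecticSteinberg
open Subgroup commutatorElement

theorem conj_eq_commutator_mul {Γ : Type} [Group Γ] (a b : Γ) :
    MulAut.conj a b = ⁅a, b⁆ * b := by
  simp [commutatorElement_def]

theorem commutator_zpow_zpow {Γ : Type} [Group Γ] {a b : Γ} (ha : Commute a ⁅a, b⁆)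
    (hb : Commute ⁅a, b⁆ b) (s t : ℤ) : ⁅a ^ s, b ^ t⁆ = ⁅a, b⁆ ^ (s * t) := by
  have := conj_zpow_zpow (conj_eq_commutator_mul a b) ha hb s t
  rw [conj_eq_commutator_mul] at this
  exact mul_right_cancel this

theorem commutator_commutator_eq {Γ : Type} [Group Γ] {a b c : Γ} (hac : Commute a c)
    (h : Commute ⁅a, b⁆ ⁅b, c⁆) (h' : Commute ⁅⁅a, b⁆, c⁆ ⁅b, c⁆) :
    ⁅a, ⁅b, c⁆⁆ = ⁅⁅a, b⁆, c⁆ := by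
  have e1 : MulAut.conj a ⁅b, c⁆ = ⁅a, b⁆ * ⁅b, c⁆ * ⁅a, b⁆⁻¹ * ⁅⁅a, b⁆, c⁆ := by
    rw [map_commutatorElement, conj_of_commute hac, conj_eq_commutator_mul a b]
    simp only [commutatorElement_def]
    group
  rw [commutatorElement_def a, ← MulAut.conj_apply, e1, h.eq, mul_inv_cancel_right, ← h'.eq,
    mul_inv_cancel_right]

variable {g : ℕ} {Γ F : Type} [Group Γ] [Group F] {π : Γ →* F} {p : Sp g ℤ →* F}

/-- A lift of a root element. -/
def rtLift (hπ : Function.Surjective π) (p : Sp g ℤ →* F) (i j : Idx g) : Γ :=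
  Function.surjInv hπ (p (rt i j))

theorem map_rtLift (hπ : Function.Surjective π) (i j : Idx g) :
    π (rtLift hπ p i j) = p (rt i j) := Function.surjInv_eq hπ _

/-- The lift of a short root element obtained as a commutator through `m`. -/
def shortVia (hπ : Function.Surjective π) (p : Sp g ℤ →* F) (i j m : Idx g) : Γ :=
  ⁅rtLift hπ p i m, rtLift hπ p (bar m) j⁆ ^ (sg m : ℤ)

theorem map_shortVia (hπ : Function.Surjective π) (i j m : Idx g) (h : pl i ≠ pl j)
    (h1 : pl m ≠ pl i) (h2 : pl m ≠ pl j) : π (shortVia hπ p i j m) = p (rt i j) := by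
  rw [shortVia, map_zpow, map_commutatorElement, map_rtLift, map_rtLift, ← map_commutatorElement,
    commutator_rt_short i m j h1.symm h h2, ← map_zpow, ← zpow_mul, sg_mul_self, zpow_one]

theorem shortVia_symm (hπ : Function.Surjective π) (i j m : Idx g)
    (h1 : pl m ≠ pl i) (h2 : pl m ≠ pl j) : shortVia hπ p j i (bar m) = shortVia hπ p i j m := by
  rw [shortVia, shortVia, sg_bar, zpow_neg, ← inv_zpow, commutatorElement_inv, bar_bar]
  simp only [rtLift]
  rw [rt_symm m i (by grind), rt_symm j (bar m) (by grind)]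

variable (hg : 4 ≤ g) (hπ : Function.Surjective π) (hc : π.ker ≤ center Γ)
include hc

theorem commutator_short_lifts {i j m : Idx g} {x y : Γ} (hx : π x = p (rt i m))
    (hy : π y = p (rt (bar m) j)) : ⁅x, y⁆ = shortVia hπ p i j m ^ (sg m : ℤ) := by
  rw [shortVia, ← zpow_mul, sg_mul_self, zpow_one]
  exact commutator_eq_of_map_eq hc (hx.trans (map_rtLift hπ _ _).symm)
    (hy.trans (map_rtLift hπ _ _).symm)

include hg
theorem lift_commute (hπ : Function.Surjective π) {i j k l : Idx g} {x y : Γ}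
    (hx : π x = p (rt i j)) (hy : π y = p (rt k l)) (hij : j ≠ bar i) (hkl : l ≠ bar k)
    (h1 : k ≠ bar i) (h2 : k ≠ bar j) (h3 : l ≠ bar i) (h4 : l ≠ bar j) : Commute x y :=
  perp_rt hg hπ hc i j k l hij hkl h1 h2 h3 h4 x y hx hy

theorem shortVia_eq_of_ne (i j m n : Idx g) (h : pl i ≠ pl j) (m1 : pl m ≠ pl i)
    (m2 : pl m ≠ pl j) (n1 : pl n ≠ pl i) (n2 : pl n ≠ pl j) (hmn : pl m ≠ pl n) :
    shortVia hπ p i j m = shortVia hπ p i j n := by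
  have ea := map_rtLift (p := p) hπ i m
  have eb := map_rtLift (p := p) hπ (bar m) n
  have ec := map_rtLift (p := p) hπ (bar n) j
  have eX := map_shortVia (p := p) hπ i n m n1.symm m1 hmn
  have eY := map_shortVia (p := p) hπ (bar m) j n (by simpa) (by simpa using hmn.symm) n2
  have eb1 := commutator_short_lifts hπ hc ea eb
  have eb2 := commutator_short_lifts hπ hc eb ec
  have eb3 := commutator_short_lifts hπ hc eX ec
  have eb4 := commutator_short_lifts hπ hc ea eY
  have eXm := map_shortVia (p := p) hπ i j m h m1 m2
  have eXn := map_shortVia (p := p) hπ i j n h n1 n2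
  set a := rtLift hπ p i m
  set b := rtLift hπ p (bar m) n
  set c := rtLift hπ p (bar n) j
  set X := shortVia hπ p i n m
  set Y := shortVia hπ p (bar m) j n
  set Xm := shortVia hπ p i j m
  set Xn := shortVia hπ p i j n
  have c1 : Commute a c := lift_commute hg hc hπ ea ec (by grind) (by grind) (by grind) (by grind)
    (by grind) (by grind)
  have c2 : Commute X Y := lift_commute hg hc hπ eX eY (by grind) (by grind) (by grind) (by grind)
    (by grind) (by grind)
  have c3 : Commute Xn Y := lift_commute hg hc hπ eXn eY (by grind) (by grind) (by grind)
    (by grind) (by grind) (by grind)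
  have c4 : Commute Xn X := lift_commute hg hc hπ eXn eX (by grind) (by grind) (by grind)
    (by grind) (by grind) (by grind)
  have c5 : Commute Xn c := lift_commute hg hc hπ eXn ec (by grind) (by grind) (by grind)
    (by grind) (by grind) (by grind)
  have c6 : Commute Xm a := lift_commute hg hc hπ eXm ea (by grind) (by grind) (by grind)
    (by grind) (by grind) (by grind)
  have c7 : Commute Xm Y := lift_commute hg hc hπ eXm eY (by grind) (by grind) (by grind)
    (by grind) (by grind) (by grind)
  have f1 : ⁅X ^ (sg m : ℤ), c⁆ = Xn ^ ((sg n : ℤ) * sg m) := by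
    have := commutator_zpow_zpow (a := X) (b := c) (by rw [eb3]; exact (c4.zpow_left _).symm)
      (by rw [eb3]; exact c5.zpow_left _) (sg m) 1
    rw [zpow_one, mul_one, eb3, ← zpow_mul] at this
    exact this
  have f2 : ⁅a, Y ^ (sg n : ℤ)⁆ = Xm ^ ((sg m : ℤ) * sg n) := by
    have := commutator_zpow_zpow (a := a) (b := Y) (by rw [eb4]; exact (c6.zpow_left _).symm)
      (by rw [eb4]; exact c7.zpow_left _) 1 (sg n)
    rw [zpow_one, one_mul, eb4, ← zpow_mul] at this
    exact this
  have key := commutator_commutator_eq (b := b) c1 (by rw [eb1, eb2]; exact c2.zpow_zpow _ _)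
    (by rw [eb1, eb2, f1]; exact c3.zpow_zpow _ _)
  rw [eb1, eb2, f1, f2, mul_comm (sg n : ℤ)] at key
  rcases sg_eq (R := ℤ) m with e | e <;> rcases sg_eq (R := ℤ) n with e' | e' <;>
    simpa [e, e'] using key

theorem shortVia_eq (i j m n : Idx g) (h : pl i ≠ pl j) (m1 : pl m ≠ pl i)
    (m2 : pl m ≠ pl j) (n1 : pl n ≠ pl i) (n2 : pl n ≠ pl j) :
    shortVia hπ p i j m = shortVia hπ p i j n := by
  by_cases hmn : pl m = pl n
  · obtain ⟨k, k1, k2, k3⟩ := exists_pl_ne hg i j m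
    rw [shortVia_eq_of_ne hg hπ hc i j m k h m1 m2 k1 k2 k3.symm,
      shortVia_eq_of_ne hg hπ hc i j k n h k1 k2 n1 n2 (hmn ▸ k3)]
  · exact shortVia_eq_of_ne hg hπ hc i j m n h m1 m2 n1 n2 hmn

omit hc in
/-- The canonical lift of a short root element. -/
def shortLift (hg : 4 ≤ g) (hπ : Function.Surjective π) (p : Sp g ℤ →* F) (i j : Idx g) : Γ :=
  shortVia hπ p i j (exists_pl_ne hg i j j).choose

theorem shortLift_eq (i j m : Idx g) (h : pl i ≠ pl j) (m1 : pl m ≠ pl i)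
    (m2 : pl m ≠ pl j) : shortLift hg hπ p i j = shortVia hπ p i j m :=
  shortVia_eq hg hπ hc i j _ m h (exists_pl_ne hg i j j).choose_spec.1
    (exists_pl_ne hg i j j).choose_spec.2.1 m1 m2

omit hc in
theorem map_shortLift (i j : Idx g) (h : pl i ≠ pl j) :
    π (shortLift hg hπ p i j) = p (rt i j) :=
  map_shortVia hπ _ _ _ h (exists_pl_ne hg i j j).choose_spec.1
    (exists_pl_ne hg i j j).choose_spec.2.1

theorem shortLift_symm (i j : Idx g) (h : pl i ≠ pl j) :
    shortLift hg hπ p i j = shortLift hg hπ p j i := by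
  obtain ⟨m, m1, m2, -⟩ := exists_pl_ne hg i j j
  rw [shortLift_eq hg hπ hc i j m h m1 m2, shortLift_eq hg hπ hc j i (bar m) h.symm (by simpa)
    (by simpa), shortVia_symm _ _ _ _ m1 m2]

theorem commutator_shortLift (i j l : Idx g) (h1 : pl i ≠ pl j) (h2 : pl i ≠ pl l)
    (h3 : pl j ≠ pl l) : ⁅shortLift hg hπ p i j, shortLift hg hπ p (bar j) l⁆ =
      shortLift hg hπ p i l ^ (sg j : ℤ) := by
  rw [shortLift_eq hg hπ hc i l j h2 h1.symm h3]
  exact commutator_short_lifts hπ hc (map_shortLift hg hπ i j h1)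
    (map_shortLift hg hπ (bar j) l (by simpa))

theorem shortDatum_shortLift :
    ShortDatum (fun (i j : Idx g) (t : ℤ) => shortLift hg hπ p i j ^ t) where
  add_short i j s t _ := zpow_add _ _ _
  symm i j t h := by
    by_cases e : pl i = pl j
    · have : i = j := by grind
      rw [this]
    · rw [shortLift_symm hg hπ hc i j e]
  comm_short i j k l s t h1 h2 h3 h4 h5 h6 :=
    (lift_commute hg hc hπ (map_shortLift hg hπ i j h1) (map_shortLift hg hπ k l h2) (by grind)
      (by grind) h3 h4 h5 h6).zpow_zpow _ _
  conj_short i j l s t h1 h2 h3 := by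
    have e := commutator_shortLift (p := p) hg hπ hc i j l h1 h2 h3
    have e1 := map_shortLift (p := p) hg hπ i j h1
    have e2 := map_shortLift (p := p) hg hπ (bar j) l (by simpa)
    have e3 := map_shortLift (p := p) hg hπ i l h2
    have c1 := lift_commute hg hc hπ e1 e3 (by grind) (by grind) (by grind) (by grind)
      (by grind) (by grind)
    have c2 := lift_commute hg hc hπ e3 e2 (by grind) (by grind) (by grind) (by grind)
      (by grind) (by grind)
    rw [conj_eq_commutator_mul, commutator_zpow_zpow (by rw [e]; exact c1.zpow_right _)
      (by rw [e]; exact c2.zpow_left _), e, ← zpow_mul, mul_assoc]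

end SymplecticSteinberg

namespace SymplecticSteinberg
open Subgroup commutatorElement
variable {g : ℕ} {Γ F : Type} [Group Γ] [Group F] {π : Γ →* F} {p : Sp g ℤ →* F}
variable (hg : 4 ≤ g) (hπ : Function.Surjective π) (hc : π.ker ≤ center Γ)

theorem commutator_eq_sq {D A B Z : Γ} (h1 : Z = ⁅D, B⁆⁻¹ * A) (h2 : Z = ⁅D, B⁻¹⁆⁻¹ * A⁻¹)
    (h3 : Commute Z B) (h4 : Commute Z A) : ⁅A, B⁆ = Z ^ 2 := by
  have e1 : MulAut.conj D B = A * Z⁻¹ * B := by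
    rw [conj_eq_commutator_mul, h1]; group
  have e2 : MulAut.conj D B⁻¹ = A⁻¹ * Z⁻¹ * B⁻¹ := by
    rw [conj_eq_commutator_mul, h2]; group
  rw [map_inv, e1, inv_eq_iff_mul_eq_one] at e2
  have h5 : Commute Z⁻¹ (B * A⁻¹) := (h3.mul_right h4.inv_right).inv_left
  have h6 : A * Z⁻¹ * B * (A⁻¹ * Z⁻¹ * B⁻¹) = ⁅A, B⁆ * (Z⁻¹ * Z⁻¹) := by
    calc A * Z⁻¹ * B * (A⁻¹ * Z⁻¹ * B⁻¹) = A * (Z⁻¹ * (B * A⁻¹)) * Z⁻¹ * B⁻¹ := by group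
      _ = A * B * A⁻¹ * (Z⁻¹ * (Z⁻¹ * B⁻¹)) := by rw [h5.eq]; group
      _ = A * B * A⁻¹ * (B⁻¹ * Z⁻¹ * Z⁻¹) := by
        rw [h3.inv_inv.eq, ← mul_assoc Z⁻¹, h3.inv_inv.eq]
      _ = _ := by rw [commutatorElement_def]; group
  rw [h6, mul_eq_one_iff_eq_inv] at e2
  rw [e2, sq, mul_inv_rev, inv_inv]

/-- The lift of a long root element obtained from a commutator with a short root element. -/
def longVia (hg : 4 ≤ g) (hπ : Function.Surjective π) (p : Sp g ℤ →* F) (j l : Idx g) : Γ :=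
  ⁅rtLift hπ p j j, shortLift hg hπ p (bar j) l⁆⁻¹ * shortLift hg hπ p j l ^ (sg j : ℤ)

theorem map_longVia (j l : Idx g) (h : pl j ≠ pl l) :
    π (longVia hg hπ p j l) = p (rt l l) := by
  rw [longVia, map_mul, map_inv, map_commutatorElement, map_rtLift,
    map_shortLift hg hπ (bar j) l (by simpa), map_zpow, map_shortLift hg hπ j l h,
    ← map_commutatorElement, commutator_rt_long j l h]
  simp

/-- The family of powers of the canonical lifts of the short root elements. -/
def shortFam (hg : 4 ≤ g) (hπ : Function.Surjective π) (p : Sp g ℤ →* F) (i j : Idx g) (t : ℤ) : Γ :=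
  shortLift hg hπ p i j ^ t

theorem map_shortFam (i j : Idx g) (t : ℤ) (h : pl i ≠ pl j) :
    π (shortFam hg hπ p i j t) = p (rootSp i j t) := by
  rw [shortFam, map_zpow, map_shortLift hg hπ i j h, ← map_zpow, rootSp_eq_zpow i j (by grind)]

theorem map_wShort_shortFam (i j : Idx g) (u : ℤˣ) (h : pl i ≠ pl j) :
    π (wShort (shortFam hg hπ p) i j u) = p (wShort rootSp i j u) := by
  simp only [wShort, map_mul]
  rw [map_shortFam hg hπ i j _ h, map_shortFam hg hπ (bar i) (bar j) _ (by simpa)]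

include hg in
theorem wShort_rootSp_conj_rt (j k : Idx g) (h : pl j ≠ pl k) :
    MulAut.conj (wShort rootSp k (bar j) (-sgU k)) (rt j j) = rt k k := by
  have h1 : j ≠ bar k := by grind
  have := (spDatum_rootSp (g := g) (R := ℤ).mono_wShort (by omega) k (bar j) (by simpa using h.symm)
    (-sgU k)).conj j j 1 (by simp)
  rw [bar_bar, Equiv.Perm.mul_apply, Equiv.swap_apply_of_ne_of_ne (ne_bar j) h1,
    Equiv.swap_apply_right, ← sq, mul_one] at this
  rw [rt, this, rt]
  congr 1
  simp [cShort, sgU, mul_pow]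

include hg in
theorem wShort_rootSp_conj_rt' (j k : Idx g) (h : pl j ≠ pl k) :
    MulAut.conj (wShort rootSp k (bar j) (-sgU k)) (rt k k) = rt j j := by
  have h1 : k ≠ bar j := by grind
  have h2 : k ≠ j := by grind
  have := (spDatum_rootSp (g := g) (R := ℤ).mono_wShort (by omega) k (bar j) (by simpa using h.symm)
    (-sgU k)).conj k k 1 (by simp)
  rw [bar_bar, Equiv.Perm.mul_apply, Equiv.swap_apply_of_ne_of_ne h1 (ne_bar k),
    Equiv.swap_apply_left, ← sq, mul_one] at this
  rw [rt, this, rt]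
  congr 1
  simp [cShort, sgU, mul_pow, h2]

include hc

theorem commute_wShort_shortFam {i j l : Idx g} {x : Γ} (hx : π x = p (rt l l))
    (u : ℤˣ) (h : pl i ≠ pl j) (h1 : pl i ≠ pl l) (h2 : pl j ≠ pl l) :
    Commute (wShort (shortFam hg hπ p) i j u) x := by
  have c1 : Commute (shortLift hg hπ p i j) x :=
    lift_commute hg hc hπ (map_shortLift hg hπ i j h) hx (by grind) (by grind) (by grind) (by grind)
      (by grind) (by grind)
  have c2 : Commute (shortLift hg hπ p (bar i) (bar j)) x :=
    lift_commute hg hc hπ (map_shortLift hg hπ (bar i) (bar j) (by simpa)) hx (by grind) (by grind)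
      (by grind) (by grind) (by grind) (by grind)
  exact ((c1.zpow_left _).mul_left (c2.zpow_left _)).mul_left (c1.zpow_left _)

theorem shortDatum_shortFam : ShortDatum (shortFam hg hπ p) := shortDatum_shortLift hg hπ hc

theorem wShort_conj_shortLift (j k l : Idx g) (h : pl j ≠ pl k) (h1 : pl j ≠ pl l)
    (h2 : pl k ≠ pl l) : MulAut.conj (wShort (shortFam hg hπ p) k (bar j) (-sgU k))
      (shortLift hg hπ p (bar j) l) = shortLift hg hπ p (bar k) l := by
  have := (shortDatum_shortFam (p := p) hg hπ hc).wShort_conj (bar j) k l (-sgU k) 1 (by simpa)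
    (by simpa) h2
  rw [(shortDatum_shortFam (p := p) hg hπ hc).wShort_symm (by grind)] at this
  simpa [shortFam, sgU] using this

theorem wShort_conj_shortLift' (j k l : Idx g) (h : pl j ≠ pl k) (h1 : pl j ≠ pl l)
    (h2 : pl k ≠ pl l) : MulAut.conj (wShort (shortFam hg hπ p) k (bar j) (-sgU k))
      (shortLift hg hπ p j l ^ (sg j : ℤ)) = shortLift hg hπ p k l ^ (sg k : ℤ) := by
  have := (shortDatum_shortFam (p := p) hg hπ hc).wShort_conj_bar k (bar j) l (-sgU k) (sg j)
    (by simpa using h.symm) h2 (by simpa)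
  rw [bar_bar] at this
  have e : sg (bar j) * ((-sgU k : ℤˣ) : ℤ) * sg j = sg k := by
    rw [sg_bar]; push_cast; rw [sgU_val]; linear_combination sg k * sg_sq (R := ℤ) j
  rwa [e] at this

theorem longVia_eq_of_ne (j k l : Idx g) (h : pl j ≠ pl k) (h1 : pl j ≠ pl l)
    (h2 : pl k ≠ pl l) : longVia hg hπ p j l = longVia hg hπ p k l := by
  have e1 := conj_of_commute (commute_wShort_shortFam hg hπ hc (map_longVia (p := p) hg hπ j l h1)
    (i := k) (j := bar j) (-sgU k) (by simpa using h.symm) h2 (by simpa))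
  rw [← e1, longVia, map_mul, map_inv, map_commutatorElement,
    wShort_conj_shortLift hg hπ hc j k l h h1 h2, wShort_conj_shortLift' hg hπ hc j k l h h1 h2,
    longVia]
  congr 2
  apply commutator_eq_of_map_eq hc _ rfl
  rw [map_rtLift, ← wShort_rootSp_conj_rt hg j k h, MulAut.conj_apply, MulAut.conj_apply]
  simp only [map_mul, map_inv, map_rtLift]
  rw [map_wShort_shortFam _ _ _ _ _ (by simpa using h.symm)]

theorem longVia_eq (j k l : Idx g) (h1 : pl j ≠ pl l) (h2 : pl k ≠ pl l) :
    longVia hg hπ p j l = longVia hg hπ p k l := by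
  by_cases h : pl j = pl k
  · obtain ⟨m, m1, m2, -⟩ := exists_pl_ne hg j l l
    rw [longVia_eq_of_ne hg hπ hc j m l m1.symm h1 m2,
      longVia_eq_of_ne hg hπ hc m k l (h ▸ m1) m2 h2]
  · exact longVia_eq_of_ne hg hπ hc j k l h h1 h2

theorem commutator_shortLift_opp (j l : Idx g) (h : pl j ≠ pl l) :
    ⁅shortLift hg hπ p j l ^ (sg j : ℤ), shortLift hg hπ p (bar j) l⁆ =
      longVia hg hπ p j l ^ 2 := by
  obtain ⟨k, k1, k2, -⟩ := exists_pl_ne hg j l l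
  set w := wShort (shortFam hg hπ p) k (bar j) (-sgU k) with hw
  have eZ := map_longVia (p := p) hg hπ j l h
  have hs := shortDatum_shortFam (p := p) hg hπ hc
  have a1 : MulAut.conj w (longVia hg hπ p j l) = longVia hg hπ p j l :=
    conj_of_commute (commute_wShort_shortFam hg hπ hc eZ _ (by simpa) k2 (by simpa))
  have a2 := wShort_conj_shortLift (p := p) hg hπ hc j k l k1.symm h k2
  have a3 := wShort_conj_shortLift' (p := p) hg hπ hc j k l k1.symm h k2
  have a4 : MulAut.conj w (shortLift hg hπ p (bar k) l) = (shortLift hg hπ p (bar j) l)⁻¹ := by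
    have := hs.wShort_conj_bar (bar j) k l (-sgU k) 1 (by simpa using k1.symm) (by simpa) k2
    rw [hs.wShort_symm (by grind), ← hw] at this
    simpa [shortFam, sgU] using this
  have a5 : MulAut.conj w (shortLift hg hπ p k l ^ (sg k : ℤ)) =
      (shortLift hg hπ p j l ^ (sg j : ℤ))⁻¹ := by
    have := hs.wShort_conj k (bar j) l (-sgU k) (sg k) (by simpa) k2 (by simpa)
    rw [bar_bar, ← hw] at this
    simpa [shortFam, sgU, mul_assoc] using this
  rw [← hw] at a2 a3
  have a6 : π (MulAut.conj w (MulAut.conj w (rtLift hπ p j j))) = π (rtLift hπ p j j) := by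
    have e := congrArg p (wShort_rootSp_conj_rt hg j k k1.symm)
    have e' := congrArg p (wShort_rootSp_conj_rt' hg j k k1.symm)
    have e'' := map_wShort_shortFam (p := p) hg hπ k (bar j) (-sgU k) (by simpa)
    rw [← hw] at e''
    simp only [MulAut.conj_apply, map_mul, map_inv, ← e''] at e e'
    rw [MulAut.conj_apply, MulAut.conj_apply]
    simp only [map_mul, map_inv, map_rtLift]
    rw [e, e']
  have a7 : longVia hg hπ p j l = ⁅rtLift hπ p j j, shortLift hg hπ p (bar j) l⁆⁻¹ *
      shortLift hg hπ p j l ^ (sg j : ℤ) := rfl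
  have a8 := congrArg (fun x => MulAut.conj w (MulAut.conj w x)) a7
  simp only [a1, map_mul, map_inv, map_commutatorElement, a2, a3, a4, a5] at a8
  rw [commutator_eq_of_map_eq hc a6 rfl] at a8
  have c1 : Commute (longVia hg hπ p j l) (shortLift hg hπ p (bar j) l) :=
    lift_commute hg hc hπ eZ (map_shortLift hg hπ (bar j) l (by simpa)) (by grind) (by grind)
      (by grind) (by grind) (by grind) (by grind)
  have c2 : Commute (longVia hg hπ p j l) (shortLift hg hπ p j l ^ (sg j : ℤ)) :=
    (lift_commute hg hc hπ eZ (map_shortLift hg hπ j l h) (by grind) (by grind)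
      (by grind) (by grind) (by grind) (by grind)).zpow_right _
  exact commutator_eq_sq a7 a8 c1 c2

omit hc in
theorem zpow_of_commutator_eq_sq {D Y B : Γ} (h : ⁅D, B⁆ = Y ^ (2 : ℤ)) (h1 : Commute Y D)
    (h2 : Commute Y B) (t : ℤ) : (D * Y⁻¹ * B) ^ t = D ^ t * Y ^ (-t ^ 2) * B ^ t := by
  have key (t : ℤ) : D ^ t * Y ^ (-t ^ 2) * B ^ t * (D * Y⁻¹ * B) =
      D ^ (t + 1) * Y ^ (-(t + 1) ^ 2) * B ^ (t + 1) := by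
    have h3 : D * B ^ t = Y ^ (2 * t) * (B ^ t * D) := by
      have := commutator_zpow_zpow (a := D) (b := B) (by rw [h]; exact (h1.zpow_left _).symm)
        (by rw [h]; exact h2.zpow_left _) 1 t
      rw [h, zpow_one, one_mul, ← zpow_mul, commutatorElement_def] at this
      rw [← this]; group
    have h4 : B ^ t * D = Y ^ (-(2 * t)) * (D * B ^ t) := by rw [h3]; group
    have h5 : Commute (Y⁻¹) (B ^ t) := (h2.zpow_right t).inv_left
    calc D ^ t * Y ^ (-t ^ 2) * B ^ t * (D * Y⁻¹ * B) =
        D ^ t * Y ^ (-t ^ 2) * (B ^ t * D) * Y⁻¹ * B := by group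
      _ = D ^ t * (Y ^ (-t ^ 2 + -(2 * t)) * D) * (B ^ t * Y⁻¹) * B := by
        rw [h4, zpow_add]; group
      _ = D ^ t * (D * Y ^ (-t ^ 2 + -(2 * t))) * (Y⁻¹ * B ^ t) * B := by
        rw [(h1.zpow_left _).eq, h5.eq]
      _ = D ^ (t + 1) * (Y ^ (-t ^ 2 + -(2 * t)) * Y ^ (-1 : ℤ)) * B ^ (t + 1) := by
        rw [zpow_add_one, zpow_add_one, zpow_neg_one]; group
      _ = _ := by rw [← zpow_add]; congr 3; ring
  induction t using Int.induction_on with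
  | zero => simp
  | succ k ih => rw [zpow_add_one, ih, key]
  | pred k ih =>
    have := key (-k - 1)
    rw [sub_add_cancel, ← ih, ← eq_mul_inv_iff_mul_eq, ← zpow_sub_one] at this
    exact this.symm

omit hc in
theorem conj_long_zpow {Z' A Z B : Γ} (h : MulAut.conj Z' B = A * Z⁻¹ * B) (h1 : Commute Z' A)
    (h2 : Commute Z' Z) (h3 : Commute Z A) (h4 : Commute Z B) (h5 : ⁅A, B⁆ = Z ^ 2)
    (h6 : Commute A (Z ^ 2)) (s t : ℤ) :
    MulAut.conj (Z' ^ s) (B ^ t) = A ^ (s * t) * Z ^ (-(s * t ^ 2)) * B ^ t := by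
  have e := conj_zpow_left h (h1.mul_right h2.inv_right) s
  rw [(h3.symm.inv_right).mul_zpow, inv_zpow] at e
  have e2 := commutator_zpow_zpow (a := A) (b := B) (by rw [h5]; exact h6)
    (by rw [h5]; exact h4.pow_left _) s 1
  rw [h5, zpow_one, mul_one, ← zpow_natCast, ← zpow_mul, mul_comm, zpow_mul] at e2
  rw [map_zpow, e, zpow_of_commutator_eq_sq e2 (h3.zpow_zpow _ _) (h4.zpow_left _), ← zpow_mul,
    ← zpow_mul]
  congr 3
  ring

omit hc in
/-- The canonical lift of a long root element. -/
def longLift (hg : 4 ≤ g) (hπ : Function.Surjective π) (p : Sp g ℤ →* F) (i : Idx g) : Γ :=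
  longVia hg hπ p (exists_pl_ne hg i i i).choose i

theorem longLift_eq (i j : Idx g) (h : pl j ≠ pl i) :
    longLift hg hπ p i = longVia hg hπ p j i :=
  longVia_eq hg hπ hc _ _ _ (exists_pl_ne hg i i i).choose_spec.1 h

omit hc in
theorem map_longLift (i : Idx g) : π (longLift hg hπ p i) = p (rt i i) :=
  map_longVia hg hπ _ _ (exists_pl_ne hg i i i).choose_spec.1

/-- The canonical lifts of the root elements of the integral symplectic group. -/
def liftFam (hg : 4 ≤ g) (hπ : Function.Surjective π) (p : Sp g ℤ →* F) (i j : Idx g) (t : ℤ) : Γ :=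
  if pl i = pl j then longLift hg hπ p i ^ t else shortLift hg hπ p i j ^ t

omit hc in
theorem liftFam_same (i : Idx g) (t : ℤ) :
    liftFam hg hπ p i i t = longLift hg hπ p i ^ t := by simp [liftFam]

omit hc in
theorem liftFam_ne {i j : Idx g} (h : pl i ≠ pl j) (t : ℤ) :
    liftFam hg hπ p i j t = shortLift hg hπ p i j ^ t := by simp [liftFam, h]

omit hc in
theorem map_liftFam (i j : Idx g) (h : j ≠ bar i) (t : ℤ) :
    π (liftFam hg hπ p i j t) = p (rootSp i j t) := by
  rw [rootSp_eq_zpow i j h, map_zpow]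
  by_cases e : pl i = pl j
  · have : i = j := by grind
    subst this
    rw [liftFam_same, map_zpow, map_longLift]
  · rw [liftFam_ne hg hπ e, map_zpow, map_shortLift hg hπ i j e]

theorem spDatum_liftFam : SpDatum (liftFam hg hπ p) where
  add_short i j s t h := by simp only [liftFam_ne hg hπ h, zpow_add]
  symm i j t h := by
    by_cases e : pl i = pl j
    · have : i = j := by grind
      rw [this]
    · rw [liftFam_ne hg hπ e, liftFam_ne hg hπ (Ne.symm e), shortLift_symm hg hπ hc i j e]
  comm_short i j k l s t h1 h2 h3 h4 h5 h6 := by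
    rw [liftFam_ne hg hπ h1, liftFam_ne hg hπ h2]
    exact (shortDatum_shortFam (p := p) hg hπ hc).comm_short i j k l s t h1 h2 h3 h4 h5 h6
  conj_short i j l s t h1 h2 h3 := by
    rw [liftFam_ne hg hπ h1, liftFam_ne hg hπ h2, liftFam_ne hg hπ (i := bar j) (by simpa)]
    exact (shortDatum_shortFam (p := p) hg hπ hc).conj_short i j l s t h1 h2 h3
  add_long i s t := by simp only [liftFam_same, zpow_add]
  comm_long_short i k l s t h1 h2 h3 := by
    rw [liftFam_same, liftFam_ne hg hπ h1]
    exact (lift_commute hg hc hπ (map_longLift hg hπ i) (map_shortLift hg hπ k l h1) (by grind)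
      (by grind) h2 h2 h3 h3).zpow_zpow _ _
  comm_long i k s t h := by
    rw [liftFam_same, liftFam_same]
    exact (lift_commute hg hc hπ (map_longLift hg hπ i) (map_longLift hg hπ k) (by grind)
      (by grind) h h h h).zpow_zpow _ _
  conj_opp i j s t h := by
    have e := commutator_shortLift_opp (p := p) hg hπ hc j i h.symm
    rw [← longLift_eq hg hπ hc i j h.symm] at e
    have c1 := lift_commute hg hc hπ (map_longLift (p := p) hg hπ i)
      (map_shortLift (p := p) hg hπ j i h.symm) (by grind) (by grind) (by grind) (by grind) (by grind)
      (by grind)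
    have c2 := lift_commute hg hc hπ (map_longLift (p := p) hg hπ i)
      (map_shortLift (p := p) hg hπ (bar j) i (by simpa using h.symm)) (by grind) (by grind)
      (by grind) (by grind) (by grind) (by grind)
    have e1 := commutator_zpow_zpow (a := shortLift hg hπ p j i ^ (sg j : ℤ))
      (b := shortLift hg hπ p (bar j) i) (by rw [e]; exact ((c1.zpow_right _).pow_left _).symm)
      (by rw [e]; exact c2.pow_left _) (sg j * s) t
    rw [← zpow_mul, ← mul_assoc, sg_mul_self, one_mul, e, ← zpow_natCast, ← zpow_mul] at e1
    rw [liftFam_ne hg hπ h, liftFam_same, liftFam_ne hg hπ (i := bar j) (by simpa using h.symm),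
      shortLift_symm hg hπ hc i j h, conj_eq_commutator_mul, e1]
    congr 2
    push_cast
    ring
  conj_long j l s t h := by
    have e := commutator_shortLift_opp (p := p) hg hπ hc j l h
    rw [← longLift_eq hg hπ hc l j h] at e
    have m1 := map_shortLift (p := p) hg hπ j l h
    have m2 := map_shortLift (p := p) hg hπ (bar j) l (by simpa)
    have m3 := map_longLift (p := p) hg hπ j
    have m4 := map_longLift (p := p) hg hπ l
    have c1 := lift_commute hg hc hπ m3 m1 (by grind) (by grind) (by grind) (by grind) (by grind)
      (by grind)
    have c2 := lift_commute hg hc hπ m3 m4 (by grind) (by grind) (by grind) (by grind) (by grind)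
      (by grind)
    have c3 := lift_commute hg hc hπ m4 m1 (by grind) (by grind) (by grind) (by grind) (by grind)
      (by grind)
    have c4 := lift_commute hg hc hπ m4 m2 (by grind) (by grind) (by grind) (by grind) (by grind)
      (by grind)
    have e1 : MulAut.conj (longLift hg hπ p j) (shortLift hg hπ p (bar j) l) =
        shortLift hg hπ p j l ^ (sg j : ℤ) * (longLift hg hπ p l)⁻¹ *
          shortLift hg hπ p (bar j) l := by
      rw [conj_eq_of_map_eq hc (m3.trans (map_rtLift hπ j j).symm), conj_eq_commutator_mul,
        longLift_eq hg hπ hc l j h, longVia]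
      group
    rw [liftFam_same, liftFam_same, liftFam_ne hg hπ h,
      liftFam_ne hg hπ (i := bar j) (by simpa), conj_long_zpow e1 (c1.zpow_right _) c2
      (c3.zpow_right _) c4 e ((c3.zpow_right _).pow_left _).symm, ← zpow_mul, mul_assoc (sg j)]

omit hc in
include hg in
theorem SpDatum.eq_one_of_central {z : Idx g → Idx g → ℤ → Γ} (hz : SpDatum z) (n : ℤ)
    (hn : ∀ i j, j ≠ bar i → z i j n ∈ center Γ) {i j : Idx g} (h : j ≠ bar i) : z i j n = 1 := by
  have hs (i l : Idx g) (h : pl i ≠ pl l) : z i l n = 1 := by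
    obtain ⟨m, m1, m2, -⟩ := exists_pl_ne hg i l l
    have := hz.conj_short i m l n (sg m) m1.symm h m2
    rw [conj_of_commute (mem_center_iff.1 (hn i m (by grind)) _).symm, right_eq_mul,
      mul_right_comm, sg_mul_self, one_mul] at this
    exact this
  by_cases e : pl i = pl j
  · have : i = j := by grind
    subst this
    obtain ⟨m, m1, -, -⟩ := exists_pl_ne hg i i i
    have := hz.conj_long m i n 1 m1
    rw [conj_of_commute (mem_center_iff.1 (hn m m (by grind)) _).symm, right_eq_mul, mul_one,
      one_pow, mul_one, hz.neg (by grind)] at this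
    have h2 : z m i (sg m * n) = 1 := by
      rcases sg_eq (R := ℤ) m with h | h
      · rw [h, one_mul, hs _ _ m1]
      · rw [h, neg_one_mul, hz.neg (by grind), hs _ _ m1, inv_one]
    rw [h2, one_mul, inv_eq_one] at this
    exact this
  · exact hs i j e

end SymplecticSteinberg

namespace SymplecticSteinberg
open Subgroup
variable {g : ℕ} {R : Type} [CommRing R] {S : Type} [Group S] {z : Idx g → Idx g → R → S}

/-- The subgroup generated by the root elements with labels in `P`. -/
def rootGrp (z : Idx g → Idx g → R → S) (P : Idx g → Idx g → Prop) : Subgroup S :=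
  closure {x | ∃ k l t, P k l ∧ l ≠ bar k ∧ x = z k l t}

theorem mem_rootGrp {P : Idx g → Idx g → Prop} {k l : Idx g} (h : P k l) (h' : l ≠ bar k) (t : R) :
    z k l t ∈ rootGrp z P := subset_closure ⟨k, l, t, h, h', rfl⟩

theorem rootGrp_le {P : Idx g → Idx g → Prop} {H : Subgroup S}
    (h : ∀ k l t, P k l → l ≠ bar k → z k l t ∈ H) : rootGrp z P ≤ H := by
  rw [rootGrp, closure_le]
  rintro _ ⟨k, l, t, hk, hl, rfl⟩
  exact h k l t hk hl

theorem rootGrp_mono {P P' : Idx g → Idx g → Prop} (h : ∀ k l, P k l → P' k l) :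
    rootGrp z P ≤ rootGrp z P' :=
  rootGrp_le fun _ _ t hk hl => mem_rootGrp (h _ _ hk) hl t

theorem SpDatum.conj_bar_mem (hz : SpDatum z) {P : Idx g → Idx g → Prop}
    (hs : ∀ k l, P k l → P l k) {p q : Idx g} (hpq : q ≠ bar p) (hO : ¬ P (bar p) (bar q))
    (hC : ∀ l, P (bar p) l → l ≠ p → l ≠ bar q → P q l)
    (hD : p = q → ∀ l, P (bar p) l → l ≠ p → l ≠ bar p → P l l) (s t : R) (l : Idx g)
    (hl : P (bar p) l) (hl' : l ≠ p) :
    MulAut.conj (z p q s) (z (bar p) l t) ∈ rootGrp z P := by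
  have hlq : l ≠ bar q := fun h => hO (h ▸ hl)
  by_cases e : p = q
  · subst e
    rw [hz.conj_long p l s t (by grind)]
    exact mul_mem (mul_mem (mem_rootGrp (hC l hl hl' hlq) (by grind) _)
      (mem_rootGrp (hD rfl l hl hl' hlq) (by grind) _)) (mem_rootGrp hl (by grind) _)
  have e' : pl p ≠ pl q := by grind
  by_cases h1 : l = bar p
  · subst h1
    have h3 := hC _ hl hl' hlq
    have h4 := hC _ (hs _ _ h3) (Ne.symm e) (by grind)
    have h2 := conj_eq_iff.1 (hz.conj_long (bar p) q t s (by simpa))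
    rw [bar_bar] at h2
    have h5 : MulAut.conj (z p q s) (z (bar p) (bar p) t) =
        (z (bar p) q (sg (bar p) * t * s) * z q q (-(t * s ^ 2)))⁻¹ * z (bar p) (bar p) t := by
      rw [conj_eq_iff, mul_assoc, h2]; group
    rw [h5]
    exact mul_mem (inv_mem (mul_mem (mem_rootGrp (hs _ _ h3) (by grind) _)
      (mem_rootGrp h4 (by grind) _))) (mem_rootGrp hl (by grind) _)
  rw [hz.symm p q _ hpq]
  by_cases h2 : l = q
  · subst h2
    rw [hz.conj_opp l p s t (Ne.symm e')]
    exact mul_mem (mem_rootGrp (hC l hl hl' hlq) (by grind) _) (mem_rootGrp hl (by grind) _)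
  rw [hz.conj_short q p l s t (Ne.symm e') (by grind) (by grind)]
  exact mul_mem (mem_rootGrp (hC l hl hl' hlq) (by grind) _) (mem_rootGrp hl (by grind) _)

theorem SpDatum.conj_mem_rootGrp (hz : SpDatum z) {P : Idx g → Idx g → Prop}
    (hs : ∀ k l, P k l → P l k) {p q : Idx g} (hpq : q ≠ bar p) (hO : ¬ P (bar p) (bar q))
    (hC : ∀ l, P (bar p) l → l ≠ p → l ≠ bar q → P q l)
    (hC' : ∀ l, P (bar q) l → l ≠ q → l ≠ bar p → P p l)
    (hD : p = q → ∀ l, P (bar p) l → l ≠ p → l ≠ bar p → P l l) (s : R) {x : S}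
    (hx : x ∈ rootGrp z P) : MulAut.conj (z p q s) x ∈ rootGrp z P := by
  suffices h : rootGrp z P ≤ (rootGrp z P).comap (MulAut.conj (z p q s)).toMonoidHom from h hx
  refine rootGrp_le fun k l t hk hl => ?_
  rw [mem_comap]
  show MulAut.conj (z p q s) (z k l t) ∈ rootGrp z P
  have hO' : ¬ P (bar q) (bar p) := fun h => hO (hs _ _ h)
  have hD' : q = p → ∀ l, P (bar q) l → l ≠ q → l ≠ bar q → P l l := by
    rintro rfl; exact hD rfl
  by_cases h1 : k = bar p
  · subst h1
    exact hz.conj_bar_mem hs hpq hO hC hD s t l hk (by simpa using hl)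
  by_cases h2 : l = bar p
  · subst h2
    rw [hz.symm k (bar p) t hl]
    exact hz.conj_bar_mem hs hpq hO hC hD s t k (hs _ _ hk) (by grind)
  by_cases h3 : k = bar q
  · subst h3
    rw [hz.symm p q _ hpq]
    exact hz.conj_bar_mem hs (by grind) hO' hC' hD' s t l hk (by simpa using hl)
  by_cases h4 : l = bar q
  · subst h4
    rw [hz.symm p q _ hpq, hz.symm k (bar q) t hl]
    exact hz.conj_bar_mem hs (by grind) hO' hC' hD' s t k (hs _ _ hk) (by grind)
  rw [conj_of_commute (hz.comm _ _ _ _ _ _ hpq hl h1 h3 h2 h4)]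
  exact mem_rootGrp hk hl _

theorem SpDatum.exists_factor (hz : SpDatum z) {P P' : Idx g → Idx g → Prop} {p q : Idx g}
    (hpq : q ≠ bar p) (hP : ∀ k l, P k l → P' k l ∨ (k = p ∧ l = q) ∨ (k = q ∧ l = p))
    (hn : ∀ s x, x ∈ rootGrp z P' → MulAut.conj (z p q s) x ∈ rootGrp z P') {x : S}
    (hx : x ∈ rootGrp z P) : ∃ t, ∃ y ∈ rootGrp z P', x = z p q t * y := by
  have key (k l : Idx g) (hk : P k l) (hl : l ≠ bar k) (t : R) (y : S)
      (hy : ∃ t, ∃ y' ∈ rootGrp z P', y = z p q t * y') :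
      ∃ t', ∃ y' ∈ rootGrp z P', z k l t * y = z p q t' * y' := by
    obtain ⟨r, y', hy', rfl⟩ := hy
    have h0 : z k l t ∈ rootGrp z P' ∨ z k l t = z p q t := by
      rcases hP k l hk with h | ⟨rfl, rfl⟩ | ⟨rfl, rfl⟩
      · exact Or.inl (mem_rootGrp h hl t)
      · exact Or.inr rfl
      · exact Or.inr (hz.symm _ _ _ hl)
    rcases h0 with h | h
    · refine ⟨r, MulAut.conj (z p q (-r)) (z k l t) * y', mul_mem (hn _ _ h) hy', ?_⟩
      rw [MulAut.conj_apply, hz.neg hpq]; group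
    · exact ⟨t + r, y', hy', by rw [h, hz.add p q hpq, mul_assoc]⟩
  rw [rootGrp] at hx
  induction hx using closure_induction_left with
  | one => exact ⟨0, 1, one_mem _, by rw [hz.zero hpq, one_mul]⟩
  | mul_left x hx y _ ih =>
    obtain ⟨k, l, t, hk, hl, rfl⟩ := hx
    exact key k l hk hl t y ih
  | inv_mul_cancel x hx y _ ih =>
    obtain ⟨k, l, t, hk, hl, rfl⟩ := hx
    rw [← hz.neg hl]
    exact key k l hk hl (-t) y ih

theorem SpDatum.entry_rootGrp (hz : SpDatum z) (π : S →* Sp g R)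
    (hπ : ∀ i j t, j ≠ bar i → π (z i j t) = rootSp i j t) {P Rel : Idx g → Idx g → Prop}
    (hP : ∀ k l, P k l → Rel k (bar l) ∧ Rel l (bar k)) (hirr : ∀ k, ¬ Rel k k)
    (htrans : ∀ j k l, Rel j k → Rel k l → Rel j l) {x : S} (hx : x ∈ rootGrp z P) (q p : Idx g)
    (h : ¬ Rel q p) : (π x).1 q p = if q = p then 1 else 0 := by
  have key (i j : Idx g) (hij : P i j) (hij' : j ≠ bar i) (t : R) (y : S)
      (ih : ∀ q p, ¬ Rel q p → (π y).1 q p = if q = p then 1 else 0) (q p : Idx g)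
      (h : ¬ Rel q p) : (π (z i j t * y)).1 q p = if q = p then 1 else 0 := by
    have aux (a b : Idx g) (hab : Rel a b) (hqa : q = a) : (π y).1 b p = 0 := by
      subst hqa
      rw [ih b p (fun h' => h (htrans _ _ _ hab h')), if_neg]
      rintro rfl
      exact h hab
    rw [map_mul, hπ i j t hij', rootSp_mul_apply hij', ih q p h]
    have h1 : (if q = i then sg j * t * (π y).1 (bar j) p else 0) = 0 := by
      split_ifs with e
      · rw [aux i (bar j) (hP _ _ hij).1 e, mul_zero]
      · rfl
    have h2 : (if q = j ∧ i ≠ j then sg i * t * (π y).1 (bar i) p else 0) = 0 := by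
      split_ifs with e
      · rw [aux j (bar i) (hP _ _ hij).2 e.1, mul_zero]
      · rfl
    rw [h1, h2, add_zero, add_zero]
  rw [rootGrp] at hx
  induction hx using closure_induction_left generalizing q p with
  | one => rw [map_one]; rfl
  | mul_left x hx y _ ih =>
    obtain ⟨k, l, t, hk, hl, rfl⟩ := hx
    exact key k l hk hl t y (fun q p h => ih q p h) q p h
  | inv_mul_cancel x hx y _ ih =>
    obtain ⟨k, l, t, hk, hl, rfl⟩ := hx
    rw [← hz.neg hl]
    exact key k l hk hl (-t) y (fun q p h => ih q p h) q p h

end SymplecticSteinberg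

namespace SymplecticSteinberg
open Subgroup
variable {g : ℕ} {R : Type} [CommRing R] {S : Type} [Group S] {z : Idx g → Idx g → R → S}

/-- A strict ordering of the symplectic basis by odd weights, compatible with duality. -/
structure Weight (φ : Idx g → ℤ) : Prop where
  bar : ∀ k, φ (bar k) = -φ k
  inj : ∀ k l, φ k = φ l → k = l
  odd : ∀ k, φ k % 2 = 1
  pred : ∀ k, 3 ≤ φ k → ∃ k', φ k' = φ k - 2

theorem exists_weight (g : ℕ) : ∃ φ : Idx g → ℤ, Weight φ ∧ Weight (-φ) ∧ ∀ i, 0 < φ (Sum.inl i) := by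
  have hp (n : ℤ) (i : Fin g) (h : n = 2 * ((g : ℤ) - (i : ℕ)) - 1) (h3 : 3 ≤ n) :
      ∃ j : Fin g, 2 * ((g : ℤ) - (j : ℕ)) - 1 = n - 2 :=
    ⟨⟨i + 1, by omega⟩, by push_cast; omega⟩
  have hi (i j : Fin g) (h : (2 * ((g : ℤ) - (i : ℕ)) - 1 : ℤ) = 2 * ((g : ℤ) - (j : ℕ)) - 1) : i = j :=
    Fin.ext (by omega)
  refine ⟨Sum.elim (fun i => 2 * ((g : ℤ) - (i : ℕ)) - 1) (fun i => -(2 * ((g : ℤ) - (i : ℕ)) - 1)),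
    ⟨?_, ?_, ?_, ?_⟩, ⟨?_, ?_, ?_, ?_⟩, fun i => ?_⟩
  · rintro (i | i) <;> simp
  · rintro (i | i) (j | j) h <;> simp only [Sum.elim_inl, Sum.elim_inr] at h
    · rw [hi i j h]
    · omega
    · omega
    · rw [hi i j (by omega)]
  · rintro (i | i) <;> simp only [Sum.elim_inl, Sum.elim_inr] <;> omega
  · rintro (i | i) h <;> simp only [Sum.elim_inl, Sum.elim_inr] at h ⊢
    · obtain ⟨j, hj⟩ := hp _ i rfl h
      exact ⟨Sum.inl j, hj⟩
    · omega
  · rintro (i | i) <;> simp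
  · rintro (i | i) (j | j) h <;> simp only [Pi.neg_apply, Sum.elim_inl, Sum.elim_inr] at h
    · rw [hi i j (by omega)]
    · omega
    · omega
    · rw [hi i j (by omega)]
  · rintro (i | i) <;> simp only [Pi.neg_apply, Sum.elim_inl, Sum.elim_inr] <;> omega
  · rintro (i | i) h <;> simp only [Pi.neg_apply, Sum.elim_inl, Sum.elim_inr] at h ⊢
    · omega
    · obtain ⟨j, hj⟩ := hp _ i rfl (by omega)
      exact ⟨Sum.inr j, by simp only [Sum.elim_inr]; omega⟩
  · simp only [Sum.elim_inl]; omega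

/-- A closed symmetric set of roots. -/
structure RootSys (Q : Idx g → Idx g → Prop) : Prop where
  symm : ∀ k l, Q k l → Q l k
  bar : ∀ k l, Q k l → Q (bar k) (bar l)
  sum : ∀ p q l, Q p q → Q (SymplecticSteinberg.bar p) l → Q q l
  long : ∀ p l, Q p p → Q (SymplecticSteinberg.bar p) l → Q l l

/-- The positive roots of a closed symmetric set. -/
def Pos (φ : Idx g → ℤ) (Q : Idx g → Idx g → Prop) (k l : Idx g) : Prop := Q k l ∧ 0 < φ k + φ l

theorem Weight.ne_bar_of_pos {φ : Idx g → ℤ} (hφ : Weight φ) {k l : Idx g} (h : 0 < φ k + φ l) :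
    l ≠ SymplecticSteinberg.bar k := by
  rintro rfl
  rw [hφ.bar] at h
  omega

open Classical in
theorem SpDatum.eq_one_of_closed (hz : SpDatum z) (π : S →* Sp g R)
    (hπ : ∀ i j t, j ≠ bar i → π (z i j t) = rootSp i j t) {φ : Idx g → ℤ} (hφ : Weight φ) (n : ℕ) :
    ∀ P : Idx g → Idx g → Prop, (Finset.univ.filter fun a : Idx g × Idx g => P a.1 a.2).card ≤ n →
    (∀ k l, P k l → 0 < φ k + φ l) → (∀ k l, P k l → P l k) →
    (∀ p q l, P p q → P (bar p) l → P q l) → (∀ p l, P p p → P (bar p) l → P l l) →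
    ∀ x ∈ rootGrp z P, π x = 1 → x = 1 := by
  induction n with
  | zero =>
    intro P hc _ _ _ _ x hx _
    have h0 : ∀ k l, ¬ P k l := by
      intro k l h
      rw [Nat.le_zero, Finset.card_eq_zero] at hc
      exact absurd (hc ▸ Finset.mem_filter.2 ⟨Finset.mem_univ (k, l), h⟩) (Finset.notMem_empty _)
    have : rootGrp z P ≤ ⊥ := rootGrp_le fun k l t h => absurd h (h0 k l)
    simpa using this hx
  | succ n ih =>
    intro P hc hpos hs hsum hlong x hx hx1
    by_cases hne : (Finset.univ.filter fun a : Idx g × Idx g => P a.1 a.2).Nonempty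
    swap
    · refine ih P ?_ hpos hs hsum hlong x hx hx1
      rw [Finset.not_nonempty_iff_eq_empty.1 hne]; simp
    obtain ⟨⟨p, q⟩, hpq, hmin⟩ := Finset.exists_min_image _ (fun a : Idx g × Idx g => φ a.1 + φ a.2) hne
    simp only [Finset.mem_filter, Finset.mem_univ, true_and] at hpq hmin
    replace hmin : ∀ k l, P k l → φ p + φ q ≤ φ k + φ l := fun k l h => hmin (k, l) h
    have hm := hpos _ _ hpq
    have hb := hφ.bar
    let P' : Idx g → Idx g → Prop := fun k l => P k l ∧ ¬ (k = p ∧ l = q) ∧ ¬ (k = q ∧ l = p)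
    have hP' (k l : Idx g) (h : P k l) (hw : φ p + φ q < φ k + φ l) : P' k l := by
      refine ⟨h, ?_, ?_⟩ <;> (rintro ⟨rfl, rfl⟩; omega)
    have hs' : ∀ k l, P' k l → P' l k := fun k l h => ⟨hs _ _ h.1, by have := h.2; tauto⟩
    have hpqb : q ≠ bar p := hφ.ne_bar_of_pos hm
    have hn : ∀ s x, x ∈ rootGrp z P' → MulAut.conj (z p q s) x ∈ rootGrp z P' := by
      intro s x hx
      refine hz.conj_mem_rootGrp hs' hpqb ?_ ?_ ?_ ?_ s hx
      · intro h
        have := hpos _ _ h.1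
        rw [hb, hb] at this
        omega
      · intro l h _ _
        have := hpos _ _ h.1
        rw [hb] at this
        exact hP' _ _ (hsum _ _ _ hpq h.1) (by omega)
      · intro l h _ _
        have := hpos _ _ h.1
        rw [hb] at this
        exact hP' _ _ (hsum _ _ _ (hs _ _ hpq) h.1) (by omega)
      · rintro rfl l h _ _
        have := hpos _ _ h.1
        rw [hb] at this
        exact hP' _ _ (hlong _ _ hpq h.1) (by omega)
    obtain ⟨t, y, hy, rfl⟩ := hz.exists_factor hpqb (P' := P') (fun k l h => by
      by_cases h1 : k = p ∧ l = q
      · exact Or.inr (Or.inl h1)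
      by_cases h2 : k = q ∧ l = p
      · exact Or.inr (Or.inr h2)
      exact Or.inl ⟨h, h1, h2⟩) hn hx
    have hentry := hz.entry_rootGrp π hπ (P := P')
      (Rel := fun k l => φ p + φ q < φ k - φ l ∨ (φ p + φ q = φ k - φ l ∧ P' k (bar l)))
      (fun k l h => by
        have := hmin _ _ h.1
        simp only [hb, bar_bar]
        constructor
        · rcases this.lt_or_eq with h' | h'
          · left; omega
          · exact Or.inr ⟨by omega, h⟩
        · rcases this.lt_or_eq with h' | h'
          · left; omega
          · exact Or.inr ⟨by omega, hs' _ _ h⟩)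
      (fun k h => by omega) (fun j k l h h' => by left; omega) hy
    have e1 := hentry p (bar q) (by
      rintro (h | ⟨_, h⟩)
      · rw [hb] at h; omega
      · rw [bar_bar] at h; exact h.2.1 ⟨rfl, rfl⟩)
    rw [if_neg (fun h => hpqb (by rw [h, bar_bar]))] at e1
    have e2 := hentry (bar q) (bar q) (by rintro (h | h) <;> omega)
    have e3 := congrArg (fun N : Sp g R => N.1 p (bar q)) hx1
    have hpne : p ≠ bar q := fun h => hpqb (by rw [h, bar_bar])
    simp only [map_mul] at e3
    rw [hπ p q t hpqb, rootSp_mul_apply hpqb, e1, e2, if_pos rfl, if_pos rfl,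
      if_neg (fun h => h.2 h.1)] at e3
    have e4 : sg q * t = 0 := by
      have h1 : ((1 : Sp g R).1 p (bar q)) = 0 := Matrix.one_apply_ne hpne
      rw [h1] at e3
      linear_combination e3
    have ht : t = 0 := by linear_combination sg q * e4 - t * (sg_sq (R := R) q)
    subst ht
    rw [hz.zero hpqb, one_mul] at hx1 ⊢
    refine ih P' ?_ (fun k l h => hpos _ _ h.1) hs' (fun a b l h1 h2 => ?_) (fun a l h1 h2 => ?_) y hy hx1
    · refine Nat.le_of_lt_succ (lt_of_lt_of_le (Finset.card_lt_card ?_) hc)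
      refine (Finset.ssubset_iff_of_subset fun a ha => ?_).2 ⟨(p, q), ?_, ?_⟩
      · simp only [Finset.mem_filter, Finset.mem_univ, true_and] at ha ⊢; exact ha.1
      · simpa using hpq
      · simp [P']
    · have := hmin _ _ h1.1
      have h3 := hmin _ _ h2.1
      rw [hb] at h3
      exact hP' _ _ (hsum _ _ _ h1.1 h2.1) (by omega)
    · have := hmin _ _ h1.1
      have h3 := hmin _ _ h2.1
      rw [hb] at h3
      exact hP' _ _ (hlong _ _ h1.1 h2.1) (by omega)

theorem SpDatum.eq_one_of_pos (hz : SpDatum z) (π : S →* Sp g R)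
    (hπ : ∀ i j t, j ≠ bar i → π (z i j t) = rootSp i j t) {φ : Idx g → ℤ} (hφ : Weight φ)
    {Q : Idx g → Idx g → Prop} (hQ : RootSys Q) {x : S} (hx : x ∈ rootGrp z (Pos φ Q))
    (h : π x = 1) : x = 1 := by
  classical
  have hb := hφ.bar
  refine hz.eq_one_of_closed π hπ hφ _ _ le_rfl (fun k l h => h.2)
    (fun k l h => ⟨hQ.symm _ _ h.1, by have := h.2; omega⟩)
    (fun p q l h h' => ⟨hQ.sum _ _ _ h.1 h'.1, ?_⟩)
    (fun p l h h' => ⟨hQ.long _ _ h.1 h'.1, ?_⟩) x hx h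
  all_goals
    have h1 := h.2
    have h2 := h'.2
    rw [hb] at h2
    omega

theorem SpDatum.entry_pos (hz : SpDatum z) (π : S →* Sp g R)
    (hπ : ∀ i j t, j ≠ bar i → π (z i j t) = rootSp i j t) {φ : Idx g → ℤ} (hφ : Weight φ)
    {Q : Idx g → Idx g → Prop} {x : S} (hx : x ∈ rootGrp z (Pos φ Q)) (q p : Idx g)
    (h : φ q ≤ φ p) : (π x).1 q p = if q = p then 1 else 0 := by
  refine hz.entry_rootGrp π hπ (Rel := fun k l => φ l < φ k) (fun k l h => ?_) (fun k => lt_irrefl _)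
    (fun j k l h h' => h'.trans h) hx q p (not_lt.2 h)
  have := h.2
  have h1 := hφ.bar k
  have h2 := hφ.bar l
  constructor <;> omega

/-- A product of an upper unitriangular, a diagonal and a lower unitriangular element acting
trivially has trivial factors. -/
theorem SpDatum.eq_one_of_triple (hz : SpDatum z) (π : S →* Sp g R)
    (hπ : ∀ i j t, j ≠ bar i → π (z i j t) = rootSp i j t) {φ : Idx g → ℤ} (hφ : Weight φ)
    (hφ' : Weight (-φ)) {Q : Idx g → Idx g → Prop} (hQ : RootSys Q) {u h v : S}
    (hu : u ∈ rootGrp z (Pos φ Q)) (hv : v ∈ rootGrp z (Pos (-φ) Q))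
    (hh : ∃ c, (π h).1 = Matrix.diagonal c) (h1 : π (u * h * v) = 1) :
    u = 1 ∧ π h = 1 ∧ v = 1 := by
  obtain ⟨c, hc⟩ := hh
  have e : π u * π h = π v⁻¹ := by
    rw [map_mul, map_mul] at h1
    rw [map_inv, eq_inv_iff_mul_eq_one, h1]
  have key (q p : Idx g) : (π u).1 q p * c p = (π v⁻¹).1 q p := by
    rw [← e]
    show _ = ((π u).1 * (π h).1) q p
    rw [hc, Matrix.mul_diagonal]
  have hu1 := fun q p => hz.entry_pos π hπ hφ hu q p
  have hv1 := fun q p => hz.entry_pos π hπ hφ' (inv_mem hv) q p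
  have hd (q : Idx g) : c q = 1 := by
    have := key q q
    rw [hu1 q q le_rfl, hv1 q q le_rfl, if_pos rfl, one_mul] at this
    exact this
  have hπh : π h = 1 := by
    apply Subtype.ext
    rw [hc]
    show _ = (1 : Matrix _ _ R)
    rw [← Matrix.diagonal_one]
    congr 1
    exact funext hd
  have hπu : π u = 1 := by
    apply Subtype.ext
    ext q p
    show _ = (1 : Matrix _ _ R) q p
    rw [Matrix.one_apply]
    rcases le_total (φ q) (φ p) with h' | h'
    · exact hu1 q p h'
    · have := key q p
      rw [hd, mul_one] at this
      rw [this]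
      exact hv1 q p (by simpa using h')
  rw [map_mul, map_mul, hπu, hπh, one_mul, one_mul] at h1
  exact ⟨hz.eq_one_of_pos π hπ hφ hQ hu hπu, hπh, hz.eq_one_of_pos π hπ hφ' hQ hv h1⟩

end SymplecticSteinberg

namespace SymplecticSteinberg
open Subgroup
variable {R : Type} [CommRing R] {S : Type} [Group S]

/-- A rank one configuration: two opposite root subgroups together with a torus. -/
structure RankOne (X Y : R → S) (κ : R) (W : Rˣ → S) (H : Subgroup S) : Prop where
  addX : ∀ s t, X (s + t) = X s * X t
  addY : ∀ s t, Y (s + t) = Y s * Y t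
  sq : κ * κ = 1
  eqX : ∀ u, W u = X u * Y (κ * ↑u⁻¹) * X u
  eqY : ∀ u, W u = Y (κ * ↑u⁻¹) * X u * Y (κ * ↑u⁻¹)
  weylX : ∀ u t, W u * X t = Y (κ * (↑u⁻¹ * ↑u⁻¹) * t) * W u
  weylY : ∀ u t, W u * Y t = X (κ * (u * u) * t) * W u
  torus : ∀ u v, W u * W v ∈ H
  normX : ∀ h ∈ H, ∀ t, ∃ t', X t * h = h * X t'
  normY : ∀ h ∈ H, ∀ t, ∃ t', Y t * h = h * Y t'

namespace RankOne
variable {X Y : R → S} {κ : R} {W : Rˣ → S} {H : Subgroup S}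

/-- The big cell of a rank one configuration. -/
def cell (X Y : R → S) (H : Subgroup S) : Set S :=
  {x | ∃ a b c, ∃ h ∈ H, x = X a * h * Y b * X c}

variable (hr : RankOne X Y κ W H)
include hr

theorem X_zero : X 0 = 1 := by
  have := hr.addX 0 0
  rw [add_zero] at this
  exact left_eq_mul.1 this

theorem Y_zero : Y 0 = 1 := by
  have := hr.addY 0 0
  rw [add_zero] at this
  exact left_eq_mul.1 this

theorem X_mul_cell (a : R) {x : S} (hx : x ∈ cell X Y H) : X a * x ∈ cell X Y H := by
  obtain ⟨a', b, c, h, hh, rfl⟩ := hx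
  exact ⟨a + a', b, c, h, hh, by rw [hr.addX]; group⟩

theorem H_mul_cell {k : S} (hk : k ∈ H) {x : S} (hx : x ∈ cell X Y H) : k * x ∈ cell X Y H := by
  obtain ⟨a', b, c, h, hh, rfl⟩ := hx
  obtain ⟨a, ha⟩ := hr.normX k⁻¹ (inv_mem hk) a'
  refine ⟨a, b, c, k * h, mul_mem hk hh, ?_⟩
  have : k * X a' = X a * k := by
    rw [← mul_inv_eq_iff_eq_mul, mul_assoc, ha]; group
  rw [← mul_assoc, ← mul_assoc, ← mul_assoc, this]; group

theorem cell_mul_X (a : R) {x : S} (hx : x ∈ cell X Y H) : x * X a ∈ cell X Y H := by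
  obtain ⟨a', b, c, h, hh, rfl⟩ := hx
  exact ⟨a', b, c + a, h, hh, by rw [hr.addX]; group⟩

theorem cell_mul_H {k : S} (hk : k ∈ H) {x : S} (hx : x ∈ cell X Y H) : x * k ∈ cell X Y H := by
  obtain ⟨a, b, c, h, hh, rfl⟩ := hx
  obtain ⟨b', hb⟩ := hr.normY k hk b
  obtain ⟨c', hc⟩ := hr.normX k hk c
  exact ⟨a, b', c', h * k, mul_mem hh hk, by rw [mul_assoc, hc, ← mul_assoc, mul_assoc _ _ k, hb]; group⟩

theorem HYX_mem {h : S} (hh : h ∈ H) (b c : R) : h * Y b * X c ∈ cell X Y H :=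
  ⟨0, b, c, h, hh, by rw [hr.X_zero, one_mul]⟩

theorem YHX_mem {h : S} (hh : h ∈ H) (b c : R) : Y b * h * X c ∈ cell X Y H := by
  obtain ⟨b', hb⟩ := hr.normY h hh b
  rw [hb]; exact hr.HYX_mem hh b' c

theorem eq_Y (u : Rˣ) : Y u = X (-(κ * ↑u⁻¹)) * W (⟨κ, κ, hr.sq, hr.sq⟩ * u⁻¹) * X (-(κ * ↑u⁻¹)) := by
  rw [hr.eqX]
  have h1 : κ * ↑(((⟨κ, κ, hr.sq, hr.sq⟩ : Rˣ) * u⁻¹)⁻¹) = (u : R) := by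
    rw [mul_inv, inv_inv, Units.val_mul, Units.inv_mk, ← mul_assoc, hr.sq, one_mul]
  rw [h1]
  show _ = X (-(κ * ↑u⁻¹)) * (X (κ * ↑u⁻¹) * Y u * X (κ * ↑u⁻¹)) * X (-(κ * ↑u⁻¹))
  rw [← mul_assoc, ← mul_assoc, ← hr.addX, mul_assoc, ← hr.addX]
  simp [hr.X_zero]

theorem eq_X (u : Rˣ) : X u = Y (-(κ * ↑u⁻¹)) * W u * Y (-(κ * ↑u⁻¹)) := by
  rw [hr.eqY, ← mul_assoc, ← mul_assoc, ← hr.addY, mul_assoc, ← hr.addY]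
  simp [hr.Y_zero]

theorem mul_W_X (u : Rˣ) (t : R) : ∃ t', X t * W u = W u * Y t' :=
  ⟨κ * (↑u⁻¹ * ↑u⁻¹) * t, by
    rw [hr.weylY]; congr 2
    linear_combination (-t - t * (u * ↑u⁻¹) * (κ * κ)) * u.mul_inv - t * (u * ↑u⁻¹) * hr.sq⟩

variable [IsLocalRing R]

theorem YX_mul_W_mem (b c : R) : Y b * X c * W 1 ∈ cell X Y H := by
  by_cases hb : IsUnit b
  · obtain ⟨b, rfl⟩ := hb
    rw [hr.eq_Y, mul_assoc _ (X _) (X _), ← hr.addX, mul_assoc, mul_assoc]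
    obtain ⟨t, ht⟩ := hr.mul_W_X 1 (-(κ * ↑b⁻¹) + c)
    rw [ht]
    refine hr.X_mul_cell _ ?_
    have := hr.HYX_mem (hr.torus (⟨κ, κ, hr.sq, hr.sq⟩ * b⁻¹) 1) t 0
    rwa [hr.X_zero, mul_one, mul_assoc] at this
  by_cases hc : IsUnit c
  · obtain ⟨c, rfl⟩ := hc
    have ht : Y (-(κ * ↑c⁻¹)) * W 1 = W 1 * X (κ * -(κ * ↑c⁻¹)) := by
      rw [hr.weylX]; congr 2; simp [← mul_assoc, hr.sq]
    rw [hr.eq_X, ← mul_assoc, ← mul_assoc, ← hr.addY, mul_assoc _ _ (W 1), ht]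
    have := hr.YHX_mem (hr.torus c 1) (b + -(κ * ↑c⁻¹)) (κ * -(κ * ↑c⁻¹))
    rwa [← mul_assoc] at this ⊢
  have e1 : Y b * X c * W 1 = W 1 * (X (κ * b) * Y (κ * c)) := by
    have h1 := hr.weylX 1 (κ * b)
    have h2 := hr.weylY 1 (κ * c)
    simp only [inv_one, Units.val_one, mul_one, ← mul_assoc, hr.sq, one_mul] at h1 h2
    rw [← mul_assoc, h1, mul_assoc, mul_assoc, h2]
  have hκ : IsUnit κ := ⟨⟨κ, κ, hr.sq, hr.sq⟩, rfl⟩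
  have hm : IsUnit (1 + κ * b) := by
    rcases IsLocalRing.isUnit_or_isUnit_of_isUnit_add (a := 1 + κ * b) (b := -(κ * b)) (by simp) with h | h
    · exact h
    · exact absurd (isUnit_of_mul_isUnit_right ((IsUnit.neg_iff _).1 h)) hb
  obtain ⟨u, hu⟩ := hm
  have hq : IsUnit (-(κ * ↑u⁻¹) + κ * c) := by
    rcases IsLocalRing.isUnit_or_isUnit_of_isUnit_add (a := -(κ * ↑u⁻¹) + κ * c) (b := -(κ * c))
      (by simpa using hκ) with h | h
    · exact h
    · exact absurd (isUnit_of_mul_isUnit_right ((IsUnit.neg_iff _).1 h)) hc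
  obtain ⟨r, hr'⟩ := hq
  have e2 : X (κ * b) = X (-1) * X u := by rw [← hr.addX, hu]; congr 1; ring
  obtain ⟨e, he⟩ : ∃ e, e = -(κ * ((r⁻¹ : Rˣ) : R)) := ⟨_, rfl⟩
  obtain ⟨v, hv⟩ : ∃ v, v = (⟨κ, κ, hr.sq, hr.sq⟩ : Rˣ) * r⁻¹ := ⟨_, rfl⟩
  have e3 : X (κ * b) * Y (κ * c) = X (-1) * Y (-(κ * ↑u⁻¹)) * W u * X e * W v * X e := by
    rw [e2, hr.eq_X u, mul_assoc, mul_assoc _ _ (Y (κ * c)), ← hr.addY, ← hr', hr.eq_Y, ← he, ← hv]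
    group
  obtain ⟨q', hq'⟩ : ∃ q', Y (-(κ * ↑u⁻¹)) * W u * X e = Y q' * W u :=
    ⟨_, by rw [mul_assoc, hr.weylX, ← mul_assoc, ← hr.addY]⟩
  have e4 : W 1 * X (-1) = Y (-κ) * W 1 := by rw [hr.weylX]; simp
  have e5 : W 1 * Y q' = X (κ * q') * W 1 := by rw [hr.weylY]; simp
  have e6 : Y (-κ) = X 1 * W (-1) * X 1 := by
    have := hr.eq_Y (-(⟨κ, κ, hr.sq, hr.sq⟩ : Rˣ))
    have h1 : (⟨κ, κ, hr.sq, hr.sq⟩ : Rˣ) * (-⟨κ, κ, hr.sq, hr.sq⟩)⁻¹ = -1 := by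
      ext; simp [hr.sq]
    rw [h1] at this
    simpa [hr.sq] using this
  have e7 : Y b * X c * W 1 = X 1 * (W (-1) * X (1 + κ * q')) * W 1 * (W u * W v) * X e := by
    calc Y b * X c * W 1 = W 1 * X (-1) * (Y (-(κ * ↑u⁻¹)) * W u * X e) * W v * X e := by
          rw [e1, e3]; group
      _ = Y (-κ) * (W 1 * Y q') * W u * W v * X e := by rw [hq', e4]; group
      _ = _ := by rw [e5, e6, hr.addX]; group
  rw [e7, hr.weylX, mul_assoc, mul_assoc, mul_assoc]
  refine hr.X_mul_cell _ ?_
  have := hr.YHX_mem (mul_mem (hr.torus (-1) 1) (hr.torus u v))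
    (κ * (↑(-1 : Rˣ)⁻¹ * ↑(-1 : Rˣ)⁻¹) * (1 + κ * q')) e
  simpa only [mul_assoc] using this

theorem cell_mul_W {x : S} (hx : x ∈ cell X Y H) : x * W 1 ∈ cell X Y H := by
  obtain ⟨a, b, c, h, hh, rfl⟩ := hx
  rw [mul_assoc _ (Y b), mul_assoc, mul_assoc]
  exact hr.X_mul_cell _ (hr.H_mul_cell hh (hr.YX_mul_W_mem b c))

theorem YXY_mem (a b c : R) : Y a * X b * Y c ∈ cell X Y H := by
  have h0 : Y a * X b ∈ cell X Y H := by
    have := hr.HYX_mem (one_mem H) a b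
    rwa [one_mul] at this
  have h1 : Y c = W 1 * X (κ * c) * W 1 * (W 1 * W 1)⁻¹ := by
    rw [hr.weylX]; simp [← mul_assoc, hr.sq]
  rw [h1]
  have := hr.cell_mul_H (inv_mem (hr.torus 1 1)) (hr.cell_mul_W (hr.cell_mul_X (κ * c) (hr.cell_mul_W h0)))
  simpa only [mul_assoc] using this

end RankOne
end SymplecticSteinberg

namespace SymplecticSteinberg
open Subgroup
variable {g : ℕ} {R : Type} [CommRing R] {S : Type} [Group S] {z : Idx g → Idx g → R → S}

theorem wShort_self (j : Idx g) (u : Rˣ) : wShort z j j u = wLong z j u := by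
  simp [wShort, wLong]

theorem Mono.one (hz : SpDatum z) : Mono z 1 1 (fun _ => 1) where
  bar k := rfl
  scale k := by simp
  conj k l t h := by simp

theorem perm_apply_inv (σ : Equiv.Perm (Idx g)) (k : Idx g) : σ (σ⁻¹ k) = k :=
  Equiv.apply_symm_apply σ k

theorem Mono.inv {n : S} {σ : Equiv.Perm (Idx g)} {c : Idx g → Rˣ} (h : Mono z n σ c) :
    Mono z n⁻¹ σ⁻¹ (fun k => (c (σ⁻¹ k))⁻¹) := by
  have hb : ∀ k, σ⁻¹ (SymplecticSteinberg.bar k) = SymplecticSteinberg.bar (σ⁻¹ k) := fun k => by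
    rw [Equiv.Perm.inv_eq_iff_eq, h.bar]; simp
  refine ⟨hb, fun k => ?_, fun k l t hkl => ?_⟩
  · have := h.scale (σ⁻¹ k)
    rw [perm_apply_inv] at this
    rw [hb, ← this]
    have h1 := (c (σ⁻¹ k)).inv_mul
    have h2 := (c (SymplecticSteinberg.bar (σ⁻¹ k))).inv_mul
    linear_combination sg k * h1 + (↑(c (σ⁻¹ k))⁻¹ * ↑(c (σ⁻¹ k)) * sg k) * h2
  · have hne : σ⁻¹ l ≠ SymplecticSteinberg.bar (σ⁻¹ k) := by
      rw [← hb]; exact fun e => hkl (σ⁻¹.injective e)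
    have := h.conj (σ⁻¹ k) (σ⁻¹ l) (↑(c (σ⁻¹ k))⁻¹ * ↑(c (σ⁻¹ l))⁻¹ * t) hne
    rw [perm_apply_inv, perm_apply_inv] at this
    have e : (↑(c (σ⁻¹ k)) * ↑(c (σ⁻¹ l)) * (↑(c (σ⁻¹ k))⁻¹ * ↑(c (σ⁻¹ l))⁻¹ * t) : R) = t := by
      have h1 := (c (σ⁻¹ k)).mul_inv
      have h2 := (c (σ⁻¹ l)).mul_inv
      linear_combination t * h1 + (↑(c (σ⁻¹ k)) * ↑(c (σ⁻¹ k))⁻¹ * t) * h2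
    rw [e] at this
    rw [← this, ← MulAut.mul_apply, ← map_mul, inv_mul_cancel, map_one, MulAut.one_apply]

/-- The subgroup of elements rescaling every root element. -/
def diagGrp (hz : SpDatum z) : Subgroup S where
  carrier := {h | ∃ c, Mono z h 1 c}
  one_mem' := ⟨_, Mono.one hz⟩
  mul_mem' := by
    rintro a b ⟨c, hc⟩ ⟨d, hd⟩
    exact ⟨_, by simpa using hc.mul hd⟩
  inv_mem' := by
    rintro a ⟨c, hc⟩
    exact ⟨_, by simpa using hc.inv⟩

theorem diag_scale {hz : SpDatum z} {h : S} (hh : h ∈ diagGrp hz) {k l : Idx g} (hkl : l ≠ bar k)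
    (t : R) : ∃ t', z k l t * h = h * z k l t' := by
  obtain ⟨c, hc⟩ := inv_mem hh
  have := hc.conj k l t hkl
  rw [MulAut.conj_apply, inv_inv, mul_assoc, inv_mul_eq_iff_eq_mul] at this
  exact ⟨_, this⟩

theorem diag_conj_mem {hz : SpDatum z} {h : S} (hh : h ∈ diagGrp hz) {P : Idx g → Idx g → Prop} {x : S}
    (hx : x ∈ rootGrp z P) : h⁻¹ * x * h ∈ rootGrp z P := by
  suffices h' : rootGrp z P ≤ (rootGrp z P).comap (MulAut.conj h⁻¹).toMonoidHom by
    have := h' hx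
    rw [mem_comap] at this
    simpa using this
  refine rootGrp_le fun k l t hk hl => ?_
  rw [mem_comap]
  show MulAut.conj h⁻¹ (z k l t) ∈ rootGrp z P
  obtain ⟨t', ht⟩ := diag_scale hh hl t
  rw [MulAut.conj_apply, inv_inv, mul_assoc, ht, inv_mul_cancel_left]
  exact mem_rootGrp hk hl _

theorem SpDatum.weyl_conj (hz : SpDatum z) (hg : 3 ≤ g) {a b : Idx g} (hab : b ≠ bar a) (u : Rˣ) (t : R) :
    MulAut.conj (wShort z a b u) (z a b t) = z (bar a) (bar b) (sg a * sg b * (↑u⁻¹ * ↑u⁻¹) * t) := by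
  have hab' : bar b ≠ bar (bar a) := by grind
  by_cases h : pl a = pl b
  · have e : a = b := by grind
    subst e
    have := (hz.mono_wLong (by omega) a u).conj a a t hab
    rw [wShort_self, this]
    simp [cLong]; congr 1; ring_nf; simp
  have e1 : a ≠ b := by grind
  have e2 : a ≠ bar b := by grind
  have := (hz.mono_wShort hg a b h u).conj a b t hab
  rw [this, hz.symm (bar a) (bar b) _ hab']
  have h1 : (Equiv.swap a (bar b) * Equiv.swap b (bar a)) a = bar b := by
    rw [Equiv.Perm.mul_apply, Equiv.swap_apply_of_ne_of_ne e1 (ne_bar a), Equiv.swap_apply_left]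
  have h2 : (Equiv.swap a (bar b) * Equiv.swap b (bar a)) b = bar a := by
    rw [Equiv.Perm.mul_apply, Equiv.swap_apply_left, Equiv.swap_apply_of_ne_of_ne (bar_ne a) (by grind)]
  rw [h1, h2]
  simp [cShort, e1, e2, hab, Ne.symm e1]; congr 1; ring

theorem SpDatum.weyl_conj_bar (hz : SpDatum z) (hg : 3 ≤ g) {a b : Idx g} (hab : b ≠ bar a) (u : Rˣ) (t : R) :
    MulAut.conj (wShort z a b u) (z (bar a) (bar b) t) = z a b (sg a * sg b * (u * u) * t) := by
  by_cases h : pl a = pl b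
  · have e : a = b := by grind
    subst e
    have := (hz.mono_wLong (by omega) a u).conj (bar a) (bar a) t (by grind)
    rw [wShort_self, this]
    simp [cLong]; congr 1; ring_nf; simp
  have e1 : a ≠ b := by grind
  have e2 : a ≠ bar b := by grind
  have e3 : bar a ≠ b := by grind
  have := (hz.mono_wShort hg a b h u).conj (bar a) (bar b) t (by grind)
  rw [this, hz.symm a b _ hab]
  have h1 : (Equiv.swap a (bar b) * Equiv.swap b (bar a)) (bar a) = b := by
    rw [Equiv.Perm.mul_apply, Equiv.swap_apply_right, Equiv.swap_apply_of_ne_of_ne (Ne.symm e1) (by grind)]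
  have h2 : (Equiv.swap a (bar b) * Equiv.swap b (bar a)) (bar b) = a := by
    rw [Equiv.Perm.mul_apply, Equiv.swap_apply_of_ne_of_ne (bar_ne b) (by grind), Equiv.swap_apply_right]
  rw [h1, h2]
  simp [cShort, e1, e2, hab]; congr 1; ring

theorem SpDatum.rankOne (hz : SpDatum z) (hg : 3 ≤ g) {a b : Idx g} (hab : b ≠ bar a) {T : Subgroup S}
    (hT : T ≤ diagGrp hz) (hw : ∀ u v, wShort z a b u * wShort z a b v ∈ T) :
    RankOne (z a b) (z (bar a) (bar b)) (sg a * sg b) (wShort z a b) T := by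
  have hab' : bar b ≠ bar (bar a) := by grind
  have hX (u t) := conj_eq_iff.1 (hz.weyl_conj hg hab u t)
  have hY (u t) := conj_eq_iff.1 (hz.weyl_conj_bar hg hab u t)
  have h2 := sg_sq (R := R) a
  have h3 := sg_sq (R := R) b
  refine ⟨hz.add a b hab, hz.add _ _ hab', by linear_combination sg b ^ 2 * h2 + h3, fun u => rfl,
    fun u => ?_, hX, hY, hw, fun h hh t => diag_scale (hT hh) hab t,
    fun h hh t => diag_scale (hT hh) hab' t⟩
  have h1 : MulAut.conj (wShort z a b u) (wShort z a b u) = wShort z a b u := by simp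
  conv_lhs => rw [← h1]
  conv_lhs => rw [show wShort z a b u = z a b u * z (bar a) (bar b) (sg a * sg b * ↑u⁻¹) * z a b u from rfl]
  have e : (sg a * sg b * (↑u⁻¹ * ↑u⁻¹) * u : R) = sg a * sg b * ↑u⁻¹ := by
    linear_combination (sg a * sg b * ↑u⁻¹ : R) * u.mul_inv
  have e₂ : (sg a * sg b * (u * u) * (sg a * sg b * ↑u⁻¹) : R) = u := by
    linear_combination (sg b ^ 2 * h2 + h3) * (u * u * ↑u⁻¹ : R) + (u : R) * u.mul_inv
  show MulAut.conj (wShort z a b u) _ = _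
  rw [map_mul, map_mul, hz.weyl_conj hg hab, hz.weyl_conj_bar hg hab, e, e₂]

/-- Positive roots other than a given one. -/
def PosNe (φ : Idx g → ℤ) (Q : Idx g → Idx g → Prop) (p q k l : Idx g) : Prop :=
  Pos φ Q k l ∧ ¬ (k = p ∧ l = q) ∧ ¬ (k = q ∧ l = p)

theorem SpDatum.conj_mem_posNe (hz : SpDatum z) {φ : Idx g → ℤ} (hφ : Weight φ)
    {Q : Idx g → Idx g → Prop} (hQ : RootSys Q) {p q : Idx g} (hpq : Q p q) (h2 : φ p + φ q = 2) (s : R)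
    {x : S} (hx : x ∈ rootGrp z (PosNe φ Q p q)) :
    MulAut.conj (z p q s) x ∈ rootGrp z (PosNe φ Q p q) ∧
    MulAut.conj (z (bar p) (bar q) s) x ∈ rootGrp z (PosNe φ Q p q) := by
  have hb := hφ.bar
  have hne : q ≠ bar p := hφ.ne_bar_of_pos (by omega)
  have hs : ∀ k l, PosNe φ Q p q k l → PosNe φ Q p q l k := fun k l h =>
    ⟨⟨hQ.symm _ _ h.1.1, by have := h.1.2; omega⟩, by have := h.2; tauto⟩
  have key (k l : Idx g) (h : Q k l) (hw : 2 < φ k + φ l) : PosNe φ Q p q k l := by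
    refine ⟨⟨h, by omega⟩, ?_, ?_⟩ <;> (rintro ⟨rfl, rfl⟩; omega)
  have op := hφ.odd p
  have oq := hφ.odd q
  have hbar := hQ.bar _ _ hpq
  have hqp := hQ.symm _ _ hpq
  have hbar' := hQ.symm _ _ hbar
  constructor
  · refine hz.conj_mem_rootGrp hs hne (fun h => ?_) (fun l h _ _ => ?_) (fun l h _ _ => ?_) ?_ s hx
    · have := h.1.2; rw [hb, hb] at this; omega
    · have := h.1.2; rw [hb] at this
      have ol := hφ.odd l
      exact key _ _ (hQ.sum _ _ _ hpq h.1.1) (by omega)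
    · have := h.1.2; rw [hb] at this
      have ol := hφ.odd l
      exact key _ _ (hQ.sum _ _ _ hqp h.1.1) (by omega)
    · rintro rfl l h _ _
      have := h.1.2; rw [hb] at this
      have ol := hφ.odd l
      exact key _ _ (hQ.long _ _ hpq h.1.1) (by omega)
  · refine hz.conj_mem_rootGrp hs (by grind) (fun h => ?_) (fun l h h3 h4 => ?_) (fun l h h3 h4 => ?_) ?_ s hx
    · rw [bar_bar, bar_bar] at h; exact h.2.1 ⟨rfl, rfl⟩
    · rw [bar_bar] at h h4
      have ol := hφ.odd l
      have := h.1.2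
      have h5 : φ l ≠ φ q := fun e => h4 (hφ.inj _ _ e)
      refine ⟨⟨hQ.sum _ _ _ hbar (by rw [bar_bar]; exact h.1.1), by rw [hb]; omega⟩, ?_, ?_⟩
      · rintro ⟨e1, e2⟩; exact h4 e2
      · rintro ⟨e1, e2⟩; exact absurd e1 (bar_ne q)
    · rw [bar_bar] at h h4
      have ol := hφ.odd l
      have := h.1.2
      have h5 : φ l ≠ φ p := fun e => h4 (hφ.inj _ _ e)
      refine ⟨⟨hQ.sum _ _ _ hbar' (by rw [bar_bar]; exact h.1.1), by rw [hb]; omega⟩, ?_, ?_⟩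
      · rintro ⟨e1, e2⟩; exact absurd e1 (bar_ne p)
      · rintro ⟨e1, e2⟩; exact h4 e2
    · intro e l h h3 h4
      have e' : p = q := by simpa using e
      subst e'
      rw [bar_bar] at h h4
      have ol := hφ.odd l
      have := h.1.2
      have h5 : φ l ≠ φ p := fun e => h4 (hφ.inj _ _ e)
      refine ⟨⟨hQ.long _ _ hbar (by rw [bar_bar]; exact h.1.1), by omega⟩, ?_, ?_⟩
      · rintro ⟨e1, e2⟩; exact h4 e2
      · rintro ⟨e1, e2⟩; exact h4 e2

theorem SpDatum.pos_factor (hz : SpDatum z) {φ : Idx g → ℤ} (hφ : Weight φ)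
    {Q : Idx g → Idx g → Prop} (hQ : RootSys Q) {p q : Idx g} (hpq : Q p q) (h2 : φ p + φ q = 2)
    {x : S} (hx : x ∈ rootGrp z (Pos φ Q)) :
    ∃ t, ∃ y ∈ rootGrp z (PosNe φ Q p q), x = z p q t * y := by
  refine hz.exists_factor (hφ.ne_bar_of_pos (by omega)) (fun k l h => ?_)
    (fun s x hx => (hz.conj_mem_posNe hφ hQ hpq h2 s hx).1) hx
  by_cases h1 : k = p ∧ l = q
  · exact Or.inr (Or.inl h1)
  by_cases h2 : k = q ∧ l = p
  · exact Or.inr (Or.inr h2)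
  exact Or.inl ⟨h, h1, h2⟩

/-- The products of a torus element, an upper, a lower and an upper unipotent element. -/
def bigCell (z : Idx g → Idx g → R → S) (φ : Idx g → ℤ) (Q : Idx g → Idx g → Prop) (T : Subgroup S) :
    Set S :=
  {x | ∃ h ∈ T, ∃ u ∈ rootGrp z (Pos φ Q), ∃ v ∈ rootGrp z (Pos (-φ) Q), ∃ u' ∈ rootGrp z (Pos φ Q),
    x = h * u * v * u'}

variable [IsLocalRing R]

theorem SpDatum.bigCell_mul (hz : SpDatum z) (hg : 3 ≤ g) {φ : Idx g → ℤ} (hφ : Weight φ)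
    (hφ' : Weight (-φ)) {Q : Idx g → Idx g → Prop} (hQ : RootSys Q) {T : Subgroup S}
    (hT : T ≤ diagGrp hz) {p q : Idx g} (hpq : Q p q) (h2 : φ p + φ q = 2)
    (hw : ∀ u v, wShort z p q u * wShort z p q v ∈ T) {x : S} (hx : x ∈ bigCell z φ Q T) (s : R) :
    x * z (bar p) (bar q) s ∈ bigCell z φ Q T := by
  have hne : q ≠ bar p := hφ.ne_bar_of_pos (by omega)
  have hne' : bar q ≠ bar (bar p) := by grind
  have h2' : (-φ) (bar p) + (-φ) (bar q) = 2 := by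
    simp only [Pi.neg_apply, hφ.bar]; omega
  have hr := hz.rankOne hg hne hT hw
  obtain ⟨h, hh, u, hu, v, hv, u', hu', rfl⟩ := hx
  obtain ⟨t, y, hy, rfl⟩ := hz.pos_factor hφ hQ hpq h2 hu'
  obtain ⟨r, y₂, hy₂, e₂⟩ := hz.pos_factor hφ' hQ (hQ.bar _ _ hpq) h2' (inv_mem hv)
  have e3 : v = y₂⁻¹ * z (bar p) (bar q) (-r) := by
    rw [hz.neg hne', ← mul_inv_rev, ← e₂, inv_inv]
  obtain ⟨a, b, c, k, hk, e4⟩ := hr.YXY_mem (-r) t s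
  have hy' := (hz.conj_mem_posNe hφ hQ hpq h2 (-s) hy).2
  have hy₂' := (hz.conj_mem_posNe hφ' hQ (hQ.bar _ _ hpq) h2' (-a) (inv_mem hy₂)).2
  rw [bar_bar, bar_bar] at hy₂'
  have hle {φ : Idx g → ℤ} {p q : Idx g} : rootGrp z (PosNe φ Q p q) ≤ rootGrp z (Pos φ Q) :=
    rootGrp_mono fun k l h => h.1
  refine ⟨h * k, mul_mem hh hk, k⁻¹ * (u * z p q a) * k, diag_conj_mem (hT hk)
      (mul_mem hu (mem_rootGrp ⟨hpq, by omega⟩ hne a)),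
    k⁻¹ * (MulAut.conj (z p q (-a)) y₂⁻¹) * k * z (bar p) (bar q) b,
    mul_mem (diag_conj_mem (hT hk) (hle hy₂')) (mem_rootGrp ⟨hQ.bar _ _ hpq, by omega⟩ hne' _),
    z p q c * MulAut.conj (z (bar p) (bar q) (-s)) y,
    mul_mem (mem_rootGrp ⟨hpq, by omega⟩ hne _) (hle hy'), ?_⟩
  rw [MulAut.conj_apply, MulAut.conj_apply, hz.neg hne, hz.neg hne', e3]
  calc _ = h * u * y₂⁻¹ * (z (bar p) (bar q) (-r) * z p q t * z (bar p) (bar q) s) *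
        ((z (bar p) (bar q) s)⁻¹ * y * z (bar p) (bar q) s) := by group
    _ = _ := by rw [e4]; group

end SymplecticSteinberg

namespace SymplecticSteinberg
open Subgroup
variable {g : ℕ} {R : Type} [CommRing R] {S : Type} [Group S] {z : Idx g → Idx g → R → S}

theorem SpDatum.wShort_mem (K : Subgroup S) {a b : Idx g}
    (h1 : ∀ t, z a b t ∈ K) (h2 : ∀ t, z (bar a) (bar b) t ∈ K) (u : Rˣ) : wShort z a b u ∈ K :=
  mul_mem (mul_mem (h1 _) (h2 _)) (h1 _)

theorem SpDatum.long_mem_of_simple (hz : SpDatum z) (hg : 3 ≤ g) {φ : Idx g → ℤ} (hφ : Weight φ)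
    {Q : Idx g → Idx g → Prop} (hQ : RootSys Q)
    (hQφ : ∀ k k', φ k' = φ k - 2 → 0 < φ k' → Q k (bar k')) (K : Subgroup S)
    (hK : ∀ p q t, Q p q → φ p + φ q = 2 → z p q t ∈ K ∧ z (bar p) (bar q) t ∈ K) (n : ℕ) :
    ∀ k, φ k ≤ n → 0 < φ k → Q k k → ∀ t, z k k t ∈ K := by
  induction n with
  | zero => intro k h1 h2; push_cast at h1; omega
  | succ n ih =>
    intro k h1 h2 hk t
    have o := hφ.odd k
    by_cases h3 : φ k = 1
    · exact (hK k k t hk (by omega)).1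
    obtain ⟨k', hk'⟩ := hφ.pred k (by omega)
    have o' := hφ.odd k'
    have q1 := hQφ k k' hk' (by omega)
    have q2 := hQ.bar _ _ q1
    rw [bar_bar] at q2
    have hb := hφ.bar
    have hpl : pl k ≠ pl (bar k') := by
      intro e
      rcases eq_or_eq_bar_of_pl_eq e with e | e
      · have := hb k'; rw [← e] at this; omega
      · rw [bar_bar] at e; rw [e] at hk'; omega
    have hw : wShort z k (bar k') 1 ∈ K :=
      SpDatum.wShort_mem K (fun t => (hK _ _ t q1 (by rw [hb]; omega)).1)
        (fun t => (hK _ _ t q1 (by rw [hb]; omega)).2) 1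
    have := (hz.mono_wShort hg k (bar k') hpl 1).conj k' k' t (ne_bar k')
    have e1 : k' ≠ k := by rintro rfl; omega
    have h5 : (Equiv.swap k (bar (bar k')) * Equiv.swap (bar k') (bar k)) k' = k := by
      rw [Equiv.Perm.mul_apply, Equiv.swap_apply_of_ne_of_ne (ne_bar k') (by grind), bar_bar,
        Equiv.swap_apply_right]
    rw [h5] at this
    have e2 : (↑(cShort k (bar k') 1 k' : Rˣ) * ↑(cShort k (bar k') 1 k' : Rˣ) * t : R) = t := by
      simp [cShort]
    rw [e2] at this
    rw [← this, MulAut.conj_apply]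
    exact mul_mem (mul_mem hw (ih k' (by push_cast at h1; omega) (by omega) (hQ.long _ _ hk q2) t))
      (inv_mem hw)

theorem SpDatum.mem_of_simple (hz : SpDatum z) (hg : 3 ≤ g) {φ : Idx g → ℤ} (hφ : Weight φ)
    {Q : Idx g → Idx g → Prop} (hQ : RootSys Q)
    (hQφ : ∀ k k', φ k' = φ k - 2 → 0 < φ k' → Q k (bar k')) (K : Subgroup S)
    (hK : ∀ p q t, Q p q → φ p + φ q = 2 → z p q t ∈ K ∧ z (bar p) (bar q) t ∈ K) (n : ℕ) :
    ∀ k l, φ k + φ l ≤ n → 0 < φ k + φ l → Q k l → ∀ t, z k l t ∈ K := by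
  have hb := hφ.bar
  induction n with
  | zero => intro k l h1 h2; push_cast at h1; omega
  | succ n ih =>
    intro k l h1 h2 hkl t
    wlog hle : φ l ≤ φ k generalizing k l
    · rw [hz.symm k l t (hφ.ne_bar_of_pos h2)]
      exact this l k (by omega) (by omega) (hQ.symm _ _ hkl) (by omega)
    have o := hφ.odd k
    have ol := hφ.odd l
    by_cases h3 : φ k + φ l = 2
    · exact (hK k l t hkl h3).1
    obtain ⟨k', hk'⟩ := hφ.pred k (by omega)
    have o' := hφ.odd k'
    have q1 := hQφ k k' hk' (by omega)
    have q2 := hQ.bar _ _ q1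
    rw [bar_bar] at q2
    have q3 := hQ.sum _ _ _ hkl q2
    have hlong := hz.long_mem_of_simple hg hφ hQ hQφ K hK
    have hsimple (t) := (hK _ _ t q1 (by rw [hb]; omega)).1
    by_cases e0 : k = l
    · subst e0
      exact hlong (φ k).toNat k (by omega) (by omega) hkl t
    have hpl : pl k ≠ pl k' := by
      intro e
      rcases eq_or_eq_bar_of_pl_eq e with e | e
      · rw [e] at hk'; omega
      · have := hb k'; rw [← e] at this; omega
    by_cases e1 : k' = l
    · subst e1
      have q4 := hQ.long k' k q3 (hQ.symm _ _ q1)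
      have := hz.conj_long k' k (sg k' * t) 1 (Ne.symm hpl)
      have e4 : sg k' * (sg k' * t) * 1 = t := by linear_combination t * sg_sq (R := R) k'
      rw [e4, hz.symm (bar k') k _ (by grind), mul_assoc, eq_comm, ← eq_mul_inv_iff_mul_eq] at this
      rw [hz.symm _ _ _ (by grind), this, MulAut.conj_apply]
      have hk'mem := hlong (φ k').toNat k' (by omega) (by omega) q3
      have hkmem := hlong (φ k).toNat k (by omega) (by omega) q4
      exact mul_mem (mul_mem (mul_mem (hk'mem _) (hsimple _)) (inv_mem (hk'mem _)))
        (inv_mem (mul_mem (hkmem _) (hsimple _)))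
    have hpl2 : pl k' ≠ pl l := by
      intro e
      rcases eq_or_eq_bar_of_pl_eq e with e | e
      · exact e1 e
      · have := hb l; rw [← e] at this; omega
    have hpl3 : pl k ≠ pl l := by
      intro e
      rcases eq_or_eq_bar_of_pl_eq e with e | e
      · exact e0 e
      · have := hb l; rw [← e] at this; omega
    have := hz.conj_eq k (bar k') l (sg (bar k') * t) 1 (by simpa) hpl3 (by simpa)
    have e4 : sg (bar k') * (sg (bar k') * t) * 1 = t := by
      linear_combination t * sg_sq (R := R) (bar k')
    rw [e4, bar_bar] at this
    rw [this, MulAut.conj_apply]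
    have hk'l := ih k' l (by push_cast at h1; omega) (by omega) (hQ.symm _ _ q3) 1
    exact mul_mem (mul_mem (mul_mem (hsimple _) hk'l) (inv_mem (hsimple _))) (inv_mem hk'l)

variable [IsLocalRing R]

theorem SpDatum.mem_bigCell (hz : SpDatum z) (hg : 3 ≤ g) {φ : Idx g → ℤ} (hφ : Weight φ)
    (hφ' : Weight (-φ)) {Q : Idx g → Idx g → Prop} (hQ : RootSys Q)
    (hQφ : ∀ k k', φ k' = φ k - 2 → 0 < φ k' → Q k (bar k'))
    {T : Subgroup S}
    (hT : T ≤ diagGrp hz)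
    (hw : ∀ p q, Q p q → φ p + φ q = 2 → ∀ u v, wShort z p q u * wShort z p q v ∈ T)
    {x : S} (hx : x ∈ rootGrp z Q) : x ∈ bigCell z φ Q T := by
  have hb := hφ.bar
  let K : Subgroup S := closure {x | ∃ p q t, Q p q ∧ φ p + φ q = 2 ∧
    (x = z p q t ∨ x = z (bar p) (bar q) t)}
  have hK : ∀ p q t, Q p q → φ p + φ q = 2 → z p q t ∈ K ∧ z (bar p) (bar q) t ∈ K :=
    fun p q t h h' => ⟨subset_closure ⟨p, q, t, h, h', Or.inl rfl⟩,
      subset_closure ⟨p, q, t, h, h', Or.inr rfl⟩⟩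
  have hle : rootGrp z Q ≤ K := by
    refine rootGrp_le fun k l t hk hl => ?_
    rcases lt_trichotomy 0 (φ k + φ l) with h | h | h
    · exact hz.mem_of_simple hg hφ hQ hQφ K hK (φ k + φ l).toNat k l (by omega) h hk t
    · exact absurd (hφ.inj l (bar k) (by rw [hb]; omega)) hl
    · refine hz.mem_of_simple hg hφ' hQ (fun k k' h1 h2 => ?_) K (fun p q t h1 h2 => ?_)
        (-(φ k + φ l)).toNat k l ?_ ?_ hk t
      · simp only [Pi.neg_apply] at h1 h2
        have := hQ.bar _ _ (hQφ (bar k) (bar k') (by rw [hb, hb]; omega) (by rw [hb]; omega))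
        simpa using this
      · simp only [Pi.neg_apply] at h2
        have := hK (bar p) (bar q) t (hQ.bar _ _ h1) (by rw [hb, hb]; omega)
        rw [bar_bar, bar_bar] at this
        exact ⟨this.2, this.1⟩
      · simp only [Pi.neg_apply]; omega
      · simp only [Pi.neg_apply]; omega
  replace hx := hle hx
  have step (y : S) (hy : y ∈ bigCell z φ Q T) (p q : Idx g) (t : R) (hpq : Q p q)
      (h2 : φ p + φ q = 2) : y * z p q t ∈ bigCell z φ Q T ∧
        y * z (bar p) (bar q) t ∈ bigCell z φ Q T := by
    refine ⟨?_, hz.bigCell_mul hg hφ hφ' hQ hT hpq h2 (hw p q hpq h2) hy t⟩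
    obtain ⟨h, hh, u, hu, v, hv, u', hu', rfl⟩ := hy
    exact ⟨h, hh, u, hu, v, hv, u' * z p q t, mul_mem hu'
      (mem_rootGrp ⟨hpq, by omega⟩ (hφ.ne_bar_of_pos (by omega)) t), by group⟩
  change x ∈ Subgroup.closure _ at hx
  induction hx using closure_induction_right with
  | one => exact ⟨1, one_mem _, 1, one_mem _, 1, one_mem _, 1, one_mem _, by simp⟩
  | mul_right x _ y hy ih =>
    obtain ⟨p, q, t, h1, h2, rfl | rfl⟩ := hy
    · exact (step _ ih p q t h1 h2).1
    · exact (step _ ih p q t h1 h2).2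
  | mul_inv_cancel x _ y hy ih =>
    obtain ⟨p, q, t, h1, h2, rfl | rfl⟩ := hy
    · rw [← hz.neg (hφ.ne_bar_of_pos (by omega))]
      exact (step _ ih p q _ h1 h2).1
    · rw [← hz.neg (by have := hφ.ne_bar_of_pos (k := p) (l := q) (by omega); grind)]
      exact (step _ ih p q _ h1 h2).2

/-- The kernel of the projection to matrices is conjugate into the torus. -/
theorem SpDatum.exists_torus (hz : SpDatum z) (hg : 3 ≤ g) (π : S →* Sp g R)
    (hπ : ∀ i j t, j ≠ bar i → π (z i j t) = rootSp i j t) {φ : Idx g → ℤ} (hφ : Weight φ)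
    (hφ' : Weight (-φ)) {Q : Idx g → Idx g → Prop} (hQ : RootSys Q)
    (hQφ : ∀ k k', φ k' = φ k - 2 → 0 < φ k' → Q k (bar k'))
    {T : Subgroup S}
    (hT : T ≤ diagGrp hz) (hTπ : ∀ h ∈ T, ∃ c, (π h).1 = Matrix.diagonal c)
    (hw : ∀ p q, Q p q → φ p + φ q = 2 → ∀ u v, wShort z p q u * wShort z p q v ∈ T)
    {x : S} (hx : x ∈ rootGrp z Q) (hx1 : π x = 1) :
    ∃ h ∈ T, π h = 1 ∧ ∃ u ∈ rootGrp z Q, x = u⁻¹ * h * u := by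
  obtain ⟨h, hh, u, hu, v, hv, u', hu', rfl⟩ := hz.mem_bigCell hg hφ hφ' hQ hQφ hT hw hx
  have hu2 := diag_conj_mem (inv_mem (hT hh)) hu
  have h1 : π (u' * (h⁻¹⁻¹ * u * h⁻¹) * h * v) = 1 := by
    simp only [map_mul, map_inv, inv_inv] at hx1 ⊢
    calc _ = π u' * (π h * π u * π v * π u') * (π u')⁻¹ := by group
      _ = 1 := by rw [hx1]; group
  obtain ⟨h2, h4, h3⟩ := hz.eq_one_of_triple π hπ hφ hφ' hQ (mul_mem hu' hu2) hv (hTπ h hh) h1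
  subst h3
  refine ⟨h, hh, h4, u', rootGrp_mono (fun k l h => h.1) hu', ?_⟩
  calc _ = u'⁻¹ * (u' * (h⁻¹⁻¹ * u * h⁻¹)) * h * u' := by group
    _ = _ := by rw [h2, mul_one]

end SymplecticSteinberg

namespace SymplecticSteinberg
open Subgroup
variable {g : ℕ} {R : Type} [CommRing R] {S : Type} [Group S] {z : Idx g → Idx g → R → S}

theorem Mono.scale_inv {n : S} {σ : Equiv.Perm (Idx g)} {c : Idx g → Rˣ} (h : Mono z n σ c) (k : Idx g) :
    (c (SymplecticSteinberg.bar k) : R) = sg k * sg (σ k) * ↑(c k)⁻¹ := by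
  have h1 := h.scale k
  have h2 := (c k).inv_mul
  linear_combination (sg (σ k) * ↑(c k)⁻¹ : R) * h1 - (c (SymplecticSteinberg.bar k) * sg (σ k) ^ 2 : R) * h2 -
    (c (SymplecticSteinberg.bar k) : R) * sg_sq (R := R) (σ k)

theorem Mono.conj_wShort {n : S} {σ : Equiv.Perm (Idx g)} {c : Idx g → Rˣ} (h : Mono z n σ c)
    {i j : Idx g} (hij : j ≠ SymplecticSteinberg.bar i) (u : Rˣ) :
    MulAut.conj n (wShort z i j u) = wShort z (σ i) (σ j) (c i * c j * u) := by
  have e : (c (SymplecticSteinberg.bar i) * c (SymplecticSteinberg.bar j) * (sg i * sg j * ↑u⁻¹) : R) =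
      sg (σ i) * sg (σ j) * ↑(c i * c j * u)⁻¹ := by
    rw [h.scale_inv, h.scale_inv, mul_inv, mul_inv, Units.val_mul, Units.val_mul]
    linear_combination (sg (σ i) * sg (σ j) * ↑(c i)⁻¹ * ↑(c j)⁻¹ * ↑u⁻¹ : R) *
      (sg j ^ 2 * sg_sq (R := R) i + sg_sq (R := R) j)
  rw [wShort, map_mul, map_mul, h.conj i j u hij, h.conj (SymplecticSteinberg.bar i) (SymplecticSteinberg.bar j) _ (by grind), h.bar, h.bar, e]
  simp only [wShort, Units.val_mul]

theorem Mono.conj_wLong {n : S} {σ : Equiv.Perm (Idx g)} {c : Idx g → Rˣ} (h : Mono z n σ c)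
    (i : Idx g) (u : Rˣ) : MulAut.conj n (wLong z i u) = wLong z (σ i) (c i * c i * u) := by
  rw [← wShort_self, h.conj_wShort (ne_bar i), wShort_self]

theorem SpDatum.wShort_neg (hz : SpDatum z) {i j : Idx g} (hij : j ≠ bar i) (u : Rˣ) :
    wShort z i j (-u) = (wShort z i j u)⁻¹ := by
  have h := hz.neg (i := bar i) (j := bar j) (by grind) (sg i * sg j * ↑u⁻¹)
  simp only [wShort, inv_neg, Units.val_neg, mul_neg, hz.neg hij, h]
  group

theorem SpDatum.wLong_neg (hz : SpDatum z) (i : Idx g) (u : Rˣ) : wLong z i (-u) = (wLong z i u)⁻¹ := by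
  rw [← wShort_self, ← wShort_self, hz.wShort_neg (ne_bar i)]

/-- The torus elements. -/
def hLong (z : Idx g → Idx g → R → S) (i : Idx g) (u : Rˣ) : S := wLong z i u * wLong z i (-1)

/-- The scaling factors of the torus elements. -/
def cTor (i : Idx g) (u : Rˣ) (k : Idx g) : Rˣ :=
  if k = i then u else if k = bar i then u⁻¹ else 1

theorem cTor_of_pl_ne {i k : Idx g} (h : pl k ≠ pl i) (u : Rˣ) : cTor i u k = 1 := by
  rw [cTor, if_neg (by grind), if_neg (by grind)]

@[simp] theorem cTor_self (i : Idx g) (u : Rˣ) : cTor i u i = u := by simp [cTor]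

theorem wLong_eq (hz : SpDatum z) (i : Idx g) (u : Rˣ) : wLong z i u = hLong z i u * wLong z i 1 := by
  rw [hLong, hz.wLong_neg]; group

theorem hLong_one (hz : SpDatum z) (i : Idx g) : hLong z i 1 = 1 := by
  rw [hLong, hz.wLong_neg]; group

theorem SpDatum.mono_hLong (hz : SpDatum z) (hg : 2 ≤ g) (i : Idx g) (u : Rˣ) :
    Mono z (hLong z i u) 1 (cTor i u) := by
  have := (hz.mono_wLong hg i u).mul (hz.mono_wLong hg i (-1))
  rw [Equiv.swap_mul_self] at this
  convert this using 1
  · rfl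
  funext k
  by_cases h1 : k = i
  · subst h1
    simp [cTor, cLong, mul_assoc]
  by_cases h2 : k = bar i
  · subst h2
    simp [cTor, cLong, mul_assoc]
  · rw [Equiv.swap_apply_of_ne_of_ne h1 h2]
    simp [cTor, cLong, h1, h2]

theorem Mono.conj_hLong (hz : SpDatum z) {n : S} {σ : Equiv.Perm (Idx g)} {c : Idx g → Rˣ} (h : Mono z n σ c)
    (i : Idx g) (u : Rˣ) : MulAut.conj n (hLong z i u) =
      hLong z (σ i) (c i * c i * u) * (hLong z (σ i) (c i * c i))⁻¹ := by
  rw [hLong, map_mul, h.conj_wLong, h.conj_wLong, hLong, hLong, mul_neg_one, hz.wLong_neg]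
  group

theorem wLong_mul_wLong (hz : SpDatum z) (i : Idx g) (u v : Rˣ) :
    wLong z i u * wLong z i v = hLong z i u * (hLong z i (-v))⁻¹ := by
  rw [hLong, hLong, hz.wLong_neg, hz.wLong_neg]; group

theorem Mono.conj_hLong_of_one (hz : SpDatum z) {n : S} {σ : Equiv.Perm (Idx g)} {c : Idx g → Rˣ}
    (h : Mono z n σ c) (i : Idx g) (hi : c i * c i = 1) (u : Rˣ) :
    MulAut.conj n (hLong z i u) = hLong z (σ i) u := by
  rw [h.conj_hLong hz, hi, hLong_one hz, one_mul, inv_one, mul_one]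

theorem hLong_comm (hz : SpDatum z) (hg : 2 ≤ g) {i j : Idx g} (hij : pl i ≠ pl j) (u v : Rˣ) :
    Commute (hLong z i u) (hLong z j v) := by
  have := (hz.mono_hLong hg i u).conj_hLong_of_one hz j (by rw [cTor_of_pl_ne (Ne.symm hij)]; simp) v
  exact conj_eq_iff.1 this

theorem hLong_conj (hz : SpDatum z) (hg : 2 ≤ g) (i : Idx g) (u v : Rˣ) :
    hLong z i u * hLong z i v * (hLong z i u)⁻¹ = hLong z i (u * u * v) * (hLong z i (u * u))⁻¹ := by
  have := (hz.mono_hLong hg i u).conj_hLong hz i v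
  rwa [MulAut.conj_apply, cTor_self] at this

theorem wLong_bar (hz : SpDatum z) (hg : 3 ≤ g) (i : Idx g) (u : Rˣ) :
    wLong z (bar i) u = wLong z i u⁻¹ := by
  have hT : (diagGrp hz) ≤ diagGrp hz := le_rfl
  have := (hz.rankOne hg (a := i) (b := i) (ne_bar i) hT (fun u v => by
    rw [wShort_self, wShort_self, wLong_mul_wLong hz]
    exact mul_mem ⟨_, hz.mono_hLong (by omega) i u⟩ (inv_mem ⟨_, hz.mono_hLong (by omega) i _⟩))).eqY u⁻¹
  rw [wShort_self, inv_inv, sg_mul_self, one_mul] at this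
  rw [this, wLong, bar_bar]

theorem hLong_bar (hz : SpDatum z) (hg : 3 ≤ g) (i : Idx g) (u : Rˣ) :
    hLong z (bar i) u = hLong z i u⁻¹ := by
  rw [hLong, wLong_bar hz hg, wLong_bar hz hg, hLong, inv_neg_one]

theorem hLong_mul_neg (hz : SpDatum z) (hg : 3 ≤ g) (i : Idx g) (u : Rˣ) :
    hLong z i u * hLong z i (-u) = hLong z i (-(u * u)) := by
  have := (hz.mono_wLong (by omega) i u).conj_wLong i (-1)
  rw [Equiv.swap_apply_left, wLong_bar hz hg] at this
  have e : (cLong i u i * cLong i u i * (-1))⁻¹ = -(u * u) := by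
    rw [inv_eq_iff_eq_inv]
    simp [cLong, mul_mul_mul_comm, inv_neg]
  rw [e, MulAut.conj_apply] at this
  rw [hLong, hLong, hLong, ← this, hz.wLong_neg i u]
  group

theorem wShort_mul_wShort (hz : SpDatum z) (hg : 3 ≤ g) {i j : Idx g} (hij : pl i ≠ pl j) (u v : Rˣ) :
    wShort z i j u * wShort z i j v = hLong z i u * (hLong z (bar j) u)⁻¹ *
      (hLong z i (-v) * (hLong z (bar j) (-v))⁻¹)⁻¹ := by
  have hne : j ≠ bar i := by grind
  have key (u : Rˣ) : wShort z i j u * wShort z i j (-1) = hLong z i u * (hLong z (bar j) u)⁻¹ := by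
    have h1 := (hz.mono_hLong (by omega) i u).conj_wShort hne 1
    have h2 := (hz.mono_wShort hg i j hij 1).conj_hLong_of_one hz i (by
      have : i ≠ bar j := by grind
      simp [cShort, this]) u
    have h5 : (Equiv.swap i (bar j) * Equiv.swap j (bar i)) i = bar j := by
      have h6 : i ≠ j := by grind
      rw [Equiv.Perm.mul_apply, Equiv.swap_apply_of_ne_of_ne h6 (ne_bar i),
        Equiv.swap_apply_left]
    rw [cTor_self, cTor_of_pl_ne (Ne.symm hij), mul_one, mul_one] at h1
    change _ = wShort z i j u at h1
    rw [h5] at h2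
    rw [← h1, ← h2, hz.wShort_neg hne, MulAut.conj_apply, MulAut.conj_apply]
    group
  rw [← key, ← key, hz.wShort_neg hne, hz.wShort_neg hne]
  group

/-- The cocycle of the torus elements. -/
def sym (z : Idx g → Idx g → R → S) (i : Idx g) (u v : Rˣ) : S :=
  hLong z i u * hLong z i v * (hLong z i (u * v))⁻¹

theorem Mono.commute_of_one {n : S} (h : Mono z n 1 (fun _ => 1)) {x : S} {P : Idx g → Idx g → Prop}
    (hx : x ∈ rootGrp z P) : Commute n x := by
  have : rootGrp z P ≤ centralizer {n} := rootGrp_le fun k l t _ hl => by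
    have := conj_eq_iff.1 (h.conj k l t hl)
    rw [mem_centralizer_singleton_iff]
    simpa using this.symm
  exact (mem_centralizer_singleton_iff.1 (this hx)).symm

theorem mono_sym (hz : SpDatum z) (hg : 2 ≤ g) (i : Idx g) (u v : Rˣ) :
    Mono z (sym z i u v) 1 (fun _ => 1) := by
  have := ((hz.mono_hLong hg i u).mul (hz.mono_hLong hg i v)).mul (hz.mono_hLong hg i (u * v)).inv
  simp only [mul_one, inv_one] at this
  convert this using 1
  · rfl
  funext k
  simp only [cTor, Equiv.Perm.one_apply]
  by_cases h1 : k = i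
  · simp [h1]
  · by_cases h2 : k = bar i
    · subst h2
      simp only [ne_eq, bar_ne, if_true, if_false, mul_inv, inv_inv]
      exact (by rw [mul_mul_mul_comm, inv_mul_cancel, one_mul, inv_mul_cancel] :
        u⁻¹ * v⁻¹ * (u * v) = 1).symm
    · simp [h1, h2]

theorem hLong_mem (z : Idx g → Idx g → R → S) {i : Idx g} {P : Idx g → Idx g → Prop} (h : P i i) (h' : P (bar i) (bar i)) (u : Rˣ) :
    hLong z i u ∈ rootGrp z P := by
  have (u : Rˣ) : wLong z i u ∈ rootGrp z P := mul_mem (mul_mem (mem_rootGrp h (ne_bar i) _)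
    (mem_rootGrp h' (ne_bar _) _)) (mem_rootGrp h (ne_bar i) _)
  exact mul_mem (this _) (this _)

theorem wShort_mem' (z : Idx g → Idx g → R → S) {i j : Idx g} (hij : j ≠ bar i) {P : Idx g → Idx g → Prop}
    (h : P i j) (h' : P (bar i) (bar j)) (u : Rˣ) : wShort z i j u ∈ rootGrp z P :=
  mul_mem (mul_mem (mem_rootGrp h hij _) (mem_rootGrp h' (by grind) _)) (mem_rootGrp h hij _)

theorem sym_eq (hz : SpDatum z) (hg : 3 ≤ g) {i j : Idx g} (hij : pl i ≠ pl j) (u v : Rˣ) :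
    sym z i u v = sym z j u v := by
  have hne : bar j ≠ bar i := by grind
  have h1 := conj_of_commute ((mono_sym hz (by omega) i u v).commute_of_one
    (wShort_mem' z (P := fun _ _ => True) hne trivial trivial 1)).symm
  have h2 (u : Rˣ) := (hz.mono_wShort hg i (bar j) (by simpa) 1).conj_hLong_of_one hz i (by
      have : i ≠ j := by grind
      simp [cShort, this]) u
  have h5 : (Equiv.swap i (bar (bar j)) * Equiv.swap (bar j) (bar i)) i = j := by
    have h6 : i ≠ bar j := by grind
    rw [Equiv.Perm.mul_apply, Equiv.swap_apply_of_ne_of_ne h6 (ne_bar i), bar_bar,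
      Equiv.swap_apply_left]
  rw [h5] at h2
  rw [← h1, sym, map_mul, map_mul, map_inv, h2, h2, h2, sym]

end SymplecticSteinberg

namespace SymplecticSteinberg
open Subgroup

/-- The formal properties of the torus elements of a long root. -/
structure Symbol {R S : Type} [CommRing R] [Group S] (h : Rˣ → S) (ζ : Rˣ) : Prop where
  gen : ∀ u : Rˣ, ∃ n : ℤ, u = ζ ^ n ∨ u = -ζ ^ n
  one : h 1 = 1
  central : ∀ u v w, Commute (h u * h v * (h (u * v))⁻¹) (h w)
  conj : ∀ u v, h u * h v * (h u)⁻¹ = h (u * u * v) * (h (u * u))⁻¹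
  neg : ∀ u, h u * h (-u) = h (-(u * u))

namespace Symbol
variable {R S : Type} [CommRing R] [Group S] {h : Rˣ → S} {ζ : Rˣ}

theorem commute_mul (H : Symbol h ζ) {u v w : Rˣ} (hu : Commute (h u) (h w)) (hv : Commute (h v) (h w)) :
    Commute (h (u * v)) (h w) := by
  have : h (u * v) = (h u * h v * (h (u * v))⁻¹)⁻¹ * (h u * h v) := by group
  rw [this]
  exact (H.central u v w).inv_left.mul_left (hu.mul_left hv)

theorem commute_inv (H : Symbol h ζ) {u w : Rˣ} (hu : Commute (h u) (h w)) :
    Commute (h u⁻¹) (h w) := by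
  have := H.central u u⁻¹ w
  rw [mul_inv_cancel, H.one, inv_one, mul_one] at this
  simpa using hu.inv_left.mul_left this

theorem commute_neg_one (H : Symbol h ζ) (w : Rˣ) : Commute (h (-1)) (h w) := by
  have := H.conj (-1) w
  rw [neg_mul_neg, one_mul, one_mul, H.one, inv_one, mul_one, mul_inv_eq_iff_eq_mul] at this
  exact this

theorem commute_of_gen (H : Symbol h ζ) {w : Rˣ} (hw : Commute (h ζ) (h w)) (u : Rˣ) :
    Commute (h u) (h w) := by
  have key (n : ℤ) : Commute (h (ζ ^ n)) (h w) := by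
    induction n using Int.induction_on with
    | zero => rw [zpow_zero, H.one]; exact Commute.one_left _
    | succ n ih => rw [zpow_add_one]; exact H.commute_mul ih hw
    | pred n ih => rw [zpow_sub_one]; exact H.commute_mul ih (H.commute_inv hw)
  obtain ⟨n, rfl | rfl⟩ := H.gen u
  · exact key n
  · rw [← neg_one_mul]; exact H.commute_mul (H.commute_neg_one w) (key n)

theorem commute (H : Symbol h ζ) (u v : Rˣ) : Commute (h u) (h v) :=
  H.commute_of_gen (H.commute_of_gen (Commute.refl _) v).symm u

theorem sq_mul (H : Symbol h ζ) (u v : Rˣ) : h (u * u * v) = h v * h (u * u) := by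
  have := H.conj u v
  rw [(H.commute u v).eq, mul_inv_cancel_right] at this
  rw [this, inv_mul_cancel_right]

theorem gen_sq (H : Symbol h ζ) {s x : Rˣ} (hx : ζ * (s * s) = x)
    (hs : h x * h x * (h (x * x))⁻¹ = 1) : h (ζ * ζ) = h ζ * h ζ := by
  have e1 : h x = h ζ * h (s * s) := by rw [← hx, mul_comm, H.sq_mul]
  have e2 : h (x * x) = h (ζ * ζ) * (h (s * s) * h (s * s)) := by
    rw [← hx, mul_mul_mul_comm, mul_comm, H.sq_mul, H.sq_mul]
  have e3 := (H.commute (s * s) ζ).eq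
  rw [mul_inv_eq_one, e1, e2, mul_assoc, ← mul_assoc (h (s * s)), e3, mul_assoc, ← mul_assoc] at hs
  exact (mul_right_cancel hs).symm

theorem zpow_aux (H : Symbol h ζ) (hz : h (ζ * ζ) = h ζ * h ζ) (v : Rˣ) (n : ℤ) :
    h (v * (ζ * ζ) ^ n) = h v * (h ζ * h ζ) ^ n := by
  have key (w : Rˣ) : h (w * (ζ * ζ)) = h w * (h ζ * h ζ) := by
    rw [mul_comm, H.sq_mul, hz]
  induction n using Int.induction_on with
  | zero => simp
  | succ n ih => rw [zpow_add_one, zpow_add_one, ← mul_assoc, key, ih, mul_assoc]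
  | pred n ih =>
    rw [zpow_sub_one, zpow_sub_one, ← mul_assoc, ← mul_assoc, ← ih, eq_mul_inv_iff_mul_eq, ← key,
      inv_mul_cancel_right]

theorem neg_gen (H : Symbol h ζ) (hz : h (ζ * ζ) = h ζ * h ζ) : h (-ζ) = h (-1) * h ζ := by
  have h1 := H.neg ζ
  have h2 := H.sq_mul ζ (-1)
  rw [mul_neg_one, hz] at h2
  rw [h2, (H.commute ζ (-ζ)).eq, ← mul_assoc] at h1
  exact mul_right_cancel h1

theorem zpow (H : Symbol h ζ) (hz : h (ζ * ζ) = h ζ * h ζ) (n : ℤ) :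
    h (ζ ^ n) = h ζ ^ n ∧ h (-ζ ^ n) = h (-1) * h ζ ^ n := by
  obtain ⟨m, rfl | rfl⟩ := Int.even_or_odd' n
  · have h1 := H.zpow_aux hz 1 m
    have h2 := H.zpow_aux hz (-1) m
    rw [one_mul, H.one, one_mul, ← zpow_two_mul_aux, ← zpow_two_mul_aux] at h1
    rw [neg_one_mul, ← zpow_two_mul_aux, ← zpow_two_mul_aux] at h2
    exact ⟨h1, h2⟩
  · have h1 := H.zpow_aux hz ζ m
    have h2 := H.zpow_aux hz (-ζ) m
    rw [← zpow_two_mul_aux, ← zpow_two_mul_aux, ← zpow_one_add, ← zpow_one_add, add_comm] at h1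
    rw [H.neg_gen hz, neg_mul, ← zpow_two_mul_aux, ← zpow_two_mul_aux, mul_assoc, ← zpow_one_add,
      ← zpow_one_add, add_comm] at h2
    exact ⟨h1, h2⟩
where
  zpow_two_mul_aux {G : Type} [Group G] {x : G} {m : ℤ} : x ^ (2 * m) = (x * x) ^ m := by
    rw [zpow_mul, zpow_two]

theorem exists_zpow (H : Symbol h ζ) (hz : h (ζ * ζ) = h ζ * h ζ) (u v : Rˣ) :
    ∃ k : ℤ, h u * h v = h (u * v) * (h (-1) * h (-1)) ^ k := by
  obtain ⟨m, hm⟩ := H.gen u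
  obtain ⟨n, hn⟩ := H.gen v
  have hc : Commute (h ζ ^ m) (h (-1)) := (H.commute_neg_one ζ).symm.zpow_left m
  have hc' : Commute (h ζ ^ (m + n)) (h (-1)) := (H.commute_neg_one ζ).symm.zpow_left _
  rcases hm with rfl | rfl <;> rcases hn with rfl | rfl
  · exact ⟨0, by rw [← zpow_add, (H.zpow hz _).1, (H.zpow hz _).1, (H.zpow hz _).1, zpow_add]; simp⟩
  · refine ⟨0, ?_⟩
    rw [mul_neg, ← zpow_add, (H.zpow hz _).1, (H.zpow hz _).2, (H.zpow hz _).2, zpow_add,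
      ← mul_assoc, hc.eq]
    simp [mul_assoc]
  · refine ⟨0, ?_⟩
    rw [neg_mul, ← zpow_add, (H.zpow hz _).1, (H.zpow hz _).2, (H.zpow hz _).2, zpow_add]
    simp [mul_assoc]
  · refine ⟨1, ?_⟩
    rw [neg_mul_neg, ← zpow_add, (H.zpow hz _).1, (H.zpow hz _).2, (H.zpow hz _).2, zpow_one,
      (hc'.mul_right hc').eq, zpow_add, mul_assoc, ← mul_assoc (h ζ ^ m), hc.eq]
    simp only [mul_assoc]

theorem sq_neg_one (H : Symbol h ζ) (hz : h (ζ * ζ) = h ζ * h ζ) {m : ℤ} (hm : -1 = ζ ^ m) :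
    h (-1) * h (-1) = 1 := by
  rw [hm, (H.zpow hz m).1, ← zpow_add, ← (H.zpow hz _).1, zpow_add, ← hm, neg_mul_neg, one_mul, H.one]

theorem sq_neg_one' (H : Symbol h ζ) (hz : h (ζ * ζ) = h ζ * h ζ) {u : Rˣ} {n : ℤ} (hu : u = -ζ ^ n) :
    h u * h u * (h (u * u))⁻¹ = h (-1) * h (-1) := by
  have hc : Commute (h ζ ^ n) (h (-1)) := (H.commute_neg_one ζ).symm.zpow_left n
  rw [hu, neg_mul_neg, ← zpow_add, (H.zpow hz _).1, (H.zpow hz _).2, mul_inv_eq_iff_eq_mul, zpow_add,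
    mul_assoc, ← mul_assoc (h ζ ^ n), hc.eq]
  simp only [mul_assoc]

end Symbol

/-- Kernel of a product of commuting subgroups. -/
theorem mem_of_peel {S ι : Type} [Group S] [DecidableEq ι] (D K : ι → Subgroup S) (N Z : Subgroup S)
    (hD : ∀ i j, i ≠ j → ∀ x ∈ D i, ∀ y ∈ D j, Commute x y)
    (hK : ∀ i j, i ≠ j → D j ≤ K i) (hZ : ∀ i, D i ⊓ K i ≤ Z) (hN : ∀ i, N ≤ K i) (hZN : Z ≤ N)
    (s : Finset ι) : ∀ x ∈ ⨆ i ∈ s, D i, x ∈ N → x ∈ Z := by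
  induction s using Finset.induction_on with
  | empty => simp +contextual [one_mem]
  | insert i s hi ih =>
    intro x hx hxN
    have hcomm : ∀ a ∈ D i, ∀ b ∈ ⨆ j ∈ s, D j, Commute a b := by
      intro a ha b hb
      have : ⨆ j ∈ s, D j ≤ centralizer {a} := iSup₂_le fun j hj y hy => by
        rw [mem_centralizer_singleton_iff]
        exact (hD i j (by rintro rfl; exact hi hj) a ha y hy).symm
      exact (mem_centralizer_singleton_iff.1 (this hb)).symm
    have hfac : ∃ a ∈ D i, ∃ b ∈ ⨆ j ∈ s, D j, x = a * b := by
      rw [Finset.iSup_insert, sup_eq_closure] at hx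
      clear hxN
      induction hx using closure_induction with
      | mem x hx =>
        rcases hx with hx | hx
        · exact ⟨x, hx, 1, one_mem _, by simp⟩
        · exact ⟨1, one_mem _, x, hx, by simp⟩
      | one => exact ⟨1, one_mem _, 1, one_mem _, by simp⟩
      | mul x y _ _ hx hy =>
        obtain ⟨a, ha, b, hb, rfl⟩ := hx
        obtain ⟨c, hc, d, hd, rfl⟩ := hy
        refine ⟨a * c, mul_mem ha hc, b * d, mul_mem hb hd, ?_⟩
        rw [mul_assoc, ← mul_assoc b, ← (hcomm c hc b hb).eq]
        simp only [mul_assoc]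
      | inv x _ hx =>
        obtain ⟨a, ha, b, hb, rfl⟩ := hx
        exact ⟨a⁻¹, inv_mem ha, b⁻¹, inv_mem hb, by rw [(hcomm a ha b hb).eq, mul_inv_rev]⟩
    obtain ⟨a, ha, b, hb, rfl⟩ := hfac
    have hbK : b ∈ K i := (iSup₂_le fun j hj => hK i j (by rintro rfl; exact hi hj)) hb
    have haZ : a ∈ Z := hZ i ⟨ha, by simpa using mul_mem (hN i hxN) (inv_mem hbK)⟩
    have hbN : b ∈ N := by simpa using mul_mem (inv_mem (hZN haZ)) hxN
    exact mul_mem haZ (ih b hb hbN)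

end SymplecticSteinberg

namespace SymplecticSteinberg
open Subgroup
variable {g : ℕ} {R : Type} [CommRing R] {S : Type} [Group S] {z : Idx g → Idx g → R → S}

theorem symbol_hLong (hz : SpDatum z) (hg : 3 ≤ g) {ζ : Rˣ}
    (hζ : ∀ u : Rˣ, ∃ n : ℤ, u = ζ ^ n ∨ u = -ζ ^ n) (i : Idx g) : Symbol (hLong z i) ζ where
  gen := hζ
  one := hLong_one hz i
  central u v w := (mono_sym hz (by omega) i u v).commute_of_one
    (hLong_mem z (P := fun _ _ => True) trivial trivial w)
  conj u v := hLong_conj hz (by omega) i u v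
  neg u := hLong_mul_neg hz hg i u

section
variable (π : S →* Sp g R) (hπ : ∀ i j t, j ≠ bar i → π (z i j t) = rootSp i j t)
include hπ

theorem map_wLong_mul_apply (j : Idx g) (u : Rˣ) (N : Sp g R) (q p : Idx g) :
    (π (wLong z j u) * N).1 q p = if q = j then sg j * u * N.1 (bar j) p else
      if q = bar j then -(sg j * ↑u⁻¹ * N.1 j p) else N.1 q p := by
  rw [wLong, map_mul, map_mul, hπ _ _ _ (ne_bar j), hπ _ _ _ (ne_bar _), mul_assoc, mul_assoc]
  have h := sg_sq (R := R) j
  have h1 := u.mul_inv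
  by_cases h2 : q = j
  · subst h2
    simp [rootSp_mul_apply (ne_bar q), rootSp_mul_apply (ne_bar (bar q)), ne_bar]
    linear_combination (-(N.1 q p) - sg q * u * N.1 (bar q) p) * (u * ↑u⁻¹ * h + h1)
  · by_cases h3 : q = bar j
    · subst h3
      simp [rootSp_mul_apply (ne_bar j), rootSp_mul_apply (ne_bar (bar j)), ne_bar]
      linear_combination (-(N.1 (bar j) p)) * (u * ↑u⁻¹ * h + h1)
    · simp [rootSp_mul_apply (ne_bar j), rootSp_mul_apply (ne_bar (bar j)), h2, h3]

theorem map_hLong (j : Idx g) (u : Rˣ) :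
    (π (hLong z j u)).1 = Matrix.diagonal fun k => (cTor j u k : R) := by
  ext q p
  have h := sg_sq (R := R) j
  rw [hLong, map_mul, map_wLong_mul_apply π hπ]
  have e (k : Idx g) := map_wLong_mul_apply π hπ j (-1) 1 k p
  simp only [mul_one] at e
  simp only [e, Matrix.diagonal_apply, cTor]
  by_cases h2 : q = j
  · subst h2
    simp [Matrix.one_apply]
    split_ifs
    · linear_combination (u : R) * h
    · simp
  · by_cases h3 : q = bar j
    · subst h3
      simp [Matrix.one_apply]
      split_ifs
      · linear_combination (↑u⁻¹ : R) * h
      · simp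
    · simp [h2, h3, Matrix.one_apply]

end

/-- Elements acting trivially on a basis vector. -/
def fixCol (π : S →* Sp g R) (i : Idx g) : Subgroup S where
  carrier := {x | (π x).1.mulVec (Pi.single i 1) = Pi.single i 1}
  one_mem' := by
    change (π 1).1.mulVec _ = _
    rw [map_one]
    exact Matrix.one_mulVec _
  mul_mem' {a b} ha hb := by
    change (π a).1.mulVec _ = _ at ha
    change (π b).1.mulVec _ = _ at hb
    change (π (a * b)).1.mulVec _ = _
    rw [map_mul, Submonoid.coe_mul, ← Matrix.mulVec_mulVec, hb, ha]
  inv_mem' {a} ha := by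
    change (π a).1.mulVec _ = _ at ha
    change (π a⁻¹).1.mulVec _ = _
    nth_rw 1 [← ha]
    rw [Matrix.mulVec_mulVec, ← Submonoid.coe_mul, ← map_mul, inv_mul_cancel, map_one]
    exact Matrix.one_mulVec _

/-- Elements mapped to diagonal matrices. -/
def diagPre (π : S →* Sp g R) : Subgroup S where
  carrier := {x | ∃ c : Idx g → Rˣ, (π x).1 = Matrix.diagonal fun k => (c k : R)}
  one_mem' := ⟨1, by simp⟩
  mul_mem' := by
    rintro a b ⟨c, hc⟩ ⟨d, hd⟩
    exact ⟨c * d, by rw [map_mul, Submonoid.coe_mul, hc, hd, Matrix.diagonal_mul_diagonal]; rfl⟩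
  inv_mem' := by
    rintro a ⟨c, hc⟩
    refine ⟨c⁻¹, left_inv_eq_right_inv (a := (π a).1) ?_ ?_⟩
    · rw [← Submonoid.coe_mul, ← map_mul, inv_mul_cancel, map_one, Submonoid.coe_one]
    · rw [hc, Matrix.diagonal_mul_diagonal, ← Matrix.diagonal_one]
      congr 1
      funext k
      simp

theorem ker_le_fixCol (π : S →* Sp g R) (i : Idx g) : π.ker ≤ fixCol π i := by
  intro x hx
  change (π x).1.mulVec _ = _
  rw [MonoidHom.mem_ker.1 hx]
  exact Matrix.one_mulVec _

section
variable (π : S →* Sp g R) (hπ : ∀ i j t, j ≠ bar i → π (z i j t) = rootSp i j t)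
include hπ

theorem hLong_mem_diagPre (j : Idx g) (u : Rˣ) : hLong z j u ∈ diagPre π := ⟨_, map_hLong π hπ j u⟩

theorem hLong_mem_fixCol {i j : Idx g} {u : Rˣ} (h : cTor j u i = 1) : hLong z j u ∈ fixCol π i := by
  change (π _).1.mulVec _ = _
  rw [map_hLong π hπ, Matrix.diagonal_mulVec_single, h]
  simp

theorem eq_one_of_hLong_mem_fixCol {i : Idx g} {u : Rˣ} (h : hLong z i u ∈ fixCol π i) : u = 1 := by
  change (π _).1.mulVec _ = _ at h
  rw [map_hLong π hπ, Matrix.diagonal_mulVec_single, cTor_self] at h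
  have := congrFun h i
  simpa using this

end

theorem hLong_commute (hz : SpDatum z) (hg : 3 ≤ g) {ζ : Rˣ}
    (hζ : ∀ u : Rˣ, ∃ n : ℤ, u = ζ ^ n ∨ u = -ζ ^ n) (i j : Fin g) (u v : Rˣ) :
    Commute (hLong z (Sum.inl i) u) (hLong z (Sum.inl j) v) := by
  by_cases h : i = j
  · subst h; exact (symbol_hLong hz hg hζ _).commute u v
  · exact hLong_comm hz (by omega) (show pl (Sum.inl i) ≠ pl (Sum.inl j) from h) u v

/-- The quotients of two torus elements depend multiplicatively on the parameter. -/
def eHom (hz : SpDatum z) (hg : 3 ≤ g) {ζ : Rˣ} (hζ : ∀ u : Rˣ, ∃ n : ℤ, u = ζ ^ n ∨ u = -ζ ^ n)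
    {i j : Fin g} (hij : i ≠ j) : Rˣ →* S where
  toFun u := hLong z (Sum.inl i) u * (hLong z (Sum.inl j) u)⁻¹
  map_one' := by simp [hLong_one hz]
  map_mul' u v := by
    have h1 := sym_eq hz hg (i := Sum.inl i) (j := Sum.inl j) hij u v
    have h2 := (mono_sym hz (by omega) (Sum.inl j) u v).commute_of_one
      (hLong_mem z (i := Sum.inl i) (P := fun _ _ => True) trivial trivial (u * v))
    have h2' := (mono_sym hz (by omega) (Sum.inl j) u v).commute_of_one
      (hLong_mem z (i := Sum.inl j) (P := fun _ _ => True) trivial trivial (u * v))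
    have h3 := (hLong_commute hz hg hζ i j v u).inv_right.eq
    have h4 := (hLong_commute hz hg hζ j j u v).eq
    have e1 : hLong z (Sum.inl i) u * hLong z (Sum.inl i) v =
        sym z (Sum.inl j) u v * hLong z (Sum.inl i) (u * v) := by rw [← h1, sym]; group
    have e2 : hLong z (Sum.inl j) u * hLong z (Sum.inl j) v =
        sym z (Sum.inl j) u v * hLong z (Sum.inl j) (u * v) := by rw [sym]; group
    calc hLong z (Sum.inl i) (u * v) * (hLong z (Sum.inl j) (u * v))⁻¹
        = (sym z (Sum.inl j) u v * hLong z (Sum.inl i) (u * v)) *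
          (sym z (Sum.inl j) u v * hLong z (Sum.inl j) (u * v))⁻¹ := by
          rw [h2.eq, h2'.eq]; group
      _ = hLong z (Sum.inl i) u * (hLong z (Sum.inl i) v * (hLong z (Sum.inl j) u)⁻¹) *
          (hLong z (Sum.inl j) v)⁻¹ := by rw [← e1, ← e2, h4]; group
      _ = _ := by rw [h3]; group

/-- Pairs of indices on opposite sides. -/
def Opp (k l : Idx g) : Prop := k.isLeft ≠ l.isLeft

theorem rootSys_opp : RootSys (Opp (g := g)) where
  symm k l h := h.symm
  bar k l h := by rcases k with k | k <;> rcases l with l | l <;> simp_all [Opp, SymplecticSteinberg.bar]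
  sum p q l h h' := by
    rcases p with k | k <;> rcases q with q | q <;> rcases l with l | l <;>
      simp_all [Opp, SymplecticSteinberg.bar]
  long p l h := absurd rfl h

theorem rootSys_true : RootSys (fun _ _ : Idx g => True) where
  symm _ _ h := h
  bar _ _ h := h
  sum _ _ _ h _ := h
  long _ _ h _ := h

theorem SpDatum.eq_one_of_opp [IsLocalRing R] (hz : SpDatum z) (hg : 3 ≤ g) {ζ : Rˣ}
    (hζ : ∀ u : Rˣ, ∃ n : ℤ, u = ζ ^ n ∨ u = -ζ ^ n) (π : S →* Sp g R)
    (hπ : ∀ i j t, j ≠ SymplecticSteinberg.bar i → π (z i j t) = rootSp i j t)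
    {x : S} (hx : x ∈ rootGrp z Opp) (hx1 : π x = 1) : x = 1 := by
  classical
  obtain ⟨φ, hφ, hφ', hpos⟩ := exists_weight g
  have hneg (i : Fin g) : φ (Sum.inr i) < 0 := by
    have : φ (Sum.inr i) = -φ (Sum.inl i) := hφ.bar (Sum.inl i)
    have h := hpos i
    omega
  let o : Fin g := ⟨0, by omega⟩
  let D (i : {i : Fin g // i ≠ o}) : Subgroup S := (eHom hz hg hζ i.2).range
  let T : Subgroup S := ⨆ i ∈ (Finset.univ : Finset {i : Fin g // i ≠ o}), D i
  have hDT (i) : D i ≤ T := le_iSup₂_of_le i (Finset.mem_univ _) le_rfl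
  have hT1 (i : Fin g) (u : Rˣ) : hLong z (Sum.inl i) u * (hLong z (Sum.inl o) u)⁻¹ ∈ T := by
    by_cases h : i = o
    · rw [h, mul_inv_cancel]; exact one_mem _
    · exact hDT ⟨i, h⟩ ⟨u, rfl⟩
  have hT2 (i j : Fin g) (u : Rˣ) : hLong z (Sum.inl i) u * (hLong z (Sum.inl j) u)⁻¹ ∈ T := by
    have := mul_mem (hT1 i u) (inv_mem (hT1 j u))
    rw [mul_inv_rev, inv_inv] at this
    convert this using 1
    group
  have hTle {H : Subgroup S} (h : ∀ i u, hLong z (Sum.inl i) u ∈ H) : T ≤ H :=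
    iSup₂_le fun i _ => by
      rintro _ ⟨u, rfl⟩
      exact mul_mem (h _ _) (inv_mem (h _ _))
  obtain ⟨h, hhT, hh1, u, hu, rfl⟩ := hz.exists_torus hg π hπ hφ hφ' rootSys_opp (T := T)
    (fun k k' h1 h2 => by
      rcases k with k | k <;> rcases k' with k' | k'
      · simp [Opp, SymplecticSteinberg.bar]
      · exact absurd h2 (by have := hneg k'; omega)
      · have := hneg k; omega
      · exact absurd h2 (by have := hneg k'; omega))
    (hTle fun i u => ⟨_, hz.mono_hLong (by omega) _ u⟩)
    (fun h hh => by
      obtain ⟨c, hc⟩ := (hTle fun i u => hLong_mem_diagPre π hπ (Sum.inl i) u) hh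
      exact ⟨_, hc⟩)
    (fun p q hpq hs u v => by
      have hne : pl p ≠ pl q := by
        rintro h
        rcases eq_or_eq_bar_of_pl_eq h with rfl | rfl
        · exact hpq rfl
        · rw [hφ.bar] at hs; omega
      rw [wShort_mul_wShort hz hg hne]
      rcases p with p | p <;> rcases q with q | q
      · exact absurd rfl hpq
      · exact mul_mem (hT2 p q _) (inv_mem (hT2 p q _))
      · have e (k : Fin g) (u : Rˣ) : hLong z (Sum.inr k) u = hLong z (Sum.inl k) u⁻¹ :=
          hLong_bar hz hg (Sum.inl k) u
        simp only [SymplecticSteinberg.bar, Sum.swap_inl, Sum.swap_inr, e]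
        exact mul_mem (hT2 p q _) (inv_mem (hT2 p q _))
      · exact absurd rfl hpq) hx hx1
  suffices h = 1 by rw [this]; group
  rw [← mem_bot]
  refine mem_of_peel D (fun i => fixCol π (Sum.inl i.1)) π.ker ⊥ ?_ ?_ ?_ (fun i => ker_le_fixCol π _)
    bot_le Finset.univ h hhT hh1
  · rintro i j - _ ⟨u, rfl⟩ _ ⟨v, rfl⟩
    have c := hLong_commute hz hg hζ (z := z)
    exact ((c _ _ _ _).mul_left (c _ _ _ _).inv_left).mul_right
      (((c _ _ _ _).mul_left (c _ _ _ _).inv_left).inv_right)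
  · rintro i j hij _ ⟨u, rfl⟩
    refine mul_mem (hLong_mem_fixCol π hπ (cTor_of_pl_ne ?_ _))
      (inv_mem (hLong_mem_fixCol π hπ (cTor_of_pl_ne ?_ _)))
    · exact fun h => hij (Subtype.ext h)
    · exact i.2
  · rintro i _ ⟨⟨u, rfl⟩, h⟩
    have h1 : hLong z (Sum.inl i.1) u ∈ fixCol π (Sum.inl i.1) := by
      have := mul_mem h (hLong_mem_fixCol (u := u) (j := Sum.inl o) π hπ (cTor_of_pl_ne (show pl (Sum.inl i.1) ≠ pl (Sum.inl o) from i.2) _))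
      simpa [eHom] using this
    rw [eq_one_of_hLong_mem_fixCol π hπ h1, map_one]
    exact one_mem _

theorem SpDatum.mem_zpowers_of_ker [IsLocalRing R] (hz : SpDatum z) (hg : 3 ≤ g) {ζ : Rˣ}
    (hζ : ∀ u : Rˣ, ∃ n : ℤ, u = ζ ^ n ∨ u = -ζ ^ n) (π : S →* Sp g R)
    (hπ : ∀ i j t, j ≠ SymplecticSteinberg.bar i → π (z i j t) = rootSp i j t) (o : Fin g)
    (hsq : ∀ i, hLong z (Sum.inl i) (ζ * ζ) = hLong z (Sum.inl i) ζ * hLong z (Sum.inl i) ζ)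
    {x : S} (hx : x ∈ rootGrp z (fun _ _ => True)) (hx1 : π x = 1) :
    x ∈ zpowers (hLong z (Sum.inl o) (-1) * hLong z (Sum.inl o) (-1)) := by
  classical
  obtain ⟨φ, hφ, hφ', hpos⟩ := exists_weight g
  set α := hLong z (Sum.inl o) (-1) * hLong z (Sum.inl o) (-1) with hα
  have hs (i : Fin g) : sym z (Sum.inl i) (-1) (-1) =
      hLong z (Sum.inl i) (-1) * hLong z (Sum.inl i) (-1) := by
    rw [sym, neg_mul_neg, one_mul, hLong_one hz, inv_one, mul_one]
  have hα' (i : Fin g) : hLong z (Sum.inl i) (-1) * hLong z (Sum.inl i) (-1) = α := by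
    by_cases h : i = o
    · rw [h]
    · rw [hα, ← hs, ← hs, sym_eq hz hg]
      exact h
  have hαm : Mono z α 1 (fun _ => 1) := by rw [hα, ← hs]; exact mono_sym hz (by omega) _ _ _
  let D (i : Fin g) : Subgroup S := closure (Set.range (hLong z (Sum.inl i)))
  let T : Subgroup S := ⨆ i ∈ (Finset.univ : Finset (Fin g)), D i
  have hT (i : Fin g) (u : Rˣ) : hLong z (Sum.inl i) u ∈ T :=
    (le_iSup₂_of_le (f := fun i (_ : i ∈ Finset.univ) => D i) i (Finset.mem_univ _) le_rfl)
      (subset_closure ⟨u, rfl⟩)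
  have hT' (k : Idx g) (u : Rˣ) : hLong z k u ∈ T := by
    rcases k with k | k
    · exact hT k u
    · have := hT k u⁻¹
      rwa [← hLong_bar hz hg] at this
  have hTle {H : Subgroup S} (h : ∀ i u, hLong z (Sum.inl i) u ∈ H) : T ≤ H :=
    iSup₂_le fun i _ => by
      rw [closure_le]
      rintro _ ⟨u, rfl⟩
      exact h i u
  obtain ⟨h, hhT, hh1, u, hu, rfl⟩ := hz.exists_torus hg π hπ hφ hφ' rootSys_true (T := T)
    (fun _ _ _ _ => trivial)
    (hTle fun i u => ⟨_, hz.mono_hLong (by omega) _ u⟩)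
    (fun h hh => by
      obtain ⟨c, hc⟩ := (hTle fun i u => hLong_mem_diagPre π hπ (Sum.inl i) u) hh
      exact ⟨_, hc⟩)
    (fun p q _ hs u v => by
      by_cases hne : pl p = pl q
      · rcases eq_or_eq_bar_of_pl_eq hne with rfl | rfl
        · rw [wShort_self, wShort_self, wLong_mul_wLong hz]
          exact mul_mem (hT' _ _) (inv_mem (hT' _ _))
        · rw [hφ.bar] at hs; omega
      · rw [wShort_mul_wShort hz hg hne]
        exact mul_mem (mul_mem (hT' _ _) (inv_mem (hT' _ _)))
          (inv_mem (mul_mem (hT' _ _) (inv_mem (hT' _ _))))) hx hx1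
  suffices hhα : h ∈ zpowers α by
    obtain ⟨n, rfl⟩ := mem_zpowers_iff.1 hhα
    have hc : Commute (α ^ n) u := (hαm.commute_of_one hu).zpow_left n
    rw [mul_assoc, hc.eq, inv_mul_cancel_left]
    exact hhα
  have hform (i : Fin g) : ∀ x ∈ D i, ∃ u, ∃ k : ℤ, x = hLong z (Sum.inl i) u * α ^ k := by
    have H := symbol_hLong hz hg hζ (Sum.inl i)
    have hc (k : ℤ) (u : Rˣ) : Commute (α ^ k) (hLong z (Sum.inl i) u) :=
      (hαm.commute_of_one (hLong_mem z (P := fun _ _ => True) trivial trivial u)).zpow_left k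
    have hmul (u v : Rˣ) : ∃ k : ℤ, hLong z (Sum.inl i) u * hLong z (Sum.inl i) v =
        hLong z (Sum.inl i) (u * v) * α ^ k := by
      obtain ⟨k, hk⟩ := H.exists_zpow (hsq i) u v
      exact ⟨k, by rw [hk, hα']⟩
    intro y hy
    induction hy using closure_induction with
    | mem x hx => obtain ⟨u, rfl⟩ := hx; exact ⟨u, 0, by simp⟩
    | one => exact ⟨1, 0, by simp [hLong_one hz]⟩
    | mul x y _ _ hx hy =>
      obtain ⟨u, k, rfl⟩ := hx
      obtain ⟨v, l, rfl⟩ := hy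
      obtain ⟨m, hm⟩ := hmul u v
      refine ⟨u * v, m + k + l, ?_⟩
      simp only [zpow_add, ← mul_assoc]
      rw [← hm, mul_assoc _ (α ^ k), (hc k v).eq, ← mul_assoc]
    | inv x _ hx =>
      obtain ⟨u, k, rfl⟩ := hx
      obtain ⟨m, hm⟩ := hmul u u⁻¹
      rw [mul_inv_cancel, hLong_one hz, one_mul] at hm
      refine ⟨u⁻¹, -k - m, ?_⟩
      rw [mul_inv_rev, zpow_sub, zpow_neg, ← mul_assoc, ← zpow_neg, ← (hc _ _).eq, zpow_neg, mul_assoc]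
      congr 1
      rw [eq_mul_inv_iff_mul_eq, ← hm, inv_mul_cancel_left]
  have hZN : zpowers α ≤ π.ker := by
    rw [zpowers_le, MonoidHom.mem_ker, hα, map_mul]
    apply Subtype.ext
    rw [Submonoid.coe_mul, map_hLong π hπ, Matrix.diagonal_mul_diagonal, Submonoid.coe_one,
      ← Matrix.diagonal_one]
    congr 1
    funext k
    simp only [cTor]
    split_ifs <;> simp
  refine mem_of_peel D (fun i => fixCol π (Sum.inl i)) π.ker _ ?_ ?_ ?_ (fun i => ker_le_fixCol π _)
    hZN Finset.univ h hhT hh1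
  · rintro i j - x hx y hy
    obtain ⟨u, k, rfl⟩ := hform i x hx
    obtain ⟨v, l, rfl⟩ := hform j y hy
    have hc (k : ℤ) (i : Fin g) (u : Rˣ) : Commute (α ^ k) (hLong z (Sum.inl i) u) :=
      (hαm.commute_of_one (hLong_mem z (P := fun _ _ => True) trivial trivial u)).zpow_left k
    have c := hLong_commute hz hg hζ i j u v
    exact (c.mul_left (hc k j v)).mul_right ((hc l i u).symm.mul_left
      ((Commute.refl α).zpow_zpow k l))
  · intro i j hij
    rw [closure_le]
    rintro _ ⟨u, rfl⟩
    exact hLong_mem_fixCol π hπ (cTor_of_pl_ne (show pl (Sum.inl i) ≠ pl (Sum.inl j) from hij) _)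
  · intro i x hx
    obtain ⟨hx, h⟩ := mem_inf.1 hx
    obtain ⟨u, k, rfl⟩ := hform i x hx
    have hk : α ^ k ∈ zpowers α := zpow_mem (mem_zpowers α) k
    have h1 : hLong z (Sum.inl i) u ∈ fixCol π (Sum.inl i) := by
      have := mul_mem h (inv_mem (ker_le_fixCol π (Sum.inl i) (hZN hk)))
      simpa using this
    rw [eq_one_of_hLong_mem_fixCol π hπ h1, hLong_one hz, one_mul]
    exact hk

end SymplecticSteinberg

namespace SymplecticSteinberg
open Subgroup Matrix
variable {g : ℕ} {R : Type} [CommRing R] {S : Type} [Group S] {z : Idx g → Idx g → R → S}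

theorem prod_map_mul {ι : Type} {L : List ι} (hL : L.Nodup) {f h : ι → S}
    (hc : ∀ i j, i ≠ j → Commute (f i) (h j)) :
    (L.map fun i => f i * h i).prod = (L.map f).prod * (L.map h).prod := by
  induction L with
  | nil => simp
  | cons i L ih =>
    rw [List.nodup_cons] at hL
    have : Commute (h i) (L.map f).prod := by
      refine Commute.list_prod_right _ _ fun x hx => ?_
      obtain ⟨j, hj, rfl⟩ := List.mem_map.1 hx
      exact (hc j i (by rintro rfl; exact hL.1 hj)).symm
    simp only [List.map_cons, List.prod_cons, ih hL.2]
    rw [mul_assoc, ← mul_assoc (h i), this.eq]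
    simp only [mul_assoc]

/-- Pairs of indices on the same given side. -/
def Side (b : Bool) (k l : Idx g) : Prop := k.isLeft = b ∧ l.isLeft = b

/-- Pairs on opposite sides whose planes belong to a list. -/
def OppIn (L : List (Fin g)) (k l : Idx g) : Prop := Opp k l ∧ pl k ∈ L ∧ pl l ∈ L

theorem isLeft_bar (k : Idx g) : (bar k).isLeft = !k.isLeft := by rcases k with k | k <;> rfl

theorem SpDatum.conj_mem_side (hz : SpDatum z) (b : Bool) {a x : S} (ha : a ∈ rootGrp z Opp)
    (hx : x ∈ rootGrp z (Side b)) : MulAut.conj a x ∈ rootGrp z (Side b) := by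
  have key (k l : Idx g) (t : R) (h : Opp k l) (h' : l ≠ SymplecticSteinberg.bar k) (y : S)
      (hy : y ∈ rootGrp z (Side b)) : MulAut.conj (z k l t) y ∈ rootGrp z (Side b) := by
    simp only [Opp] at h
    refine hz.conj_mem_rootGrp (fun k l h => ⟨h.2, h.1⟩) h' ?_ ?_ ?_ ?_ t hy
    · rintro ⟨h1, h2⟩
      rw [isLeft_bar] at h1 h2
      exact h (Bool.not_inj (h1.trans h2.symm))
    · rintro m ⟨h1, h2⟩ - -
      rw [isLeft_bar] at h1
      refine ⟨?_, h2⟩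
      rw [← h1]
      revert h; cases k.isLeft <;> cases l.isLeft <;> simp
    · rintro m ⟨h1, h2⟩ - -
      rw [isLeft_bar] at h1
      refine ⟨?_, h2⟩
      rw [← h1]
      revert h; cases k.isLeft <;> cases l.isLeft <;> simp
    · rintro rfl; exact absurd rfl h
  suffices h : rootGrp z Opp ≤ normalizer (rootGrp z (Side b)) from
    (mem_normalizer_iff.1 (h ha) x).1 hx
  refine rootGrp_le fun k l t h h' => mem_normalizer_iff.2 fun y => ⟨key k l t h h' y, fun hy => ?_⟩
  have := key k l (-t) h h' _ hy
  rw [hz.neg h', MulAut.conj_apply] at this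
  convert this using 1
  group

theorem SpDatum.eq_one_of_side (hz : SpDatum z) (π : S →* Sp g R)
    (hπ : ∀ i j t, j ≠ SymplecticSteinberg.bar i → π (z i j t) = rootSp i j t) (b : Bool) {x : S}
    (hx : x ∈ rootGrp z (Side b)) (h : π x = 1) : x = 1 := by
  obtain ⟨φ, hφ, hφ', hpos⟩ := exists_weight g
  have hneg (i : Fin g) : φ (Sum.inr i) < 0 := by
    have : φ (Sum.inr i) = -φ (Sum.inl i) := hφ.bar (Sum.inl i)
    have h := hpos i
    omega
  cases b with
  | true =>
    refine hz.eq_one_of_pos π hπ hφ rootSys_true (rootGrp_mono ?_ hx) h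
    rintro (k | k) (l | l) ⟨h1, h2⟩ <;> simp at h1 h2
    have := hpos k
    have := hpos l
    exact ⟨trivial, by omega⟩
  | false =>
    refine hz.eq_one_of_pos π hπ hφ' rootSys_true (rootGrp_mono ?_ hx) h
    rintro (k | k) (l | l) ⟨h1, h2⟩ <;> simp at h1 h2
    have := hneg k
    have := hneg l
    exact ⟨trivial, by simp only [Pi.neg_apply]; omega⟩

theorem fromBlocks_add_single_inl_inl (i j : Fin g) (t : R) :
    (single (Sum.inl i) (Sum.inl j) t : Matrix (Idx g) (Idx g) R) = fromBlocks (single i j t) 0 0 0 := by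
  ext (a | a) (b | b) <;> simp [single_apply]

theorem fromBlocks_add_single_inr_inr (i j : Fin g) (t : R) :
    (single (Sum.inr i) (Sum.inr j) t : Matrix (Idx g) (Idx g) R) = fromBlocks 0 0 0 (single i j t) := by
  ext (a | a) (b | b) <;> simp [single_apply]

theorem fromBlocks_add_single_inl_inr (i j : Fin g) (t : R) :
    (single (Sum.inl i) (Sum.inr j) t : Matrix (Idx g) (Idx g) R) = fromBlocks 0 (single i j t) 0 0 := by
  ext (a | a) (b | b) <;> simp [single_apply]

theorem fromBlocks_add_single_inr_inl (i j : Fin g) (t : R) :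
    (single (Sum.inr i) (Sum.inl j) t : Matrix (Idx g) (Idx g) R) = fromBlocks 0 0 (single i j t) 0 := by
  ext (a | a) (b | b) <;> simp [single_apply]

/-- The diagonal matrix with given entries at the indices of a list. -/
def diagL (L : List (Fin g)) (D : Fin g → R) : Matrix (Fin g) (Fin g) R :=
  (L.map fun i => single i i (D i)).sum

section
variable (π : S →* Sp g R) (hπ : ∀ i j t, j ≠ bar i → π (z i j t) = rootSp i j t)
include hπ

theorem map_prod_inl (L : List (Fin g)) (D : Fin g → R) :
    (π (L.map fun i => z (Sum.inl i) (Sum.inl i) (D i)).prod).1 = fromBlocks 1 (-diagL L D) 0 1 := by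
  induction L with
  | nil => simp [diagL, fromBlocks_one]
  | cons i L ih =>
    rw [List.map_cons, List.prod_cons, map_mul, Submonoid.coe_mul, ih, hπ _ _ _ (ne_bar _),
      rootSp_coe (ne_bar _), rootMat_same, bar_inl, fromBlocks_add_single_inl_inr, ← fromBlocks_one,
      fromBlocks_add, fromBlocks_multiply]
    simp [diagL, sg, add_comm, ← single_neg]

theorem map_prod_inr (L : List (Fin g)) (D : Fin g → R) :
    (π (L.map fun i => z (Sum.inr i) (Sum.inr i) (D i)).prod).1 = fromBlocks 1 0 (diagL L D) 1 := by
  induction L with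
  | nil => simp [diagL, fromBlocks_one]
  | cons i L ih =>
    rw [List.map_cons, List.prod_cons, map_mul, Submonoid.coe_mul, ih, hπ _ _ _ (ne_bar _),
      rootSp_coe (ne_bar _), rootMat_same, bar_inr, fromBlocks_add_single_inr_inl, ← fromBlocks_one,
      fromBlocks_add, fromBlocks_multiply]
    simp [diagL, sg, add_comm]

end

/-- A square-zero matrix is realised by a product of root elements on opposite sides. -/
def Realised (z : Idx g → Idx g → R → S) (π : S →* Sp g R) (L : List (Fin g))
    (N : Matrix (Fin g) (Fin g) R) : Prop :=
  ∃ x ∈ rootGrp z (OppIn L), (π x).1 = fromBlocks (1 + N) 0 0 (1 - Nᵀ)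

theorem Realised.single {π : S →* Sp g R} (hπ : ∀ i j t, j ≠ bar i → π (z i j t) = rootSp i j t)
    {L : List (Fin g)} {i j : Fin g} (hij : i ≠ j) (hi : i ∈ L) (hj : j ∈ L) (t : R) :
    Realised z π L (Matrix.single i j t) := by
  have hne : (Sum.inr j : Idx g) ≠ bar (Sum.inl i) := by simpa using hij.symm
  refine ⟨z (Sum.inl i) (Sum.inr j) t, mem_rootGrp ⟨by simp [Opp], hi, hj⟩ hne t, ?_⟩
  rw [hπ _ _ _ hne, rootSp_coe hne, rootMat, if_neg (by simp), bar_inl, bar_inr,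
    fromBlocks_add_single_inl_inl, fromBlocks_add_single_inr_inr, ← fromBlocks_one,
    fromBlocks_add, fromBlocks_add]
  simp [sg, sub_eq_add_neg, ← single_neg]

theorem Realised.add {π : S →* Sp g R} {L : List (Fin g)} {M N : Matrix (Fin g) (Fin g) R}
    (hM : Realised z π L M) (hN : Realised z π L N) (h : M * N = 0) (h' : N * M = 0) :
    Realised z π L (M + N) := by
  obtain ⟨x, hx, hx'⟩ := hM
  obtain ⟨y, hy, hy'⟩ := hN
  refine ⟨x * y, mul_mem hx hy, ?_⟩
  have h1 : Mᵀ * Nᵀ = 0 := by rw [← transpose_mul, h', transpose_zero]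
  rw [map_mul, Submonoid.coe_mul, hx', hy', fromBlocks_multiply]
  simp only [mul_zero, zero_mul, add_zero, zero_add, add_mul, mul_add, one_mul, mul_one, sub_mul,
    mul_sub, h, h1, transpose_add]
  congr 1 <;> abel

/-- Simultaneous Weyl elements in the planes of a list. -/
def wProd (z : Idx g → Idx g → R → S) (L : List (Fin g)) (D : Fin g → Rˣ) : S :=
  (L.map fun i => wLong z (Sum.inl i) (D i)).prod

/-- Simultaneous torus elements in the planes of a list. -/
def hProd (z : Idx g → Idx g → R → S) (L : List (Fin g)) (D : Fin g → Rˣ) : S :=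
  (L.map fun i => hLong z (Sum.inl i) (D i)).prod

theorem commute_inl (hz : SpDatum z) (i j : Fin g) (s t : R) :
    Commute (z (Sum.inl i) (Sum.inl i) s) (z (Sum.inl j) (Sum.inl j) t) :=
  hz.comm_long _ _ s t (by simp)

theorem commute_inl_inr (hz : SpDatum z) {i j : Fin g} (h : i ≠ j) (s t : R) :
    Commute (z (Sum.inl i) (Sum.inl i) s) (z (Sum.inr j) (Sum.inr j) t) :=
  hz.comm_long _ _ s t (by simpa using h.symm)

theorem wProd_eq (hz : SpDatum z) {L : List (Fin g)} (hL : L.Nodup) (D : Fin g → Rˣ) :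
    wProd z L D = (L.map fun i => z (Sum.inl i) (Sum.inl i) (D i : R)).prod *
      (L.map fun i => z (Sum.inr i) (Sum.inr i) (↑(D i)⁻¹ : R)).prod *
      (L.map fun i => z (Sum.inl i) (Sum.inl i) (D i : R)).prod := by
  rw [← prod_map_mul hL fun i j h => commute_inl_inr hz h _ _, ← prod_map_mul hL]
  · rfl
  · exact fun i j h => (commute_inl hz _ _ _ _).mul_left (commute_inl_inr hz h.symm _ _).symm

theorem wProd_eq_hProd (hz : SpDatum z) (hg : 2 ≤ g) {L : List (Fin g)} (hL : L.Nodup) (D : Fin g → Rˣ) :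
    wProd z L D = hProd z L D * wProd z L 1 := by
  rw [wProd, wProd, hProd, ← prod_map_mul hL]
  · simp only [Pi.one_apply, ← wLong_eq hz]
  · intro i j h
    have := (hz.mono_hLong hg (Sum.inl i) (D i)).conj_wLong (Sum.inl j) (1 : Rˣ)
    rw [cTor_of_pl_ne (show pl (Sum.inl j) ≠ pl (Sum.inl i) from h.symm)] at this
    rw [mul_one, mul_one] at this
    exact conj_eq_iff.1 this

theorem wProd_conj (hz : SpDatum z) (π : S →* Sp g R)
    (hπ : ∀ i j t, j ≠ bar i → π (z i j t) = rootSp i j t) {L : List (Fin g)} (hL : L.Nodup)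
    {a : S} (ha : a ∈ rootGrp z Opp) {A A' : Matrix (Fin g) (Fin g) R}
    (hA : (π a).1 = fromBlocks A 0 0 A') {D D' : Fin g → Rˣ}
    (h1 : A * diagL L (fun i => (D i : R)) = diagL L (fun i => (D' i : R)) * A')
    (h2 : A' * diagL L (fun i => (↑(D i)⁻¹ : R)) = diagL L (fun i => (↑(D' i)⁻¹ : R)) * A) :
    MulAut.conj a (wProd z L D) = wProd z L D' := by
  have memL (D : Fin g → R) : (L.map fun i => z (Sum.inl i) (Sum.inl i) (D i)).prod ∈
      rootGrp z (Side true) := list_prod_mem fun x hx => by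
    obtain ⟨i, -, rfl⟩ := List.mem_map.1 hx
    exact mem_rootGrp ⟨rfl, rfl⟩ (ne_bar _) _
  have memR (D : Fin g → R) : (L.map fun i => z (Sum.inr i) (Sum.inr i) (D i)).prod ∈
      rootGrp z (Side false) := list_prod_mem fun x hx => by
    obtain ⟨i, -, rfl⟩ := List.mem_map.1 hx
    exact mem_rootGrp ⟨rfl, rfl⟩ (ne_bar _) _
  have key (b : Bool) (x y : S) (hx : x ∈ rootGrp z (Side b)) (hy : y ∈ rootGrp z (Side b))
      (h : π a * π x = π y * π a) : MulAut.conj a x = y := by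
    rw [← mul_inv_eq_one]
    refine hz.eq_one_of_side π hπ b (mul_mem (hz.conj_mem_side b ha hx) (inv_mem hy)) ?_
    rw [MulAut.conj_apply, map_mul, map_mul, map_mul, h, map_inv, map_inv]
    group
  have e1 := key true _ _ (memL fun i => (D i : R)) (memL fun i => (D' i : R)) (Subtype.ext (by
    rw [Submonoid.coe_mul, Submonoid.coe_mul, map_prod_inl π hπ, map_prod_inl π hπ, hA,
      fromBlocks_multiply, fromBlocks_multiply]
    simp [h1]))
  have e2 := key false _ _ (memR fun i => (↑(D i)⁻¹ : R)) (memR fun i => (↑(D' i)⁻¹ : R))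
    (Subtype.ext (by
    rw [Submonoid.coe_mul, Submonoid.coe_mul, map_prod_inr π hπ, map_prod_inr π hπ, hA,
      fromBlocks_multiply, fromBlocks_multiply]
    simp [h2]))
  rw [wProd_eq hz hL, wProd_eq hz hL, map_mul, map_mul, e1, e2]

theorem diagL_append (L L' : List (Fin g)) (D : Fin g → R) :
    diagL (L ++ L') D = diagL L D + diagL L' D := by
  simp [diagL]

theorem hProd_append (L L' : List (Fin g)) (D : Fin g → Rˣ) :
    hProd z (L ++ L') D = hProd z L D * hProd z L' D := by
  simp [hProd]

theorem mono_hProd (hz : SpDatum z) (hg : 2 ≤ g) {L : List (Fin g)} (hL : L.Nodup) (u : Rˣ) :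
    Mono z (hProd z L fun _ => u) 1
      (fun k => if pl k ∈ L then (if k.isLeft then u else u⁻¹) else 1) := by
  induction L with
  | nil => simpa [hProd] using Mono.one hz
  | cons i L ih =>
    rw [List.nodup_cons] at hL
    have := (hz.mono_hLong hg (Sum.inl i) u).mul (ih hL.2)
    rw [one_mul] at this
    convert this using 1
    · simp [hProd]
    funext k
    simp only [Equiv.Perm.one_apply, List.mem_cons]
    by_cases h : pl k = i
    · have hk : pl k ∉ L := by rw [h]; exact hL.1
      rw [if_pos (Or.inl h), if_neg hk, mul_one]
      rcases k with k | k
      · simp only [pl, Sum.elim_inl, id] at h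
        simp [h]
      · simp only [pl, Sum.elim_inr, id] at h
        simp [h, cTor]
    · rw [cTor_of_pl_ne (by simpa [pl] using h), one_mul]
      simp [h]

theorem hProd_commute (hz : SpDatum z) (hg : 2 ≤ g) {L : List (Fin g)} (hL : L.Nodup) (u : Rˣ)
    {a : S} (ha : a ∈ rootGrp z (OppIn L)) : Commute (hProd z L fun _ => u) a := by
  have : rootGrp z (OppIn L) ≤ centralizer {hProd z L fun _ => u} := rootGrp_le fun k l t h hl => by
    have := (mono_hProd hz hg hL u).conj k l t hl
    obtain ⟨h1, h2, h3⟩ := h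
    have e : ((if pl k ∈ L then (if k.isLeft then u else u⁻¹) else 1 : Rˣ) : R) *
        ((if pl l ∈ L then (if l.isLeft then u else u⁻¹) else 1 : Rˣ) : R) = 1 := by
      rw [if_pos h2, if_pos h3]
      simp only [Opp] at h1
      revert h1
      cases k.isLeft <;> cases l.isLeft <;> simp
    rw [e, one_mul] at this
    exact mem_centralizer_singleton_iff.2 (conj_eq_iff.1 this).symm
  exact (mem_centralizer_singleton_iff.1 (this ha)).symm

theorem diagL_eq_diagonal {L : List (Fin g)} (hL : L.Nodup) (D : Fin g → R) :
    diagL L D = diagonal fun i => if i ∈ L then D i else 0 := by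
  induction L with
  | nil => simp [diagL]
  | cons i L ih =>
    rw [List.nodup_cons] at hL
    have := ih hL.2
    simp only [diagL] at this
    rw [diagL, List.map_cons, List.sum_cons, this, ← diagonal_single, diagonal_add]
    congr 1
    funext j
    by_cases h : j = i
    · subst h; simp [hL.1]
    · simp [h]

theorem diagL_eq_smul {L : List (Fin g)} {D : Fin g → R} {c : R} (h : ∀ i ∈ L, D i = c) :
    diagL L D = c • diagL L 1 := by
  rw [diagL, diagL, List.smul_sum, List.map_map]
  congr 1
  refine List.map_congr_left fun i hi => ?_
  simp [h i hi, smul_single]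

theorem exists_mono_wProd (hz : SpDatum z) (hg : 2 ≤ g) {L : List (Fin g)} (hL : L.Nodup) :
    ∃ (σ : Equiv.Perm (Idx g)) (c : Idx g → Rˣ), Mono z (wProd z L 1) σ c ∧
      ∀ k, σ k = if pl k ∈ L then bar k else k := by
  induction L with
  | nil => exact ⟨1, fun _ => 1, by simpa [wProd] using Mono.one hz, by simp⟩
  | cons i L ih =>
    rw [List.nodup_cons] at hL
    obtain ⟨σ, c, h, hσ⟩ := ih hL.2
    refine ⟨_, _, by simpa [wProd] using (hz.mono_wLong hg (Sum.inl i) 1).mul h, fun k => ?_⟩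
    rw [Equiv.Perm.mul_apply, hσ]
    by_cases hk : pl k ∈ L
    · have h1 : pl k ≠ i := fun e => hL.1 (e ▸ hk)
      rw [if_pos hk, if_pos (List.mem_cons_of_mem _ hk), Equiv.swap_apply_of_ne_of_ne]
      · rintro e; exact h1 (by rw [← pl_bar, e]; rfl)
      · rintro e; exact h1 (by rw [← pl_bar, e]; rfl)
    rw [if_neg hk]
    by_cases h1 : pl k = i
    · subst h1
      rw [if_pos List.mem_cons_self]
      rcases k with k | k
      · simp [pl]
      · simp [pl]
    · rw [if_neg (by simp [h1, hk]), Equiv.swap_apply_of_ne_of_ne]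
      · rintro rfl; exact h1 rfl
      · rintro rfl; exact h1 rfl

theorem hProd_mem_of_transfer (hz : SpDatum z) (hg : 3 ≤ g) (π : S →* Sp g R)
    (hπ : ∀ i j t, j ≠ bar i → π (z i j t) = rootSp i j t) {L₁ L₂ : List (Fin g)}
    (hL : (L₁ ++ L₂).Nodup) {N : Matrix (Fin g) (Fin g) R} {n : R} {u : Rˣ} (hu : (u : R) = 1 + n)
    (hN : Realised z π (L₁ ++ L₂) N) (hN' : Realised z π (L₁ ++ L₂) (-((↑u⁻¹ : R) • Nᵀ)))
    (h1 : Nᵀ * N = n • diagL L₁ 1) (h2 : N * Nᵀ = n • diagL L₂ 1)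
    (h3 : N * diagL L₁ 1 = N) (h4 : N * diagL L₂ 1 = 0) (h5 : diagL L₁ 1 * N = 0)
    (h6 : diagL L₂ 1 * N = N) :
    (hProd z (L₁ ++ L₂) fun _ => u)⁻¹ * hProd z L₂ (fun _ => u * u) ∈ rootGrp z Opp := by
  classical
  obtain ⟨x, hx, hx'⟩ := hN
  obtain ⟨y, hy, hy'⟩ := hN'
  have hopp : rootGrp z (OppIn (L₁ ++ L₂)) ≤ rootGrp z Opp := rootGrp_mono fun _ _ h => h.1
  have hd := List.nodup_append.1 hL
  set E₁ := diagL L₁ (1 : Fin g → R) with hE₁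
  set E₂ := diagL L₂ (1 : Fin g → R) with hE₂
  set v : R := ↑u⁻¹ with hv
  have huv : (u : R) * v = 1 := u.mul_inv
  have t₁ : E₁ᵀ = E₁ := by rw [hE₁, diagL_eq_diagonal hd.1, diagonal_transpose]
  have t₂ : E₂ᵀ = E₂ := by rw [hE₂, diagL_eq_diagonal hd.2.1, diagonal_transpose]
  have e11 : E₁ * E₁ = E₁ := by
    rw [hE₁, diagL_eq_diagonal hd.1, diagonal_mul_diagonal]
    congr 1; funext i; by_cases h : i ∈ L₁ <;> simp [h]
  have e22 : E₂ * E₂ = E₂ := by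
    rw [hE₂, diagL_eq_diagonal hd.2.1, diagonal_mul_diagonal]
    congr 1; funext i; by_cases h : i ∈ L₂ <;> simp [h]
  have e12 : E₁ * E₂ = 0 := by
    rw [hE₁, hE₂, diagL_eq_diagonal hd.1, diagL_eq_diagonal hd.2.1, diagonal_mul_diagonal,
      ← diagonal_zero]
    congr 1; funext i
    by_cases h : i ∈ L₁
    · have : i ∉ L₂ := fun h' => hd.2.2 i h i h' rfl
      simp [this]
    · simp [h]
  have e21 : E₂ * E₁ = 0 := by rw [← t₁, ← t₂, ← transpose_mul, e12, transpose_zero]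
  have h3' : E₁ * Nᵀ = Nᵀ := by rw [← t₁, ← transpose_mul, h3]
  have h4' : E₂ * Nᵀ = 0 := by rw [← t₂, ← transpose_mul, h4, transpose_zero]
  have h5' : Nᵀ * E₁ = 0 := by rw [← t₁, ← transpose_mul, h5, transpose_zero]
  have h6' : Nᵀ * E₂ = Nᵀ := by rw [← t₂, ← transpose_mul, h6]
  let D : Fin g → Rˣ := fun i => if i ∈ L₁ then 1 else u * u
  have hD₁ (i) (hi : i ∈ L₁) : D i = 1 := if_pos hi
  have hD₂ (i) (hi : i ∈ L₂) : D i = u * u := if_neg fun h => hd.2.2 i h i hi rfl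
  have hxy : (π (x * y)).1 = fromBlocks (1 + N - v • Nᵀ - (v * n) • E₂) 0 0
      (1 - Nᵀ + v • N - (v * n) • E₁) := by
    rw [map_mul, Submonoid.coe_mul, hx', hy', fromBlocks_multiply]
    simp only [mul_zero, zero_mul, add_zero, zero_add, add_mul, mul_add, one_mul, mul_one, sub_mul,
      mul_sub, transpose_neg, transpose_smul, transpose_transpose, mul_neg, mul_smul_comm, h1, h2,
      smul_zero, neg_zero]
    congr 1
    · module
    · exact sub_zero _
    · module
  have d₁ : diagL (L₁ ++ L₂) (fun i => (D i : R)) = E₁ + (u * u : R) • E₂ := by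
    rw [diagL_append, diagL_eq_smul (c := 1) (L := L₁), diagL_eq_smul (c := (u * u : R)) (L := L₂), one_smul]
    · intro i hi; rw [hD₂ i hi, Units.val_mul]
    · intro i hi; rw [hD₁ i hi, Units.val_one]
  have d₂ : diagL (L₁ ++ L₂) (fun i => (↑(D i)⁻¹ : R)) = E₁ + (v * v : R) • E₂ := by
    rw [diagL_append, diagL_eq_smul (c := 1) (L := L₁), diagL_eq_smul (c := (v * v : R)) (L := L₂), one_smul]
    · intro i hi; rw [hD₂ i hi, mul_inv, Units.val_mul]
    · intro i hi; rw [hD₁ i hi, inv_one, Units.val_one]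
  have d₃ (c : R) : diagL (L₁ ++ L₂) (fun _ => c) = c • E₁ + c • E₂ := by
    rw [diagL_append, diagL_eq_smul (c := c) (L := L₁) (by simp), diagL_eq_smul (c := c) (L := L₂) (by simp)]
  have key := wProd_conj hz π hπ hL (hopp (mul_mem hx hy)) hxy (D := D) (D' := fun _ => u)
    (by
      rw [d₁, d₃]
      simp only [add_mul, sub_mul, mul_add, mul_sub, one_mul, mul_one, smul_mul_assoc, mul_smul_comm,
        e11, e12, e21, e22, h3, h4, h5, h6, h3', h4', h5', h6', smul_zero]
      match_scalars
      · linear_combination n * huv - hu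
      · linear_combination (-1) * huv
      · linear_combination (u : R) * hu - u * n * huv
      · linear_combination (-u : R) * huv)
    (by
      rw [d₂, d₃]
      simp only [add_mul, sub_mul, mul_add, mul_sub, one_mul, mul_one, smul_mul_assoc, mul_smul_comm,
        e11, e12, e21, e22, h3, h4, h5, h6, h3', h4', h5', h6', smul_zero]
      match_scalars
      · linear_combination v * hu - huv
      · ring
      · linear_combination v * huv - v ^ 2 * hu
      · ring)
  rw [wProd_eq_hProd hz (by omega) hL, wProd_eq_hProd hz (by omega) hL (fun _ => u)] at key
  have hH : hProd z (L₁ ++ L₂) D = hProd z L₂ fun _ => u * u := by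
    rw [hProd_append]
    have r₁ : hProd z L₁ D = 1 := List.prod_eq_one fun x hx => by
      obtain ⟨i, hi, rfl⟩ := List.mem_map.1 hx
      rw [hD₁ i hi, hLong_one hz]
    have r₂ : hProd z L₂ D = hProd z L₂ fun _ => u * u := by
      rw [hProd, hProd]
      congr 1
      exact List.map_congr_left fun i hi => by rw [hD₂ i hi]
    rw [r₁, r₂, one_mul]
  rw [hH, MulAut.conj_apply] at key
  have hc := hProd_commute hz (by omega) hL u (mul_mem hx hy)
  set a := x * y with ha
  set w := wProd z (L₁ ++ L₂) 1 with hw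
  set d := hProd z (L₁ ++ L₂) fun _ => u with hdd
  have hb : MulAut.conj w a ∈ rootGrp z Opp := by
    obtain ⟨σ, c, hm, hσ⟩ := exists_mono_wProd hz (by omega) hL
    have : rootGrp z (OppIn (L₁ ++ L₂)) ≤ (rootGrp z Opp).comap (MulAut.conj w).toMonoidHom :=
      rootGrp_le fun k l t h hl => by
        rw [mem_comap, MulEquiv.coe_toMonoidHom, hm.conj k l t hl, hσ, hσ, if_pos h.2.1,
          if_pos h.2.2]
        refine mem_rootGrp (P := Opp) ?_ (fun e => hl (bar_inj.1 e)) _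
        have := h.1
        simp only [Opp] at this ⊢
        rw [isLeft_bar, isLeft_bar]
        exact fun e => this (by simpa using congrArg not e)
    exact this (mul_mem hx hy)
  have e : d⁻¹ * hProd z L₂ (fun _ => u * u) = a⁻¹ * (w * a * w⁻¹) := by
    have k1 : hProd z L₂ (fun _ => u * u) = a⁻¹ * d * (w * a * w⁻¹) := by
      have : hProd z L₂ (fun _ => u * u) =
          a⁻¹ * (a * (hProd z L₂ (fun _ => u * u) * w) * a⁻¹) * a * w⁻¹ := by group
      rw [this, key]
      group
    rw [k1, ← hc.inv_right.eq, mul_assoc, inv_mul_cancel_left]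
  rw [e]
  exact mul_mem (inv_mem (hopp (mul_mem hx hy))) hb

end SymplecticSteinberg

namespace SymplecticSteinberg
open Subgroup Matrix
variable {g : ℕ} {R : Type} [CommRing R] {S : Type} [Group S] {z : Idx g → Idx g → R → S}

theorem hLong_mul_inv_mem (hz : SpDatum z) (hg : 3 ≤ g) {i j : Fin g} (hij : i ≠ j) (u : Rˣ) :
    hLong z (Sum.inl i) u * (hLong z (Sum.inl j) u)⁻¹ ∈ rootGrp z Opp := by
  have hne : (Sum.inr j : Idx g) ≠ bar (Sum.inl i) := by simpa using hij.symm
  have h := wShort_mul_wShort hz hg (i := Sum.inl i) (j := Sum.inr j)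
    (show pl (Sum.inl i) ≠ pl (Sum.inr j) from hij) u (-1)
  rw [neg_neg, hLong_one hz, hLong_one hz, inv_one, mul_one, inv_one, mul_one, bar_inr] at h
  rw [← h]
  exact mul_mem (wShort_mem' z hne (by simp [Opp]) (by simp [Opp]) _)
    (wShort_mem' z hne (by simp [Opp]) (by simp [Opp]) _)

theorem map_sym (π : S →* Sp g R) (hπ : ∀ i j t, j ≠ bar i → π (z i j t) = rootSp i j t) (i : Idx g)
    (u v : Rˣ) : π (sym z i u v) = 1 := by
  rw [sym, map_mul, map_inv, mul_inv_eq_one, map_mul]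
  refine Subtype.ext ?_
  rw [Submonoid.coe_mul, map_hLong π hπ, map_hLong π hπ, map_hLong π hπ, diagonal_mul_diagonal]
  congr 1
  funext k
  simp only [cTor]
  split_ifs
  · simp
  · simp [mul_comm]
  · simp

theorem sym_commute (hz : SpDatum z) (hg : 2 ≤ g) (i j : Idx g) (u v w : Rˣ) :
    Commute (sym z i u v) (hLong z j w) :=
  (mono_sym hz hg i u v).commute_of_one (hLong_mem z (P := fun _ _ => True) trivial trivial w)

theorem hLong_mul_self_eq (hz : SpDatum z) (hg : 3 ≤ g) (i : Idx g) {j : Idx g} (h : i = j ∨ pl i ≠ pl j)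
    (u : Rˣ) : hLong z j (u * u) = (sym z i u u)⁻¹ * (hLong z j u * hLong z j u) := by
  have e : sym z i u u = sym z j u u := by
    rcases h with rfl | h
    · rfl
    · exact sym_eq hz hg h u u
  rw [e, sym]
  group

theorem mem_of_commute {H : Subgroup S} {a c γ : S} (h1 : Commute a c) (h2 : Commute γ a)
    (h3 : Commute γ c) (h : c * a⁻¹ ∈ H) (h' : (a * c)⁻¹ * (γ⁻¹ * (c * c)) ∈ H) : γ ∈ H := by
  have e : (a * c)⁻¹ * (γ⁻¹ * (c * c)) = γ⁻¹ * (c * a⁻¹) := by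
    rw [inv_mul_eq_iff_eq_mul]
    calc γ⁻¹ * (c * c) = γ⁻¹ * (a * c) * (c * a⁻¹) := by
          rw [mul_assoc, ← mul_assoc (a * c), mul_assoc a, (h1.mul_right h1).eq]
          group
      _ = a * c * (γ⁻¹ * (c * a⁻¹)) := by
          rw [(h2.mul_right h3).inv_left.eq, mul_assoc]
  rw [e] at h'
  simpa using (mul_mem_cancel_right h).1 h'

theorem sym_self_eq_one [IsLocalRing R] (hz : SpDatum z) (hg : 3 ≤ g) {ζ : Rˣ}
    (hζ : ∀ u : Rˣ, ∃ n : ℤ, u = ζ ^ n ∨ u = -ζ ^ n) (π : S →* Sp g R)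
    (hπ : ∀ i j t, j ≠ bar i → π (z i j t) = rootSp i j t) (i : Fin g) {u : Rˣ} {b : R}
    (hu : (u : R) = 1 + b ^ 2) : sym z (Sum.inl i) u u = 1 := by
  have : Nontrivial (Fin g) := Fin.nontrivial_iff_two_le.2 (by omega)
  obtain ⟨j, hij⟩ := exists_ne i
  refine hz.eq_one_of_opp hg hζ π hπ ?_ (map_sym π hπ _ _ _)
  have h := hProd_mem_of_transfer hz hg π hπ (L₁ := [i]) (L₂ := [j]) (N := single j i b) (n := b ^ 2)
    (u := u) (by simpa using hij.symm) hu (Realised.single hπ hij (by simp) (by simp) b)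
    (by
      rw [transpose_single, smul_single, single_neg]
      exact Realised.single hπ hij.symm (by simp) (by simp) _)
    (by simp [diagL, smul_single, sq]) (by simp [diagL, smul_single, sq]) (by simp [diagL])
    (by simp [diagL, hij.symm]) (by simp [diagL, hij.symm]) (by simp [diagL])
  have hc := hLong_comm hz (by omega) (show pl (Sum.inl i) ≠ pl (Sum.inl j) from hij.symm) u u
  have hs := sym_commute hz (by omega) (Sum.inl i) (Sum.inl j) u u u
  have e := hLong_mul_self_eq hz hg (Sum.inl i) (j := Sum.inl j) (.inr hij.symm) u
  simp only [hProd, List.map_cons, List.map_nil, List.cons_append, List.nil_append, List.prod_cons,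
    List.prod_nil, mul_one] at h
  rw [e] at h
  exact mem_of_commute hc (sym_commute hz (by omega) _ _ _ _ _) hs (hLong_mul_inv_mem hz hg hij u) h

theorem Realised.block {π : S →* Sp g R} (hπ : ∀ i j t, j ≠ bar i → π (z i j t) = rootSp i j t)
    {L : List (Fin g)} {i₀ i₁ i₂ i₃ : Fin g} (h₀ : i₀ ∈ L) (h₁ : i₁ ∈ L) (h₂ : i₂ ∈ L) (h₃ : i₃ ∈ L)
    (h02 : i₀ ≠ i₂) (h03 : i₀ ≠ i₃) (h12 : i₁ ≠ i₂) (h13 : i₁ ≠ i₃) (a b c d : R) :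
    Realised z π L (Matrix.single i₀ i₂ a + Matrix.single i₀ i₃ b + Matrix.single i₁ i₂ c +
      Matrix.single i₁ i₃ d) := by
  refine (((Realised.single hπ h02 h₀ h₂ a).add (Realised.single hπ h03 h₀ h₃ b) ?_ ?_).add
    (Realised.single hπ h12 h₁ h₂ c) ?_ ?_).add (Realised.single hπ h13 h₁ h₃ d) ?_ ?_ <;>
  simp [add_mul, mul_add, h02.symm, h03.symm, h12.symm, h13.symm]

theorem sym_self_sq_eq_one [IsLocalRing R] (hz : SpDatum z) (hg : 4 ≤ g) {ζ : Rˣ}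
    (hζ : ∀ u : Rˣ, ∃ n : ℤ, u = ζ ^ n ∨ u = -ζ ^ n) (π : S →* Sp g R)
    (hπ : ∀ i j t, j ≠ bar i → π (z i j t) = rootSp i j t) (i : Fin g) {u : Rˣ} {c d : R}
    (hu : (u : R) = 1 + (c ^ 2 + d ^ 2)) : sym z (Sum.inl i) u u * sym z (Sum.inl i) u u = 1 := by
  let e : Fin 4 → Fin g := Fin.castLE hg
  have he (a b : Fin 4) (h : a ≠ b) : e a ≠ e b := fun h' => h (Fin.castLE_injective hg h')
  have hi : sym z (Sum.inl i) u u = sym z (Sum.inl (e 0)) u u := by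
    by_cases h : i = e 0
    · rw [h]
    · exact sym_eq hz (by omega) (show pl (Sum.inl i) ≠ pl (Sum.inl (e 0)) from h) u u
  rw [hi]
  have h01 := he 0 1 (by decide)
  have h02 := he 0 2 (by decide)
  have h03 := he 0 3 (by decide)
  have h12 := he 1 2 (by decide)
  have h13 := he 1 3 (by decide)
  have h23 := he 2 3 (by decide)
  refine hz.eq_one_of_opp (by omega) hζ π hπ ?_ (by rw [map_mul, map_sym π hπ, mul_one])
  have h := hProd_mem_of_transfer hz (by omega) π hπ (L₁ := [e 0, e 1]) (L₂ := [e 2, e 3])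
    (N := single (e 2) (e 0) c + single (e 2) (e 1) d + single (e 3) (e 0) (-d) + single (e 3) (e 1) c)
    (n := c ^ 2 + d ^ 2) (u := u) (by simp [h01, h02, h03, h12, h13, h23]) hu
    (Realised.block hπ (by simp) (by simp) (by simp) (by simp) h02.symm h12.symm h03.symm h13.symm _ _ _ _)
    (by
      convert Realised.block hπ (L := [e 0, e 1] ++ [e 2, e 3]) (i₀ := e 0) (i₁ := e 1) (i₂ := e 2)
        (i₃ := e 3) (by simp) (by simp) (by simp) (by simp) h02 h03 h12 h13 (-((↑u⁻¹ : R) * c))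
        ((↑u⁻¹ : R) * d) (-((↑u⁻¹ : R) * d)) (-((↑u⁻¹ : R) * c)) using 1
      simp only [transpose_add, transpose_single, smul_add, smul_single, neg_add, single_neg, smul_eq_mul,
        mul_neg, neg_neg]
      abel)
    (by
      simp [diagL, add_mul, mul_add, smul_single, h23, h23.symm, sq, single_add, mul_comm d c, ← single_neg]
      abel)
    (by
      simp [diagL, add_mul, mul_add, smul_single, h01, h01.symm, sq, single_add, mul_comm d c, ← single_neg]
      abel)
    (by
      simp [diagL, add_mul, mul_add, h01, h01.symm]
      abel) (by
      simp [diagL, add_mul, mul_add, h02, h03, h12, h13]) (by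
      simp [diagL, add_mul, mul_add, h02, h03, h12, h13])
    (by
      simp [diagL, add_mul, mul_add, h23, h23.symm])
  have hc (a b : Fin 4) (h : a ≠ b) := hLong_comm hz (by omega)
    (show pl (Sum.inl (e a)) ≠ pl (Sum.inl (e b)) from he a b h) u u
  have hs (a : Fin 4) := sym_commute hz (by omega) (Sum.inl (e 0)) (Sum.inl (e a)) u u u
  have E (a : Fin 4) (h : 0 ≠ a) := hLong_mul_self_eq hz (by omega) (Sum.inl (e 0)) (j := Sum.inl (e a))
    (.inr (he 0 a h)) u
  have m1 := hLong_mul_inv_mem hz (by omega) h02.symm u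
  have m2 := hLong_mul_inv_mem hz (by omega) h13.symm u
  simp only [hProd, List.map_cons, List.map_nil, List.cons_append, List.nil_append, List.prod_cons,
    List.prod_nil, mul_one] at h
  rw [E 2 (by decide), E 3 (by decide)] at h
  refine mem_of_commute (a := hLong z (Sum.inl (e 0)) u * hLong z (Sum.inl (e 1)) u)
    (c := hLong z (Sum.inl (e 2)) u * hLong z (Sum.inl (e 3)) u) ?_ ?_ ?_ ?_ ?_
  · exact ((hc 0 2 (by decide)).mul_right (hc 0 3 (by decide))).mul_left
      ((hc 1 2 (by decide)).mul_right (hc 1 3 (by decide)))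
  · exact ((hs 0).mul_left (hs 0)).mul_right ((hs 1).mul_left (hs 1))
  · exact ((hs 2).mul_left (hs 2)).mul_right ((hs 3).mul_left (hs 3))
  · convert mul_mem m1 m2 using 1
    have c1 : Commute (hLong z (Sum.inl (e 0)) u)⁻¹ (hLong z (Sum.inl (e 3)) u) := (hc 0 3 (by decide)).inv_left
    have c2 := (hc 0 1 (by decide)).inv_inv
    rw [_root_.mul_inv_rev, ← c2.eq, mul_assoc, mul_assoc, ← mul_assoc _⁻¹ (hLong z (Sum.inl (e 3)) u), c1.eq,
      mul_assoc]
  · convert h using 1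
    have c1 := hc 2 3 (by decide)
    have c2 := (hs 2).inv_left
    have c3 := (hs 3).inv_left
    generalize hLong z (Sum.inl (e 0)) u = a0 at *
    generalize hLong z (Sum.inl (e 1)) u = a1 at *
    generalize hLong z (Sum.inl (e 2)) u = a2 at *
    generalize hLong z (Sum.inl (e 3)) u = a3 at *
    generalize sym z (Sum.inl (e 0)) u u = γ at *
    rw [mul_assoc a0, c1.symm.mul_mul_mul_comm, _root_.mul_inv_rev γ, mul_assoc γ⁻¹ (a2 * a2),
      ← mul_assoc (a2 * a2) γ⁻¹, ← (c2.mul_right c2).eq]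
    simp only [mul_assoc]

end SymplecticSteinberg

namespace SymplecticSteinberg

theorem isLocalRing_zmod (p : ℕ) [Fact p.Prime] (k : ℕ) : IsLocalRing (ZMod (p ^ (k + 1))) := by
  have : Fact (1 < p ^ (k + 1)) := ⟨Nat.one_lt_pow (by omega) (Fact.out (p := p.Prime)).one_lt⟩
  exact IsLocalRing.of_surjective' (PadicInt.toZModPow (p := p) (k + 1)) (ZMod.ringHom_surjective _)

theorem isUnit_of_cast_ne_zero (p : ℕ) [Fact p.Prime] (k : ℕ) {x : ZMod (p ^ (k + 1))}
    (hx : ZMod.castHom (dvd_pow_self p k.succ_ne_zero) (ZMod p) x ≠ 0) : IsUnit x := by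
  have := isLocalRing_zmod p k
  have := (ZMod.ringHom_surjective (ZMod.castHom (dvd_pow_self p k.succ_ne_zero) (ZMod p))).isLocalHom
  exact (isUnit_map_iff (ZMod.castHom (dvd_pow_self p k.succ_ne_zero) (ZMod p)) x).1 hx.isUnit

theorem pow_eq_one_of_cast_eq_one (p : ℕ) [Fact p.Prime] (k : ℕ) {x : ZMod (p ^ (k + 1))}
    (hx : ZMod.castHom (dvd_pow_self p k.succ_ne_zero) (ZMod p) x = 1) : x ^ p ^ k = 1 := by
  have : NeZero (p ^ (k + 1)) := ⟨pow_ne_zero _ (Fact.out (p := p.Prime)).ne_zero⟩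
  have h : (p : ZMod (p ^ (k + 1))) ∣ x - 1 := by
    obtain ⟨n, rfl⟩ := ZMod.intCast_surjective x
    rw [map_intCast] at hx
    have : ((n - 1 : ℤ) : ZMod p) = 0 := by push_cast; rw [hx, sub_self]
    obtain ⟨m, hm⟩ := (ZMod.intCast_zmod_eq_zero_iff_dvd _ _).1 this
    exact ⟨m, by exact_mod_cast congrArg (Int.cast : ℤ → ZMod (p ^ (k + 1))) hm⟩
  have := dvd_sub_pow_of_dvd_sub h k
  rw [one_pow] at this
  have e : (p : ZMod (p ^ (k + 1))) ^ (k + 1) = 0 := by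
    rw [← Nat.cast_pow]; exact ZMod.natCast_self _
  rw [e, zero_dvd_iff, sub_eq_zero] at this
  exact this

theorem exists_generator_sq_add (p : ℕ) [Fact p.Prime] (hp : p ≠ 2) (k : ℕ) :
    ∃ ζ : (ZMod (p ^ (k + 1)))ˣ, (∀ u : (ZMod (p ^ (k + 1)))ˣ, ∃ n : ℤ, u = ζ ^ n) ∧
      ∃ (s x : (ZMod (p ^ (k + 1)))ˣ) (b : ZMod (p ^ (k + 1))), ζ * (s * s) = x ∧
        (x : ZMod (p ^ (k + 1))) = 1 + b ^ 2 := by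
  have hp' : p.Prime := Fact.out
  have hcyc := ZMod.isCyclic_units_of_prime_pow p hp' hp (k + 1)
  obtain ⟨ζ, hζ⟩ := hcyc.exists_generator
  refine ⟨ζ, fun u => ?_, ?_⟩
  · obtain ⟨n, hn⟩ := Subgroup.mem_zpowers_iff.1 (hζ u)
    exact ⟨n, hn.symm⟩
  set f := ZMod.castHom (dvd_pow_self p k.succ_ne_zero) (ZMod p) with hf
  have hfs : Function.Surjective f := ZMod.ringHom_surjective f
  have hz : f ζ ≠ 0 := (ζ.isUnit.map f).ne_zero
  obtain ⟨a, b, ha, hab⟩ : ∃ a b : ZMod p, a ≠ 0 ∧ a ^ 2 + b ^ 2 = f ζ := by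
    obtain ⟨a, b, hab⟩ := ZMod.sq_add_sq p (f ζ)
    by_cases ha : a = 0
    · refine ⟨b, a, fun hb => hz ?_, by rw [add_comm, hab]⟩
      rw [← hab, ha, hb]; simp
    · exact ⟨a, b, ha, hab⟩
  obtain ⟨s, hs⟩ := hfs a⁻¹
  obtain ⟨c, hc⟩ := hfs (b * a⁻¹)
  have hsu : IsUnit s := isUnit_of_cast_ne_zero p k (by rw [← hf, hs]; exact inv_ne_zero ha)
  have e : f (1 + c ^ 2) = f ζ * (a⁻¹ * a⁻¹) := by
    rw [map_add, map_pow, hc, map_one, ← hab]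
    field_simp
  have hxu : IsUnit (1 + c ^ 2) := isUnit_of_cast_ne_zero p k (by
    rw [← hf, e]; exact mul_ne_zero hz (mul_ne_zero (inv_ne_zero ha) (inv_ne_zero ha)))
  obtain ⟨s, rfl⟩ := hsu
  obtain ⟨x, hx⟩ := hxu
  have hr : f ((x * (ζ * (s * s))⁻¹ : (ZMod (p ^ (k + 1)))ˣ) : ZMod (p ^ (k + 1))) = 1 := by
    have : f ((x * (ζ * (s * s))⁻¹ * (ζ * (s * s)) : (ZMod (p ^ (k + 1)))ˣ) : ZMod (p ^ (k + 1))) =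
        f ζ * (a⁻¹ * a⁻¹) := by rw [inv_mul_cancel_right, hx, e]
    rw [Units.val_mul, map_mul, Units.val_mul, Units.val_mul, Units.val_mul, map_mul f (ζ : ZMod (p ^ (k + 1))), map_mul f (s : ZMod (p ^ (k + 1))), hs] at this
    rw [Units.val_mul]
    exact mul_right_cancel₀ (mul_ne_zero hz (mul_ne_zero (inv_ne_zero ha) (inv_ne_zero ha)))
      (this.trans (one_mul _).symm)
  have hr' := pow_eq_one_of_cast_eq_one p k hr
  rw [← Units.val_pow_eq_pow_val, Units.val_eq_one] at hr'
  obtain ⟨m, hm⟩ : Odd (p ^ k) := (hp'.odd_of_ne_two hp).pow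
  refine ⟨s * (x * (ζ * (s * s))⁻¹) ^ (m + 1), x, c, ?_, hx⟩
  have h2 : (x * (ζ * (s * s))⁻¹) ^ (m + 1) * (x * (ζ * (s * s))⁻¹) ^ (m + 1) = x * (ζ * (s * s))⁻¹ := by
    rw [← pow_add, show m + 1 + (m + 1) = p ^ k + 1 by omega, pow_succ (x * (ζ * (s * s))⁻¹) (p ^ k), hr', one_mul]
  rw [mul_mul_mul_comm, h2, ← mul_assoc, mul_comm, inv_mul_cancel_right]

theorem five_generates (k : ℕ) : ∃ ζ : (ZMod (2 ^ (k + 1)))ˣ, (ζ : ZMod (2 ^ (k + 1))) = 1 + 2 ^ 2 ∧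
    (∀ u : (ZMod (2 ^ (k + 1)))ˣ, ∃ n : ℤ, u = ζ ^ n ∨ u = -ζ ^ n) ∧
    ((∃ m : ℤ, -1 = ζ ^ m) ∨ ∃ (u : (ZMod (2 ^ (k + 1)))ˣ) (n : ℤ), u = -ζ ^ n ∧
      (u : ZMod (2 ^ (k + 1))) = 1 + (1 ^ 2 + 1 ^ 2)) := by
  rcases k with _ | k
  · refine ⟨1, by decide, fun u => ⟨0, ?_⟩, .inl ⟨0, by decide⟩⟩
    rw [zpow_zero]
    revert u; decide
  have h5 : (5 : ZMod 2) ≠ 0 := by decide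
  have h3 : (3 : ZMod 2) ≠ 0 := by decide
  have : Fact (Nat.Prime 2) := ⟨Nat.prime_two⟩
  obtain ⟨ζ, hζ⟩ := isUnit_of_cast_ne_zero 2 (k + 1) (x := 5) (by rw [map_ofNat]; exact h5)
  obtain ⟨u, hu⟩ := isUnit_of_cast_ne_zero 2 (k + 1) (x := 3) (by rw [map_ofNat]; exact h3)
  have hd : 2 ^ 2 ∣ 2 ^ (k + 1 + 1) := pow_dvd_pow _ (by omega)
  have h4 : Units.map (ZMod.castHom hd (ZMod (2 ^ 2))).toMonoidHom ζ = 1 := by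
    ext
    rw [Units.coe_map, hζ]
    change ZMod.castHom hd (ZMod (2 ^ 2)) 5 = 1
    rw [map_ofNat]; decide
  have hm : -1 ∉ Subgroup.zpowers ζ := by
    rintro ⟨m, hm⟩
    have := congrArg (Units.map (ZMod.castHom hd (ZMod (2 ^ 2))).toMonoidHom) hm
    simp only [map_zpow, h4, one_zpow] at this
    have := congrArg Units.val this
    rw [Units.coe_map] at this
    change _ = ZMod.castHom hd (ZMod (2 ^ 2)) (-1) at this
    rw [map_neg, map_one] at this
    revert this; decide
  have ho : Nat.card (Subgroup.zpowers ζ) = 2 ^ k := by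
    rw [Nat.card_zpowers, ← orderOf_units, hζ, ZMod.orderOf_five]
  have hidx : (Subgroup.zpowers ζ).index = 2 := by
    have h1 := (Subgroup.zpowers ζ).card_mul_index
    have : NeZero (2 ^ (k + 1 + 1)) := ⟨by positivity⟩
    rw [ho, Nat.card_eq_fintype_card, ZMod.card_units_eq_totient, Nat.totient_prime_pow_succ Nat.prime_two,
      Nat.add_one_sub_one, mul_one] at h1
    exact Nat.eq_of_mul_eq_mul_left (by positivity) (h1.trans (pow_succ 2 k))
  have hall : ∀ u : (ZMod (2 ^ (k + 1 + 1)))ˣ, ∃ n : ℤ, u = ζ ^ n ∨ u = -ζ ^ n := fun u => by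
    by_cases h : u ∈ Subgroup.zpowers ζ
    · obtain ⟨n, hn⟩ := h
      exact ⟨n, .inl hn.symm⟩
    · have : -1 * u ∈ Subgroup.zpowers ζ := (Subgroup.mul_mem_iff_of_index_two hidx).2 (by simp [h, hm])
      obtain ⟨n, hn⟩ := this
      exact ⟨n, .inr (by simp only at hn; rw [hn]; simp)⟩
  refine ⟨ζ, by rw [hζ]; norm_num, hall, .inr ⟨u, ?_⟩⟩
  obtain ⟨n, hn | hn⟩ := hall u
  · exfalso
    have := congrArg (Units.map (ZMod.castHom hd (ZMod (2 ^ 2))).toMonoidHom) hn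
    simp only [map_zpow, h4, one_zpow] at this
    have := congrArg Units.val this
    rw [Units.coe_map, hu] at this
    change ZMod.castHom hd (ZMod (2 ^ 2)) 3 = 1 at this
    rw [map_ofNat] at this
    revert this; decide
  · exact ⟨n, hn, by rw [hu]; norm_num⟩

end SymplecticSteinberg

namespace SymplecticSteinberg
open Subgroup
variable {g : ℕ} {S : Type} [Group S]

theorem eq_one_or_eq_of_mem_zpowers {c x : S} (hc : c * c = 1) (hx : x ∈ zpowers c) : x = 1 ∨ x = c := by
  obtain ⟨n, rfl⟩ := hx
  obtain ⟨m, rfl | rfl⟩ := n.even_or_odd'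
  · left
    simp only [zpow_mul, zpow_ofNat, sq, hc, one_zpow]
  · right
    simp only [zpow_add, zpow_mul, zpow_ofNat, sq, hc, one_zpow, one_mul, pow_one]

/-- Over `ZMod (p ^ (k + 1))` the kernel of a central-type family over the symplectic group has at most
two elements, and is trivial for odd `p`. -/
theorem SpDatum.exists_ker_prime_pow (hg : 4 ≤ g) (p : ℕ) [Fact p.Prime] (k : ℕ)
    {z : Idx g → Idx g → ZMod (p ^ (k + 1)) → S} (hz : SpDatum z) (π : S →* Sp g (ZMod (p ^ (k + 1))))
    (hπ : ∀ i j t, j ≠ SymplecticSteinberg.bar i → π (z i j t) = rootSp i j t) :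
    ∃ c : S, c * c = 1 ∧ (p ≠ 2 → c = 1) ∧
      ∀ x ∈ rootGrp z (fun _ _ => True), π x = 1 → x = 1 ∨ x = c := by
  have := isLocalRing_zmod p k
  let o : Fin g := ⟨0, by omega⟩
  refine ⟨hLong z (Sum.inl o) (-1) * hLong z (Sum.inl o) (-1), ?_⟩
  suffices h : ∃ ζ : (ZMod (p ^ (k + 1)))ˣ, (∀ u : (ZMod (p ^ (k + 1)))ˣ, ∃ n : ℤ, u = ζ ^ n ∨ u = -ζ ^ n) ∧
      (∃ (s x : (ZMod (p ^ (k + 1)))ˣ) (b : ZMod (p ^ (k + 1))), ζ * (s * s) = x ∧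
        (x : ZMod (p ^ (k + 1))) = 1 + b ^ 2) ∧
      ((∃ m : ℤ, -1 = ζ ^ m) ∨ (p = 2 ∧ ∃ (u : (ZMod (p ^ (k + 1)))ˣ) (n : ℤ), u = -ζ ^ n ∧
        (u : ZMod (p ^ (k + 1))) = 1 + (1 ^ 2 + 1 ^ 2))) by
    obtain ⟨ζ, hζ, ⟨s, x, b, hsx, hx⟩, h2⟩ := h
    have H (i : Fin g) := symbol_hLong hz (by omega) hζ (Sum.inl i)
    have hsq (i : Fin g) : hLong z (Sum.inl i) (ζ * ζ) = hLong z (Sum.inl i) ζ * hLong z (Sum.inl i) ζ :=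
      (H i).gen_sq hsx (sym_self_eq_one hz (by omega) hζ π hπ i hx)
    have hker := fun x hx hx1 => hz.mem_zpowers_of_ker (by omega) hζ π hπ o hsq (x := x) hx hx1
    rcases h2 with ⟨m, hm⟩ | ⟨h2, u, n, hu, hu1⟩
    · have h1 := (H o).sq_neg_one (hsq o) hm
      rw [h1]
      refine ⟨one_mul 1, fun _ => rfl, fun x hx hx1 => .inl ?_⟩
      simpa [h1] using hker x hx hx1
    · have h1 := sym_self_sq_eq_one hz hg hζ π hπ o hu1
      rw [sym, (H o).sq_neg_one' (hsq o) hu] at h1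
      exact ⟨h1, fun h => absurd h2 h, fun x hx hx1 => eq_one_or_eq_of_mem_zpowers h1 (hker x hx hx1)⟩
  by_cases hp : p = 2
  · subst hp
    obtain ⟨ζ, h1, h2, h3⟩ := five_generates k
    exact ⟨ζ, h2, ⟨1, ζ, 2, by simp, h1⟩, h3.imp_right fun h => ⟨rfl, h⟩⟩
  · obtain ⟨ζ, h1, h2⟩ := exists_generator_sq_add p hp k
    exact ⟨ζ, fun u => (h1 u).imp fun _ => .inl, h2, .inl (h1 (-1))⟩

end SymplecticSteinberg

namespace SymplecticSteinberg
open Subgroup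
variable {g : ℕ} {R R' : Type} [CommRing R] [CommRing R'] {S S' : Type} [Group S] [Group S']
  {z : Idx g → Idx g → R → S} {z' : Idx g → Idx g → R → S'}

theorem map_sg_mul {F : Type} [FunLike F R R'] [NonUnitalRingHomClass F R R'] (f : F) (i : Idx g)
    (t : R) : f (sg i * t) = sg i * f t := by
  rcases sg_eq (R := R) i with h | h <;> cases i <;> simp

theorem SpDatum.prod (hz : SpDatum z) (hz' : SpDatum z') :
    SpDatum (fun i j t => (z i j t, z' i j t)) where
  add_short i j s t h := Prod.ext (hz.add_short i j s t h) (hz'.add_short i j s t h)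
  symm i j t h := Prod.ext (hz.symm i j t h) (hz'.symm i j t h)
  comm_short i j k l s t h1 h2 h3 h4 h5 h6 :=
    Prod.ext (hz.comm_short i j k l s t h1 h2 h3 h4 h5 h6)
      (hz'.comm_short i j k l s t h1 h2 h3 h4 h5 h6)
  conj_short i j l s t h1 h2 h3 :=
    Prod.ext (hz.conj_short i j l s t h1 h2 h3) (hz'.conj_short i j l s t h1 h2 h3)
  add_long i s t := Prod.ext (hz.add_long i s t) (hz'.add_long i s t)
  comm_long_short i k l s t h1 h2 h3 :=
    Prod.ext (hz.comm_long_short i k l s t h1 h2 h3) (hz'.comm_long_short i k l s t h1 h2 h3)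
  comm_long i k s t h := Prod.ext (hz.comm_long i k s t h) (hz'.comm_long i k s t h)
  conj_opp i j s t h := Prod.ext (hz.conj_opp i j s t h) (hz'.conj_opp i j s t h)
  conj_long i j s t h := Prod.ext (hz.conj_long i j s t h) (hz'.conj_long i j s t h)

theorem SpDatum.comp {w : Idx g → Idx g → R' → S} (hw : SpDatum w) (f : R →ₙ+* R') :
    SpDatum (fun i j t => w i j (f t)) where
  add_short i j s t h := by rw [map_add, hw.add_short i j _ _ h]
  symm i j t h := hw.symm i j _ h
  comm_short i j k l s t h1 h2 h3 h4 h5 h6 := hw.comm_short i j k l _ _ h1 h2 h3 h4 h5 h6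
  conj_short i j l s t h1 h2 h3 := by
    rw [hw.conj_short i j l _ _ h1 h2 h3, mul_assoc, mul_assoc, map_sg_mul, map_mul]
  add_long i s t := by rw [map_add, hw.add_long]
  comm_long_short i k l s t h1 h2 h3 := hw.comm_long_short i k l _ _ h1 h2 h3
  comm_long i k s t h := hw.comm_long i k _ _ h
  conj_opp i j s t h := by
    rw [hw.conj_opp i j _ _ h, mul_assoc, mul_assoc, mul_assoc, mul_assoc, two_mul, two_mul, map_add,
      map_sg_mul, map_mul]
  conj_long i j s t h := by
    rw [hw.conj_long i j _ _ h, mul_assoc (sg i), mul_assoc (sg i), map_sg_mul, map_mul, map_neg,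
      map_mul, sq, sq, map_mul]

theorem SpDatum.of_surjective {w : Idx g → Idx g → R' → S} (hz : SpDatum z) (f : R →+* R')
    (hf : Function.Surjective f) (hw : ∀ i j t, j ≠ SymplecticSteinberg.bar i → w i j (f t) = z i j t) :
    SpDatum w where
  add_short i j s t h := by
    obtain ⟨s, rfl⟩ := hf s
    obtain ⟨t, rfl⟩ := hf t
    have e : j ≠ SymplecticSteinberg.bar i := by grind
    rw [← map_add, hw _ _ _ e, hw _ _ _ e, hw _ _ _ e, hz.add_short i j _ _ h]
  symm i j t h := by
    obtain ⟨t, rfl⟩ := hf t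
    rw [hw _ _ _ h, hw _ _ _ (by grind), hz.symm i j _ h]
  comm_short i j k l s t h1 h2 h3 h4 h5 h6 := by
    obtain ⟨s, rfl⟩ := hf s
    obtain ⟨t, rfl⟩ := hf t
    rw [hw _ _ _ (by grind), hw _ _ _ (by grind)]
    exact hz.comm_short i j k l s t h1 h2 h3 h4 h5 h6
  conj_short i j l s t h1 h2 h3 := by
    obtain ⟨s, rfl⟩ := hf s
    obtain ⟨t, rfl⟩ := hf t
    rw [mul_assoc (sg j), ← map_mul, ← map_sg_mul, hw _ _ _ (by grind), hw _ _ _ (by grind),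
      hw _ _ _ (by grind), hz.conj_short i j l s t h1 h2 h3, mul_assoc]
  add_long i s t := by
    obtain ⟨s, rfl⟩ := hf s
    obtain ⟨t, rfl⟩ := hf t
    rw [← map_add, hw _ _ _ (by grind), hw _ _ _ (by grind), hw _ _ _ (by grind), hz.add_long]
  comm_long_short i k l s t h1 h2 h3 := by
    obtain ⟨s, rfl⟩ := hf s
    obtain ⟨t, rfl⟩ := hf t
    rw [hw _ _ _ (by grind), hw _ _ _ (by grind)]
    exact hz.comm_long_short i k l s t h1 h2 h3
  comm_long i k s t h := by
    obtain ⟨s, rfl⟩ := hf s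
    obtain ⟨t, rfl⟩ := hf t
    rw [hw _ _ _ (by grind), hw _ _ _ (by grind)]
    exact hz.comm_long i k s t h
  conj_opp i j s t h := by
    obtain ⟨s, rfl⟩ := hf s
    obtain ⟨t, rfl⟩ := hf t
    rw [mul_assoc, mul_assoc, two_mul, ← map_mul, ← map_sg_mul, ← map_add, ← two_mul,
      hw _ _ _ (by grind), hw _ _ _ (by grind), hw _ _ _ (by grind), hz.conj_opp i j s t h,
      mul_assoc, mul_assoc]
  conj_long j l s t h := by
    obtain ⟨s, rfl⟩ := hf s
    obtain ⟨t, rfl⟩ := hf t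
    rw [mul_assoc (sg j), ← map_mul, ← map_sg_mul, sq, ← map_mul, ← map_mul, ← map_neg,
      hw _ _ _ (by grind), hw _ _ _ (by grind), hw _ _ _ (by grind), hw _ _ _ (by grind),
      hz.conj_long j l s t h, mul_assoc (sg j), sq]

theorem SpMap_rootSp (f : R →+* R') {i j : Idx g} (h : j ≠ bar i) (t : R) :
    SpAux.SpMap f g (rootSp i j t) = rootSp i j (f t) := by
  apply Subtype.ext
  change Matrix.map (rootSp i j t).1 f = (rootSp i j (f t)).1
  rw [rootSp_coe h, rootSp_coe h]
  by_cases e : i = j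
  · subst e
    rw [rootMat_same, rootMat_same, ← map_sg_mul, Matrix.map_add _ (map_add f),
      Matrix.map_one _ (map_zero f) (map_one f), Matrix.map_single]
  · rw [rootMat_ne e, rootMat_ne e, ← map_sg_mul, ← map_sg_mul, Matrix.map_add _ (map_add f),
      Matrix.map_add _ (map_add f),
      Matrix.map_one _ (map_zero f) (map_one f), Matrix.map_single, Matrix.map_single]

theorem SpDatum.commute_bar (hz : SpDatum z) {j l : Idx g} (i : Idx g) {u v : R} (h : u * v = 0)
    (hij : j ≠ SymplecticSteinberg.bar i) (hl : l ≠ j) (hli : l ≠ SymplecticSteinberg.bar i) :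
    Commute (z i j u) (z (SymplecticSteinberg.bar j) l v) := by
  have hvu : v * u = 0 := by rw [mul_comm, h]
  by_cases h1 : pl i = pl j
  · have : i = j := by grind
    subst this
    have e : pl i ≠ pl l := by grind
    refine conj_eq_iff.1 ?_
    rw [hz.conj_long i l u v e, mul_assoc (sg i), h, mul_zero, sq, ← mul_assoc, h, zero_mul, neg_zero,
      hz.zero (by grind), hz.zero (by grind), one_mul, one_mul]
  by_cases h2 : pl j = pl l
  · have : l = SymplecticSteinberg.bar j := by grind
    subst this
    refine (conj_eq_iff.1 (?_ : MulAut.conj _ _ = _) : Commute _ _).symm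
    have := hz.conj_long (SymplecticSteinberg.bar j) i v u (by grind)
    rw [bar_bar, mul_assoc (sg _), hvu, mul_zero, sq, ← mul_assoc, hvu, zero_mul, neg_zero,
      hz.zero (by grind), hz.zero (by grind), one_mul, one_mul] at this
    rw [hz.symm i j u hij, this]
  refine conj_eq_iff.1 ?_
  by_cases h3 : pl i = pl l
  · have : l = i := by grind
    subst this
    rw [hz.conj_opp _ _ _ _ h1, mul_assoc, h, mul_zero, hz.zero (by grind), one_mul]
  · rw [hz.conj_short _ _ _ _ _ h1 h3 h2, mul_assoc, h, mul_zero, hz.zero (by grind), one_mul]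

theorem SpDatum.commute_of_mul_eq_zero (hz : SpDatum z) {i j k l : Idx g} {u v : R} (h : u * v = 0)
    (hij : j ≠ SymplecticSteinberg.bar i) (hkl : l ≠ SymplecticSteinberg.bar k)
    (h1 : ¬(k = SymplecticSteinberg.bar i ∧ l = SymplecticSteinberg.bar j))
    (h2 : ¬(k = SymplecticSteinberg.bar j ∧ l = SymplecticSteinberg.bar i)) :
    Commute (z i j u) (z k l v) := by
  by_cases e1 : k = SymplecticSteinberg.bar j
  · subst e1
    exact hz.commute_bar i h hij (by grind) (by grind)
  by_cases e2 : k = SymplecticSteinberg.bar i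
  · subst e2
    rw [hz.symm i j u hij]
    exact hz.commute_bar j h (by grind) (by grind) (by grind)
  by_cases e3 : l = SymplecticSteinberg.bar j
  · subst e3
    rw [hz.symm k _ v hkl]
    exact hz.commute_bar i h hij (by grind) (by grind)
  by_cases e4 : l = SymplecticSteinberg.bar i
  · subst e4
    rw [hz.symm k _ v hkl, hz.symm i j u hij]
    exact hz.commute_bar j h (by grind) (by grind) (by grind)
  exact hz.comm i j k l u v hij hkl e2 e1 e4 e3

theorem SpDatum.commute_orthogonal (hg : 4 ≤ g) (hz : SpDatum z) {i j k l : Idx g} {u f : R} (t : R)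
    (h : u * f = 0) (hf : f * f = f) (hij : j ≠ SymplecticSteinberg.bar i)
    (hkl : l ≠ SymplecticSteinberg.bar k) : Commute (z i j u) (z k l (f * t)) := by
  have h' : u * (f * t) = 0 := by rw [← mul_assoc, h, zero_mul]
  suffices H : Commute (z i j u) (z (SymplecticSteinberg.bar i) (SymplecticSteinberg.bar j) (f * t)) by
    by_cases e1 : k = SymplecticSteinberg.bar i ∧ l = SymplecticSteinberg.bar j
    · rwa [e1.1, e1.2]
    by_cases e2 : k = SymplecticSteinberg.bar j ∧ l = SymplecticSteinberg.bar i
    · rw [e2.1, e2.2, hz.symm (SymplecticSteinberg.bar j) (SymplecticSteinberg.bar i) _ (by grind)]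
      exact H
    exact hz.commute_of_mul_eq_zero h' hij hkl e1 e2
  obtain ⟨m, hm, hm', -⟩ := exists_pl_ne hg i j j
  by_cases e : pl i = pl j
  · have : i = j := by grind
    subst this
    have H := hz.conj_long m (SymplecticSteinberg.bar i) (-(f * t)) f (by grind)
    have e1 : -(-(f * t) * f ^ 2) = f * t := by linear_combination (t * f + t) * hf
    rw [e1, mul_assoc, ← inv_mul_eq_iff_eq_mul, eq_comm, ← eq_mul_inv_iff_mul_eq] at H
    rw [H]
    have c1 : Commute (z i i u) (z m m (-(f * t))) :=
      hz.commute_of_mul_eq_zero (by rw [mul_neg, h', neg_zero]) hij (by grind) (by grind) (by grind)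
    have c2 : Commute (z i i u) (z (SymplecticSteinberg.bar m) (SymplecticSteinberg.bar i) f) :=
      hz.commute_of_mul_eq_zero h hij (by grind) (by grind) (by grind)
    have c3 : Commute (z i i u) (z m (SymplecticSteinberg.bar i) (sg m * -(f * t) * f)) :=
      hz.commute_of_mul_eq_zero (by linear_combination (-sg m * t * f) * h) hij (by grind) (by grind)
        (by grind)
    rw [MulAut.conj_apply]
    exact (c3.inv_right.mul_right ((c1.mul_right c2).mul_right c1.inv_right)).mul_right c2.inv_right
  · have H := hz.conj_eq (SymplecticSteinberg.bar i) m (SymplecticSteinberg.bar j) (sg m * (f * t)) f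
      (by grind) (by grind) (by grind)
    have e1 : sg m * (sg m * (f * t)) * f = f * t := by
      linear_combination (f * t * f) * sg_mul_self (R := R) m + t * hf
    rw [e1] at H
    rw [H]
    have c1 : Commute (z i j u) (z (SymplecticSteinberg.bar i) m (sg m * (f * t))) :=
      hz.commute_of_mul_eq_zero (by linear_combination (sg m * t) * h) hij (by grind) (by grind)
        (by grind)
    have c2 : Commute (z i j u) (z (SymplecticSteinberg.bar m) (SymplecticSteinberg.bar j) f) :=
      hz.commute_of_mul_eq_zero h hij (by grind) (by grind) (by grind)
    rw [MulAut.conj_apply]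
    exact ((c1.mul_right c2).mul_right c1.inv_right).mul_right c2.inv_right

end SymplecticSteinberg

namespace SymplecticSteinberg
open Subgroup
variable {R' : Type} [CommRing R'] {g : ℕ} {R : Type} [CommRing R]

/-- The subgroup of `S × Sp(2g, R)` generated by the pairs of a root element of the family `z` and
the corresponding elementary matrix. -/
def rootGraph {S : Type} [Group S] (z : Idx g → Idx g → R → S) : Subgroup (S × Sp g R) :=
  rootGrp (fun i j t => (z i j t, rootSp i j t)) (fun _ _ => True)

/-- For every family of root elements over `R`, the elements that lie over the identity matrix belong
to a subgroup of order at most two, which is trivial if `o` holds. -/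
def KerLeTwo (g : ℕ) (R : Type) [CommRing R] (o : Prop) : Prop :=
  ∀ (S : Type) [Group S] (z : Idx g → Idx g → R → S), SpDatum z → ∃ c : S, c * c = 1 ∧ (o → c = 1) ∧
    ∀ x : S, (x, (1 : Sp g R)) ∈ rootGraph z → x = 1 ∨ x = c

theorem KerLeTwo.mono {o o' : Prop} (h : KerLeTwo g R o) (ho : o' → o) : KerLeTwo g R o' :=
  fun S _ z hz => (h S z hz).imp fun _ hc => ⟨hc.1, fun h' => hc.2.1 (ho h'), hc.2.2⟩

theorem map_mem_rootGraph {S : Type} [Group S] {z : Idx g → Idx g → R → S} (f : R →+* R')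
    {S' : Type} [Group S'] {w : Idx g → Idx g → R' → S'} {q : S × Sp g R} (φ : S →* S')
    (hw : ∀ i j t, j ≠ bar i → φ (z i j t) = w i j (f t)) (hq : q ∈ rootGraph z) :
    (φ q.1, SpAux.SpMap f g q.2) ∈ rootGraph w := by
  have : rootGraph z ≤ (rootGraph w).comap (φ.prodMap (SpAux.SpMap f g)) := by
    refine rootGrp_le fun k l t _ hl => ?_
    have := mem_rootGrp (z := fun i j t => (w i j t, rootSp i j t)) (P := fun _ _ => True) trivial
      hl (f t)
    rw [← hw _ _ _ hl, ← SpMap_rootSp f hl] at this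
    exact this
  exact this hq

theorem KerLeTwo.exists_of_factor {o : Prop} (h : KerLeTwo g R' o) {S : Type} [Group S]
    {z : Idx g → Idx g → R → S} (hz : SpDatum z) {w : Idx g → Idx g → R' → S} (f : R →+* R')
    (hf : Function.Surjective f)
    (hw : ∀ i j t, j ≠ SymplecticSteinberg.bar i → w i j (f t) = z i j t) :
    ∃ c : S, c * c = 1 ∧ (o → c = 1) ∧
      ∀ x : S, (x, (1 : Sp g R)) ∈ rootGraph z → x = 1 ∨ x = c := by
  obtain ⟨c, h1, h2, h3⟩ := h S w (hz.of_surjective f hf hw)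
  refine ⟨c, h1, h2, fun x hx => h3 x ?_⟩
  simpa using map_mem_rootGraph f (MonoidHom.id S) (fun i j t h => (hw i j t h).symm) hx

theorem KerLeTwo.of_ringEquiv {o : Prop} (h : KerLeTwo g R' o) (e : R ≃+* R') : KerLeTwo g R o :=
  fun _ _ z hz => h.exists_of_factor hz (w := fun i j t => z i j (e.symm t)) (e : R →+* R') e.surjective
    (by simp)

theorem KerLeTwo.of_subsingleton [Subsingleton R] (o : Prop) : KerLeTwo g R o := by
  intro S _ z hz
  refine ⟨1, one_mul 1, fun _ => rfl, fun x hx => .inl ?_⟩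
  have : rootGraph z ≤ (⊥ : Subgroup S).comap (MonoidHom.fst _ _) := by
    refine rootGrp_le fun k l t _ hl => ?_
    rw [Subsingleton.elim t 0]
    exact hz.zero hl
  exact this hx

theorem KerLeTwo.prime_pow (hg : 4 ≤ g) (p : ℕ) [Fact p.Prime] (k : ℕ) :
    KerLeTwo g (ZMod (p ^ (k + 1))) (p ≠ 2) := by
  intro S _ z hz
  obtain ⟨c, h1, h2, h3⟩ := (hz.prod spDatum_rootSp).exists_ker_prime_pow hg p k
    (MonoidHom.snd S (Sp g (ZMod (p ^ (k + 1))))) (fun _ _ _ _ => rfl)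
  refine ⟨c.1, congrArg Prod.fst h1, fun h => congrArg Prod.fst (h2 h), fun x hx => ?_⟩
  exact (h3 _ hx rfl).imp (congrArg Prod.fst) (congrArg Prod.fst)

theorem KerLeTwo.prod {o o' : Prop} (hg : 4 ≤ g) (h : KerLeTwo g R o) (h' : KerLeTwo g R' o')
    (ho : o ∨ o') : KerLeTwo g (R × R') (o ∧ o') := by
  intro S _ z hz
  let φ : R →ₙ+* R × R' :=
    { toFun := fun s => (s, 0), map_mul' := by simp, map_zero' := rfl, map_add' := by simp }
  let ψ : R' →ₙ+* R × R' :=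
    { toFun := fun s => (0, s), map_mul' := by simp, map_zero' := rfl, map_add' := by simp }
  have hφ (s : R) : φ s = (s, 0) := rfl
  have hψ (t : R') : ψ t = (0, t) := rfl
  obtain ⟨c, h1, h2, h3⟩ := h S _ (hz.comp φ)
  obtain ⟨c', h1', h2', h3'⟩ := h' S _ (hz.comp ψ)
  have key : ∀ q ∈ rootGraph z, ∃ y y' : S, q.1 = y * y' ∧
      (y, SpAux.SpMap (RingHom.fst R R') g q.2) ∈ rootGraph (fun i j t => z i j (φ t)) ∧
      (y', SpAux.SpMap (RingHom.snd R R') g q.2) ∈ rootGraph (fun i j t => z i j (ψ t)) := by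
    have hroot : ∀ i j s, j ≠ bar i → ∀ q ∈ rootGraph (fun i j t => z i j (ψ t)),
        Commute (z i j (φ s)) q.1 := by
      intro i j s hij q hq
      have H : rootGraph (fun i j t => z i j (ψ t)) ≤
          (centralizer {z i j (φ s)}).comap (MonoidHom.fst _ _) := by
        refine rootGrp_le fun k l t _ hkl => ?_
        refine mem_centralizer_singleton_iff.2 ?_
        have := hz.commute_orthogonal hg (u := φ s) (f := ((0, 1) : R × R')) (0, t) (by simp [hφ])
          (by simp) hij hkl
        simpa [hψ] using this.symm.eq
      exact (mem_centralizer_singleton_iff.1 (H hq)).symm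
    have hcomm : ∀ p ∈ rootGraph (fun i j t => z i j (φ t)),
        ∀ q ∈ rootGraph (fun i j t => z i j (ψ t)), Commute p.1 q.1 := by
      intro p hp q hq
      have H : rootGraph (fun i j t => z i j (φ t)) ≤
          (centralizer {q.1}).comap (MonoidHom.fst _ _) :=
        rootGrp_le fun i j s _ hij => mem_centralizer_singleton_iff.2 (hroot i j s hij q hq).eq
      exact mem_centralizer_singleton_iff.1 (H hp)
    intro q hq
    rw [rootGraph, rootGrp] at hq
    induction hq using closure_induction with
    | mem q hq =>
      obtain ⟨i, j, t, -, hij, rfl⟩ := hq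
      refine ⟨z i j (φ t.1), z i j (ψ t.2), ?_, ?_, ?_⟩
      · rw [← hz.add i j hij]
        simp [hφ, hψ]
      · rw [SpMap_rootSp _ hij]
        exact mem_rootGrp trivial hij t.1
      · rw [SpMap_rootSp _ hij]
        exact mem_rootGrp trivial hij t.2
    | one => exact ⟨1, 1, by simp, by rw [Prod.snd_one, map_one]; exact one_mem _,
        by rw [Prod.snd_one, map_one]; exact one_mem _⟩
    | mul q r _ _ hq hr =>
      obtain ⟨y, y', e, hy, hy'⟩ := hq
      obtain ⟨x, x', e', hx, hx'⟩ := hr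
      refine ⟨y * x, y' * x', ?_, ?_, ?_⟩
      · rw [Prod.fst_mul, e, e', mul_assoc, ← mul_assoc y', ← (hcomm _ hx _ hy').eq]
        simp only [mul_assoc]
      · rw [Prod.snd_mul, map_mul]
        exact mul_mem hy hx
      · rw [Prod.snd_mul, map_mul]
        exact mul_mem hy' hx'
    | inv q _ hq =>
      obtain ⟨y, y', e, hy, hy'⟩ := hq
      refine ⟨y⁻¹, y'⁻¹, ?_, ?_, ?_⟩
      · rw [Prod.fst_inv, e, mul_inv_rev, (hcomm _ hy _ hy').inv_inv.eq]
      · rw [Prod.snd_inv, map_inv]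
        exact inv_mem hy
      · rw [Prod.snd_inv, map_inv]
        exact inv_mem hy'
  have key' : ∀ x : S, (x, (1 : Sp g (R × R'))) ∈ rootGraph z →
      ∃ y y', x = y * y' ∧ (y = 1 ∨ y = c) ∧ (y' = 1 ∨ y' = c') := by
    intro x hx
    obtain ⟨y, y', e, hy, hy'⟩ := key _ hx
    rw [map_one] at hy hy'
    exact ⟨y, y', e, h3 y hy, h3' y' hy'⟩
  rcases ho with ho | ho
  · refine ⟨c', h1', fun h => h2' h.2, fun x hx => ?_⟩
    obtain ⟨y, y', rfl, hy, hy'⟩ := key' x hx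
    have : y = 1 := by simpa [h2 ho] using hy
    simpa [this] using hy'
  · refine ⟨c, h1, fun h => h2 h.1, fun x hx => ?_⟩
    obtain ⟨y, y', rfl, hy, hy'⟩ := key' x hx
    have : y' = 1 := by simpa [h2' ho] using hy'
    simpa [this] using hy

theorem KerLeTwo.zmod (hg : 4 ≤ g) (n : ℕ) (hn : n ≠ 0) : KerLeTwo g (ZMod n) (Odd n) := by
  induction n using Nat.recOnPosPrimePosCoprime with
  | zero => exact absurd rfl hn
  | one => exact .of_subsingleton _
  | prime_pow p n hp h =>
    obtain ⟨k, rfl⟩ : ∃ k, n = k + 1 := ⟨n - 1, by omega⟩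
    have := Fact.mk hp
    refine (prime_pow hg p k).mono ?_
    rintro h rfl
    exact absurd h (by simp [Nat.even_pow, parity_simps])
  | coprime a b _ _ hab ha hb =>
    have ho : Odd a ∨ Odd b := by
      by_contra! h
      simp only [Nat.not_odd_iff_even] at h
      exact Nat.not_coprime_of_dvd_of_dvd one_lt_two h.1.two_dvd h.2.two_dvd hab
    exact ((prod hg (ha (by omega)) (hb (by omega)) ho).of_ringEquiv (ZMod.chineseRemainder hab)).mono
      Nat.odd_mul.1

/-- A family of integral root elements of period `n` has kernel of order at most two. -/
theorem SpDatum.exists_ker_of_periodic (hg : 4 ≤ g) {S : Type} [Group S] {z : Idx g → Idx g → ℤ → S}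
    (hz : SpDatum z) (n : ℕ) (hn : n ≠ 0)
    (h : ∀ i j, j ≠ SymplecticSteinberg.bar i → z i j n = 1) :
    ∃ c : S, c * c = 1 ∧ ∀ x : S, (x, (1 : Sp g ℤ)) ∈ rootGraph z → x = 1 ∨ x = c := by
  have : NeZero n := ⟨hn⟩
  have hw (i j : Idx g) (t : ℤ) (hij : j ≠ SymplecticSteinberg.bar i) :
      z i j ((t : ZMod n).val : ℤ) = z i j t := by
    have e : t = t % n + n * (t / n) := (Int.emod_add_mul_ediv t n).symm
    have e2 : z i j (n * (t / n)) = 1 := by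
      rw [hz.zpow i j hij, zpow_mul, ← hz.zpow i j hij, h i j hij, one_zpow]
    conv_rhs => rw [e, hz.add i j hij, e2, mul_one]
    rw [ZMod.val_intCast]
  obtain ⟨c, h1, -, h2⟩ := (KerLeTwo.zmod hg n hn).exists_of_factor hz
    (w := fun i j t => z i j t.val) (Int.castRingHom (ZMod n)) (ZMod.ringHom_surjective _) hw
  exact ⟨c, h1, h2⟩

end SymplecticSteinberg

namespace SymplecticSteinberg
open GpH2
variable {F : Type} [Group F]

/-- The group of 2-chains of the bar complex modulo boundaries. -/
abbrev ChainQuot (F : Type) [Group F] := ((F × F) →₀ ℤ) ⧸ B2 F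

/-- The class of a generator of the group of 2-chains. -/
def cls (a b : F) : ChainQuot F := (B2 F).mkQ (Finsupp.single (a, b) 1)

theorem cls_cocycle (a b c : F) : cls b c - cls (a * b) c + cls a (b * c) - cls a b = 0 := by
  simp only [cls, ← map_sub, ← map_add]
  rw [Submodule.mkQ_apply, Submodule.Quotient.mk_eq_zero]
  exact ⟨Finsupp.single (a, b, c) 1, by simp [d3]⟩

theorem cls_one_left (a : F) : cls 1 a = cls 1 1 := by
  have := cls_cocycle 1 1 a
  simpa [sub_eq_zero] using this

theorem cls_one_right (a : F) : cls a 1 = cls 1 1 := by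
  have := cls_cocycle a 1 1
  rw [mul_one, mul_one, sub_add_cancel, sub_eq_zero] at this
  exact this.symm

/-- The central extension of `F` by the 2-chains modulo boundaries
that is defined by the tautological cocycle. -/
@[ext] structure TautExt (F : Type) [Group F] where
  /-- the central component -/
  ctr : ChainQuot F
  /-- the component in the quotient -/
  pr : F

namespace TautExt

instance : Mul (TautExt F) := ⟨fun x y => ⟨x.ctr + y.ctr + cls x.pr y.pr, x.pr * y.pr⟩⟩
instance : One (TautExt F) := ⟨⟨-cls 1 1, 1⟩⟩
instance : Inv (TautExt F) := ⟨fun x => ⟨-x.ctr - cls 1 1 - cls x.pr⁻¹ x.pr, x.pr⁻¹⟩⟩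

@[simp] theorem mul_ctr (x y : TautExt F) : (x * y).ctr = x.ctr + y.ctr + cls x.pr y.pr := rfl
@[simp] theorem mul_pr (x y : TautExt F) : (x * y).pr = x.pr * y.pr := rfl
@[simp] theorem one_ctr : (1 : TautExt F).ctr = -cls 1 1 := rfl
@[simp] theorem one_pr : (1 : TautExt F).pr = 1 := rfl
@[simp] theorem inv_ctr (x : TautExt F) : x⁻¹.ctr = -x.ctr - cls 1 1 - cls x.pr⁻¹ x.pr := rfl
@[simp] theorem inv_pr (x : TautExt F) : x⁻¹.pr = x.pr⁻¹ := rfl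

instance : Group (TautExt F) := Group.ofLeftAxioms
  (fun x y z => TautExt.ext (by
    have := cls_cocycle x.pr y.pr z.pr
    simp only [mul_ctr, mul_pr]
    rw [← sub_eq_zero, ← neg_eq_zero, ← this]
    abel) (mul_assoc _ _ _))
  (fun x => TautExt.ext (by simp [cls_one_left x.pr]) (one_mul _))
  (fun x => TautExt.ext (by simp; abel) (inv_mul_cancel _))

/-- The projection of the tautological extension. -/
def proj : TautExt F →* F where
  toFun := pr
  map_one' := rfl
  map_mul' _ _ := rfl

@[simp] theorem proj_apply (x : TautExt F) : proj x = x.pr := rfl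

theorem proj_surjective : Function.Surjective (proj (F := F)) := fun f => ⟨⟨0, f⟩, rfl⟩

theorem ker_proj_le : (proj (F := F)).ker ≤ Subgroup.center (TautExt F) := by
  rintro ⟨m, f⟩ (rfl : f = 1)
  refine Subgroup.mem_center_iff.2 fun x => TautExt.ext ?_ (by simp)
  simp [cls_one_left x.pr, cls_one_right x.pr, add_comm]

/-- The inclusion of the kernel of the tautological extension. -/
def incl : Multiplicative (ChainQuot F) →* TautExt F where
  toFun m := ⟨m.toAdd - cls 1 1, 1⟩
  map_one' := TautExt.ext (by simp) rfl
  map_mul' m m' := TautExt.ext (by simp; abel) (by simp)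

theorem incl_injective : Function.Injective (incl (F := F)) := fun m m' h => by
  simpa [incl] using congrArg ctr h

theorem incl_eq {x y w : TautExt F} (h : x.pr * y.pr = w.pr) :
    incl (.ofAdd (x.ctr + y.ctr - w.ctr + cls x.pr y.pr)) = x * y * w⁻¹ := by
  rw [eq_mul_inv_iff_mul_eq]
  refine TautExt.ext ?_ ?_
  · simp [incl, cls_one_left w.pr]
    abel
  · simp [incl, h]

end TautExt

/-- The map from second homology to the 2-chains modulo boundaries. -/
def homologyIncl (F : Type) [Group F] : H2 F →ₗ[ℤ] ChainQuot F :=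
  Submodule.mapQ _ _ (Z2 F).subtype le_rfl

theorem homologyIncl_injective : Function.Injective (homologyIncl F) := by
  rw [← LinearMap.ker_eq_bot, homologyIncl, Submodule.ker_mapQ, Submodule.mkQ_map_self]

variable {G : Type} [Group G] (p : G →* F)

theorem incl_homologyIncl_mem {γ : G → TautExt F} (hγ : ∀ a, (γ a).pr = p a) {c : TautExt F}
    (hc : ∀ a b, γ a * γ b * (γ (a * b))⁻¹ = 1 ∨ γ a * γ b * (γ (a * b))⁻¹ = c) (x : H2 G) :
    TautExt.incl (.ofAdd (homologyIncl F (H2Map p x))) ∈ Subgroup.zpowers c := by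
  obtain ⟨⟨x, hx⟩, rfl⟩ := Submodule.Quotient.mk_surjective _ x
  let δ : G × G → ChainQuot F := fun q =>
    (γ q.1).ctr + (γ q.2).ctr - (γ (q.1 * q.2)).ctr + cls (γ q.1).pr (γ q.2).pr
  let U : AddSubgroup (ChainQuot F) := ((Subgroup.zpowers c).comap TautExt.incl).toAddSubgroup'
  have hδ (q : G × G) : δ q ∈ U := by
    change TautExt.incl _ ∈ Subgroup.zpowers c
    have h := TautExt.incl_eq (x := γ q.1) (y := γ q.2) (w := γ (q.1 * q.2)) (by simp [hγ])
    change TautExt.incl (.ofAdd (δ q)) = _ at h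
    refine (congrArg (· ∈ Subgroup.zpowers c) h).mpr ?_
    rcases hc q.1 q.2 with h | h <;> rw [h]
    exacts [one_mem _, Subgroup.mem_zpowers c]
  have key : (B2 F).mkQ ∘ₗ C2 p = Finsupp.linearCombination ℤ δ -
      Finsupp.linearCombination ℤ (fun a => (γ a).ctr) ∘ₗ d2 G := by
    refine Finsupp.lhom_ext fun q n => ?_
    simp only [LinearMap.comp_apply, C2_single, d2, Finsupp.linearCombination_single,
      LinearMap.sub_apply, map_smul, map_sub, map_add, one_smul, ← smul_sub, δ, hγ]
    rw [← Finsupp.smul_single_one, map_smul]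
    congr 1
    change cls _ _ = _
    abel
  change (B2 F).mkQ (C2 p x) ∈ U
  rw [← LinearMap.comp_apply, key, LinearMap.sub_apply, LinearMap.comp_apply,
    (show d2 G x = 0 from hx), map_zero, sub_zero, Finsupp.linearCombination_apply]
  exact sum_mem fun q _ => U.zsmul_mem (hδ q) _

theorem H2Map_range_of_lift {γ : G → TautExt F} (hγ : ∀ a, (γ a).pr = p a) {c : TautExt F}
    (hcc : c * c = 1)
    (hc : ∀ a b, γ a * γ b * (γ (a * b))⁻¹ = 1 ∨ γ a * γ b * (γ (a * b))⁻¹ = c) :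
    Nat.card (LinearMap.range (H2Map p)) ≤ 2 ∧ ∀ x : H2 G, 2 • H2Map p x = 0 := by
  have H (x : H2 G) := eq_one_or_eq_of_mem_zpowers hcc (incl_homologyIncl_mem p hγ hc x)
  constructor
  · let f : LinearMap.range (H2Map p) → ({1, c} : Set (TautExt F)) := fun y =>
      ⟨TautExt.incl (.ofAdd (homologyIncl F y)), by
        obtain ⟨_, x, rfl⟩ := y
        exact H x⟩
    have hf : Function.Injective f := fun y y' h =>
      Subtype.ext (homologyIncl_injective (TautExt.incl_injective (congrArg Subtype.val h)))
    exact (Nat.card_le_card_of_injective f hf).trans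
      ((Set.ncard_insert_le _ _).trans (by simp))
  · intro x
    apply homologyIncl_injective
    apply Multiplicative.ofAdd.injective
    apply TautExt.incl_injective
    rw [map_nsmul, ofAdd_nsmul, map_pow, map_zero, ofAdd_zero, map_one, sq]
    rcases H x with h | h <;> rw [h]
    exacts [one_mul 1, hcc]

theorem exists_lift_of_central {g : ℕ} (hg : 4 ≤ g) [Finite F] (p : Sp g ℤ →* F)
    {Γ : Type} [Group Γ] {π : Γ →* F} (hπ : Function.Surjective π)
    (hc : π.ker ≤ Subgroup.center Γ) :
    ∃ (γ : Sp g ℤ → Γ) (c : Γ), (∀ a, π (γ a) = p a) ∧ c * c = 1 ∧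
      ∀ a b, γ a * γ b * (γ (a * b))⁻¹ = 1 ∨ γ a * γ b * (γ (a * b))⁻¹ = c := by
  have hz := spDatum_liftFam hg hπ hc (p := p)
  have hmap : ∀ q ∈ rootGraph (liftFam hg hπ p), π q.1 = p q.2 := by
    have : rootGraph (liftFam hg hπ p) ≤ (π.comp (MonoidHom.fst _ _)).eqLocus
        (p.comp (MonoidHom.snd _ _)) :=
      rootGrp_le fun i j t _ h => map_liftFam hg hπ i j h t
    exact fun q hq => this hq
  have hex : ∀ a : Sp g ℤ, ∃ x, (x, a) ∈ rootGraph (liftFam hg hπ p) := by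
    have : (rootGraph (liftFam hg hπ p)).map (MonoidHom.snd _ _) = ⊤ := by
      rw [eq_top_iff, ← closure_rootSp_one, Subgroup.closure_le]
      rintro _ ⟨i, j, h, rfl⟩
      exact ⟨_, mem_rootGrp trivial h 1, rfl⟩
    intro a
    obtain ⟨⟨x, _⟩, hx, rfl⟩ := this.symm ▸ Subgroup.mem_top a
    exact ⟨x, hx⟩
  choose γ hγ using hex
  obtain ⟨c, h1, h2⟩ := hz.exists_ker_of_periodic hg (Nat.card F) Nat.card_pos.ne' fun i j h => by
    refine hz.eq_one_of_central hg _ (fun i j h => hc ?_) h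
    rw [MonoidHom.mem_ker, map_liftFam hg hπ i j h, spDatum_rootSp.zpow i j h, map_zpow,
      zpow_natCast, pow_card_eq_one']
  refine ⟨γ, c, fun a => hmap _ (hγ a), h1, fun a b => h2 _ ?_⟩
  simpa using mul_mem (mul_mem (hγ a) (hγ b)) (inv_mem (hγ (a * b)))

end SymplecticSteinberg

end

open GpH2 SpAux in
/-- **Theorem (Statement 1).** For `g ≥ 4` and any surjective homomorphism `p` from
`Sp(2g, ℤ)` onto a finite group `F`, the image of the induced map on second integral homology
is a subgroup of `H₂(F)` of order at most two; equivalently `2 • p₊(x) = 0` for all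
`x ∈ H₂(Sp(2g, ℤ))`. -/
theorem H2_image_finite_quotient_Sp (g : ℕ) (hg : 4 ≤ g) (F : Type) [Group F] [Finite F]
    (p : ↥(Sp g ℤ) →* F) (hp : Function.Surjective p) :
    Nat.card ↥(LinearMap.range (H2Map p)) ≤ 2 ∧
    ∀ x : H2 ↥(Sp g ℤ), 2 • H2Map p x = 0 := by
  obtain ⟨γ, c, h1, h2, h3⟩ := SymplecticSteinberg.exists_lift_of_central hg p
    SymplecticSteinberg.TautExt.proj_surjective SymplecticSteinberg.TautExt.ker_proj_le
  exact SymplecticSteinberg.H2Map_range_of_lift p h1 h2 h3
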